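/- There exists a constant μ > 0 such that for every ε > 0, the proportion of reduced fractions x = a/q ∈ (0,1] with gcd(a,q) = 1 and q ≤ Q that satisfy |log J(x) − μ·(log Q)·(log log Q)| ≤ ε·(log Q)·(log log Q) tends to 1 as Q → ∞. Equivalently, log J(x) ∼ μ (log Q) log log Q holds for a proportion 1 − o(1) of fractions x ∈ (0,1] ∩ ℚ of reduced denominator at most Q. -/

import Mathlib

open Real Filter Finset

/-- The Kashaev invariant of the figure-eight knot `4₁`:
`J(x) = ∑_{n≥0} ∏_{r=1}^n |1 - e^{2πirx}|²`. For `x` of reduced denominator `q`, all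
terms with `n ≥ q` vanish, so the series is a finite sum. -/
noncomputable def kashaevJ (x : ℚ) : ℝ :=
  ∑' n : ℕ, ∏ r ∈ Finset.Icc 1 n,
    ‖1 - Complex.exp (2 * (π : ℂ) * Complex.I * r * (x : ℂ))‖ ^ 2

/-- The reduced fractions `a/q ∈ (0,1]` with denominator `q ≤ Q`, encoded as pairs. -/
def fracs (Q : ℕ) : Finset (ℕ × ℕ) :=
  (Finset.Icc 1 Q ×ˢ Finset.Icc 1 Q).filter (fun p => p.1 ≤ p.2 ∧ Nat.Coprime p.1 p.2)

/-- The odd part of `log (R + d)`, doubled and with its linear term removed. -/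
noncomputable def oddLogTerm (R d : ℝ) : ℝ := log (R + d) - log (R - d) - 2 * d / R

/-- The points `b + a x + (1 + x) / 2` of a shifted quadrant of the lattice `ℤ + x ℤ`. -/
noncomputable def quadrantPoint (x : ℝ) (v : ℕ × ℕ) : ℝ := v.1 + v.2 * x + (1 + x) / 2

/-- The logarithm of the double sine function with periods `1` and `x`, centred at the midpoint
of its strip and up to a linear term. -/
noncomputable def quadrantLog (x d : ℝ) : ℝ := ∑' v, oddLogTerm (quadrantPoint x v) d

lemma abs_oddLogTerm_le {R d : ℝ} (hd : |d| < R) :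
    |oddLogTerm R d| ≤ 2 * |d| ^ 3 / (R ^ 2 * (R - |d|)) := by
  have hR : 0 < R := (abs_nonneg d).trans_lt hd
  set u := d / R with hu
  have hdu : d = R * u := by rw [hu]; field_simp
  have hau : |u| = |d| / R := by rw [hu, abs_div, abs_of_pos hR]
  have hu1 : |u| < 1 := by rw [hau, div_lt_one hR]; exact hd
  have h1 := abs_log_sub_add_sum_range_le hu1 2
  have h2 := abs_log_sub_add_sum_range_le (x := -u) (by rwa [abs_neg]) 2
  obtain ⟨hl, hr⟩ := abs_lt.mp hu1
  have e : oddLogTerm R d = log (1 + u) - log (1 - u) - 2 * u := by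
    have a1 : R + d = R * (1 + u) := by rw [hdu]; ring
    have a2 : R - d = R * (1 - u) := by rw [hdu]; ring
    have a3 : 2 * d / R = 2 * u := by rw [hdu]; field_simp
    rw [oddLogTerm, a1, a2, a3, log_mul hR.ne' (by linarith), log_mul hR.ne' (by linarith)]
    ring
  have e2 : 2 * |d| ^ 3 / (R ^ 2 * (R - |d|)) = 2 * (|u| ^ 3 / (1 - |u|)) := by
    have : R - |d| ≠ 0 := by linarith
    have h1u : 1 - |d| / R ≠ 0 := by rw [← hau]; linarith
    rw [hau]
    field_simp
  rw [e, e2]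
  simp only [sum_range_succ, range_zero, sum_empty, abs_neg, sub_neg_eq_add] at h1 h2
  norm_num at h1 h2
  rw [abs_le] at h1 h2 ⊢
  constructor <;> nlinarith [h1.1, h1.2, h2.1, h2.2]

lemma quadrantPoint_ge {x : ℝ} (hx : 0 < x) (v : ℕ × ℕ) : (1 + x) / 2 ≤ quadrantPoint x v := by
  unfold quadrantPoint
  have : (0 : ℝ) ≤ v.1 + v.2 * x := by positivity
  linarith

lemma summable_inv_quadrantPoint_cube {x : ℝ} (hx : 0 < x) :
    Summable fun v : ℕ × ℕ => 1 / quadrantPoint x v ^ 3 := by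
  have h0 : Summable fun n : ℕ => 1 / ((n : ℝ) + 1 / 2) ^ (3 / 2 : ℝ) := by
    have := (Real.summable_one_div_nat_add_rpow (1 / 2) (3 / 2)).mpr (by norm_num)
    refine this.congr fun n => ?_
    rw [abs_of_pos (by positivity)]
  have h1 : Summable fun v : ℕ × ℕ =>
      (1 / ((v.1 : ℝ) + 1 / 2) ^ (3 / 2 : ℝ)) * (1 / ((v.2 : ℝ) + 1 / 2) ^ (3 / 2 : ℝ)) :=
    h0.mul_of_nonneg h0 (fun n => by positivity) (fun n => by positivity)
  refine Summable.of_nonneg_of_le (fun v => ?_) (fun v => ?_) (h1.mul_left (1 / x ^ (3 / 2 : ℝ)))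
  · have := quadrantPoint_ge hx v
    have : 0 < quadrantPoint x v := by linarith
    positivity
  · have hq : quadrantPoint x v = ((v.1 : ℝ) + 1 / 2) + x * ((v.2 : ℝ) + 1 / 2) := by
      unfold quadrantPoint; ring
    set A : ℝ := (v.1 : ℝ) + 1 / 2
    set B : ℝ := (v.2 : ℝ) + 1 / 2
    have hA : 0 < A := by positivity
    have hB : 0 < B := by positivity
    have hS : 0 < A + x * B := by positivity
    have hcube : (A + x * B) ^ 3 = ((A + x * B) ^ 2) ^ (3 / 2 : ℝ) := by
      rw [← rpow_natCast, ← rpow_natCast, ← rpow_mul hS.le]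
      norm_num
    have hprod : 1 / x ^ (3 / 2 : ℝ) * (1 / A ^ (3 / 2 : ℝ) * (1 / B ^ (3 / 2 : ℝ))) =
        1 / (x * (A * B)) ^ (3 / 2 : ℝ) := by
      rw [mul_rpow hx.le (by positivity), mul_rpow hA.le hB.le]
      field_simp
    rw [hq, hprod, hcube]
    refine one_div_le_one_div_of_le (by positivity)
      (rpow_le_rpow (by positivity) ?_ (by norm_num))
    nlinarith [sq_nonneg (A - x * B), mul_pos hA (mul_pos hx hB)]

lemma summable_oddLogTerm {x d : ℝ} (hx : 0 < x) (hd : |d| < (1 + x) / 2) :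
    Summable fun v => oddLogTerm (quadrantPoint x v) d := by
  refine Summable.of_norm_bounded ((summable_inv_quadrantPoint_cube hx).mul_left
    (2 * |d| ^ 3 * ((1 + x) / 2) / ((1 + x) / 2 - |d|))) fun v => ?_
  have hq := quadrantPoint_ge hx v
  have hc : 0 < (1 + x) / 2 := by linarith
  rw [norm_eq_abs]
  refine (abs_oddLogTerm_le (hd.trans_le hq)).trans ?_
  set R := quadrantPoint x v
  have hR : 0 < R := by linarith
  have hRd : 0 < R - |d| := by linarith
  have hcd : 0 < (1 + x) / 2 - |d| := by linarith
  rw [div_mul_div_comm, mul_one, div_le_div_iff₀ (by positivity) (by positivity)]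
  have : ((1 + x) / 2 - |d|) * R ≤ (1 + x) / 2 * (R - |d|) := by nlinarith [abs_nonneg d]
  have h2 : 0 ≤ 2 * |d| ^ 3 * R ^ 2 := by positivity
  nlinarith [mul_le_mul_of_nonneg_left this h2]

lemma quadrantLog_neg (x d : ℝ) : quadrantLog x (-d) = -quadrantLog x d := by
  rw [quadrantLog, quadrantLog, ← tsum_neg]
  congr 1; ext v; unfold oddLogTerm; ring_nf

lemma quadrantLog_inv {x : ℝ} (hx : 0 < x) (d : ℝ) (hd : |d| < (1 + x) / 2) :
    quadrantLog x⁻¹ (d / x) = quadrantLog x d := by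
  rw [quadrantLog, quadrantLog, ← (Equiv.prodComm ℕ ℕ).tsum_eq]
  congr 1; ext v
  have hq := quadrantPoint_ge hx v
  have e : quadrantPoint x⁻¹ ((Equiv.prodComm ℕ ℕ) v) = quadrantPoint x v / x := by
    unfold quadrantPoint; simp only [Equiv.prodComm_apply, Prod.fst_swap, Prod.snd_swap]
    field_simp; ring
  rw [e]
  set R := quadrantPoint x v
  obtain ⟨h1, h2⟩ := abs_lt.mp hd
  unfold oddLogTerm
  rw [← add_div, ← sub_div, log_div (by linarith) hx.ne', log_div (by linarith) hx.ne']
  have : R ≠ 0 := by linarith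
  field_simp
  ring

lemma hasSum_oddLogTerm {R d : ℝ} (hd : |d| < R) :
    HasSum (fun k : ℕ => 2 * (1 / (2 * ((k + 1 : ℕ) : ℝ) + 1)) * (d / R) ^ (2 * (k + 1) + 1))
      (oddLogTerm R d) := by
  have hR : 0 < R := (abs_nonneg d).trans_lt hd
  obtain ⟨hl, hr⟩ := abs_lt.mp hd
  have hu1 : |d / R| < 1 := by rw [abs_div, abs_of_pos hR, div_lt_one hR]; exact hd
  have h := (hasSum_nat_add_iff' 1).mpr (hasSum_log_sub_log_of_abs_lt_one hu1)
  have a1 : 1 + d / R = (R + d) / R := by field_simp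
  have a2 : 1 - d / R = (R - d) / R := by field_simp
  rw [a1, a2, log_div (by linarith) hR.ne', log_div (by linarith) hR.ne'] at h
  have e : oddLogTerm R d = log (R + d) - log R - (log (R - d) - log R) -
      ∑ i ∈ range 1, 2 * (1 / (2 * (i : ℝ) + 1)) * (d / R) ^ (2 * i + 1) := by
    simp [oddLogTerm]
    ring
  rw [e]
  exact h

lemma convexOn_oddLogTerm {R c : ℝ} (hc : c ≤ R) : ConvexOn ℝ (Set.Ico 0 c) (oddLogTerm R) := by
  refine ⟨convex_Ico 0 c, fun d hd e he a b ha hb hab => ?_⟩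
  have hm := convex_Ico 0 c hd he ha hb hab
  have habs : ∀ t ∈ Set.Ico 0 c, |t| < R := fun t ht => by
    rw [abs_of_nonneg ht.1]; linarith [ht.2]
  have hR : 0 < R := (abs_nonneg d).trans_lt (habs d hd)
  refine hasSum_le (fun k => ?_) (hasSum_oddLogTerm (habs _ hm))
    (((hasSum_oddLogTerm (habs d hd)).mul_left a).add ((hasSum_oddLogTerm (habs e he)).mul_left b))
  have h := (convexOn_pow (𝕜 := ℝ) (2 * (k + 1) + 1)).2
    (show d / R ∈ Set.Ici (0 : ℝ) from div_nonneg hd.1 hR.le)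
    (show e / R ∈ Set.Ici (0 : ℝ) from div_nonneg he.1 hR.le) ha hb hab
  simp only [smul_eq_mul] at h ⊢
  have e1 : (a * d + b * e) / R = a * (d / R) + b * (e / R) := by ring
  rw [e1]
  have hpos : (0 : ℝ) ≤ 2 * (1 / (2 * ((k + 1 : ℕ) : ℝ) + 1)) := by positivity
  nlinarith [mul_le_mul_of_nonneg_left h hpos]

lemma convexOn_quadrantLog {x : ℝ} (hx : 0 < x) :
    ConvexOn ℝ (Set.Ico 0 ((1 + x) / 2)) (quadrantLog x) := by
  refine ⟨convex_Ico _ _, fun d hd e he a b ha hb hab => ?_⟩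
  have hm := convex_Ico _ _ hd he ha hb hab
  have habs : ∀ t ∈ Set.Ico 0 ((1 + x) / 2), |t| < (1 + x) / 2 := fun t ht => by
    rw [abs_of_nonneg ht.1]; exact ht.2
  refine hasSum_le (fun v => (convexOn_oddLogTerm (quadrantPoint_ge hx v)).2 hd he ha hb hab)
    (summable_oddLogTerm hx (habs _ hm)).hasSum ?_
  exact ((summable_oddLogTerm hx (habs _ hd)).hasSum.mul_left a).add
    ((summable_oddLogTerm hx (habs _ he)).hasSum.mul_left b)

lemma tendsto_sum_log_sin {z : ℝ} (h0 : 0 < z) (h1 : z < 1) :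
    Tendsto (fun B : ℕ => ∑ b ∈ range B,
      (log (b + (1 - z)) + log (b + z) - 2 * log ((b : ℝ) + 1 / 2)))
      atTop (nhds (log (sin (π * z)))) := by
  have hsin : 0 < sin (π * z) := sin_pos_of_pos_of_lt_pi (by positivity) (by nlinarith [pi_pos])
  rw [← tendsto_add_atTop_iff_nat 1]
  have hG : Tendsto (fun n => GammaSeq (1 / 2) n * GammaSeq (1 / 2) n /
      (GammaSeq z n * GammaSeq (1 - z) n)) atTop (nhds (sin (π * z))) := by
    have hh := (GammaSeq_tendsto_Gamma (1 / 2)).mul (GammaSeq_tendsto_Gamma (1 / 2))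
    have hz := (GammaSeq_tendsto_Gamma z).mul (GammaSeq_tendsto_Gamma (1 - z))
    have e1 := Gamma_mul_Gamma_one_sub (1 / 2)
    have e2 := Gamma_mul_Gamma_one_sub z
    norm_num at e1
    rw [mul_one_div, sin_pi_div_two, div_one] at e1
    have e3 : Gamma (1 / 2) * Gamma (1 / 2) / (Gamma z * Gamma (1 - z)) = sin (π * z) := by
      rw [e1, e2]; field_simp
    rw [← e3]
    refine hh.div hz ?_
    rw [e2]
    exact (div_pos pi_pos hsin).ne'
  have hlog := (continuousAt_log hsin.ne').tendsto.comp hG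
  refine hlog.congr' ?_
  filter_upwards [eventually_gt_atTop 0] with n hn
  have hn' : (0 : ℝ) < n := by exact_mod_cast hn
  have hpos : ∀ s : ℝ, 0 < s → 0 < ∏ j ∈ range (n + 1), (s + j) := fun s hs =>
    prod_pos fun j _ => by positivity
  have hlogG : ∀ s : ℝ, 0 < s → 0 < GammaSeq s n ∧ log (GammaSeq s n) =
      s * log n + log (n.factorial) - ∑ j ∈ range (n + 1), log (s + j) := fun s hs => by
    have hf : (0 : ℝ) < n.factorial := by exact_mod_cast n.factorial_pos
    have hr : (0 : ℝ) < (n : ℝ) ^ s := rpow_pos_of_pos hn' s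
    refine ⟨div_pos (mul_pos hr hf) (hpos s hs), ?_⟩
    rw [GammaSeq, log_div (mul_pos hr hf).ne' (hpos s hs).ne', log_mul hr.ne' hf.ne',
      log_rpow hn', log_prod fun j _ => by positivity]
  obtain ⟨p1, l1⟩ := hlogG (1 / 2) (by norm_num)
  obtain ⟨p2, l2⟩ := hlogG z h0
  obtain ⟨p3, l3⟩ := hlogG (1 - z) (by linarith)
  simp only [Function.comp_apply]
  rw [log_div (by positivity) (by positivity), log_mul p1.ne' p1.ne', log_mul p2.ne' p3.ne',
    l1, l2, l3]
  simp only [sum_sub_distrib, sum_add_distrib, ← mul_sum]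
  simp only [add_comm]
  ring

lemma tendsto_log_add_sub_log_add {x : ℝ} (hx : 0 < x) (c e : ℝ) (hc : 0 < c) (he : 0 < e) :
    Tendsto (fun n : ℕ => log (n * x + c) - log (n * x + e)) atTop (nhds 0) := by
  have hlin : Tendsto (fun n : ℕ => (n : ℝ) * x + e) atTop atTop :=
    tendsto_atTop_add_const_right _ _ (tendsto_natCast_atTop_atTop.atTop_mul_const hx)
  have h1 : Tendsto (fun n : ℕ => 1 + (c - e) / (n * x + e)) atTop (nhds (1 + 0)) :=
    tendsto_const_nhds.add (hlin.const_div_atTop _)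
  rw [add_zero] at h1
  have h2 := (continuousAt_log one_ne_zero).tendsto.comp h1
  rw [log_one] at h2
  refine h2.congr fun n => ?_
  have a : (0 : ℝ) < n * x + e := by positivity
  have b : (0 : ℝ) < n * x + c := by positivity
  simp only [Function.comp_apply]
  rw [← log_div b.ne' a.ne']
  congr 1
  field_simp
  ring

/-- The first functional equation of the double sine function, up to a constant. -/
lemma quadrantLog_shift {x z : ℝ} (hx : 0 < x) (h0 : 0 < z) (h1 : z < 1) :
    quadrantLog x ((1 - x) / 2 - z) - quadrantLog x ((1 + x) / 2 - z) =
      log (sin (π * z)) - 2 * quadrantLog x (x / 2) := by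
  have s1 : Summable _ := summable_oddLogTerm (d := (1 - x) / 2 - z) hx (by
    rw [abs_lt]; constructor <;> linarith)
  have s2 : Summable _ := summable_oddLogTerm (d := (1 + x) / 2 - z) hx (by
    rw [abs_lt]; constructor <;> linarith)
  have s3 : Summable _ := summable_oddLogTerm (d := x / 2) hx (by
    rw [abs_lt]; constructor <;> linarith)
  set G : ℕ → ℕ → ℝ := fun b a =>
    log (a * x + (b + (1 - z))) - log (a * x + (b + 1 / 2)) +
      (log (a * x + (b + z)) - log (a * x + (b + 1 / 2))) with hG
  have hterm : ∀ v : ℕ × ℕ, oddLogTerm (quadrantPoint x v) ((1 - x) / 2 - z) -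
      oddLogTerm (quadrantPoint x v) ((1 + x) / 2 - z) +
      2 * oddLogTerm (quadrantPoint x v) (x / 2) = G v.1 v.2 - G v.1 (v.2 + 1) := fun v => by
    have hq : quadrantPoint x v ≠ 0 := by linarith [quadrantPoint_ge hx v]
    simp only [oddLogTerm, hG]
    have e : ∀ w : ℝ, 2 * w / quadrantPoint x v = w * (2 / quadrantPoint x v) := fun w => by ring
    simp only [e]
    simp only [quadrantPoint]
    push_cast
    ring_nf
  have hs : Summable fun v : ℕ × ℕ => G v.1 v.2 - G v.1 (v.2 + 1) :=
    ((s1.sub s2).add (s3.mul_left 2)).congr fun v => hterm v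
  have hlhs : quadrantLog x ((1 - x) / 2 - z) - quadrantLog x ((1 + x) / 2 - z) +
      2 * quadrantLog x (x / 2) = ∑' v : ℕ × ℕ, (G v.1 v.2 - G v.1 (v.2 + 1)) := by
    rw [quadrantLog, quadrantLog, quadrantLog, ← s1.tsum_sub s2, ← tsum_mul_left,
      ← (s1.sub s2).tsum_add (s3.mul_left 2)]
    exact tsum_congr hterm
  have hinner : ∀ b, ∑' a, (G b a - G b (a + 1)) = G b 0 := fun b => by
    have hsb : Summable fun a => G b a - G b (a + 1) := hs.prod_factor b
    refine tendsto_nhds_unique hsb.hasSum.tendsto_sum_nat ?_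
    simp only [sum_range_sub']
    have t : Tendsto (G b) atTop (nhds (0 + 0)) :=
      (tendsto_log_add_sub_log_add hx _ _ (add_pos_of_nonneg_of_pos b.cast_nonneg (by linarith)) (by positivity)).add
        (tendsto_log_add_sub_log_add hx _ _ (by positivity) (by positivity))
    simpa using t.const_sub (G b 0)
  have houter : ∑' b, G b 0 = log (sin (π * z)) := by
    have hsb : Summable fun b => G b 0 := hs.prod.congr hinner
    refine tendsto_nhds_unique hsb.hasSum.tendsto_sum_nat ((tendsto_sum_log_sin h0 h1).congr ?_)
    intro B
    refine sum_congr rfl fun b _ => ?_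
    simp only [hG]
    norm_num
    ring
  have : ∑' v : ℕ × ℕ, (G v.1 v.2 - G v.1 (v.2 + 1)) = log (sin (π * z)) := by
    rw [hs.tsum_prod, ← houter]
    exact tsum_congr hinner
  linarith

/-- The logarithm of the double sine function with periods `1` and `x`. -/
noncomputable def doubleSineLog (x z : ℝ) : ℝ :=
  quadrantLog x ((1 + x) / 2 - z) -
    (log 2 + 2 * quadrantLog x (x / 2)) / x * ((1 + x) / 2 - z)

/-- The defect in the second functional equation of `doubleSineLog x`; it vanishes for
rational `x`. -/
noncomputable def doubleSineDefect (x : ℝ) : ℝ :=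
  (log 2 + 2 * quadrantLog x (x / 2)) / x - 2 * quadrantLog x (1 / 2) - log 2

lemma doubleSineLog_reflect (x z : ℝ) : doubleSineLog x (1 + x - z) = -doubleSineLog x z := by
  have e : (1 + x) / 2 - (1 + x - z) = -((1 + x) / 2 - z) := by ring
  rw [doubleSineLog, doubleSineLog, e, quadrantLog_neg]
  ring

lemma doubleSineLog_add_self {x z : ℝ} (hx : 0 < x) (h0 : 0 < z) (h1 : z < 1) :
    doubleSineLog x (z + x) = doubleSineLog x z + log (2 * sin (π * z)) := by
  have h := quadrantLog_shift hx h0 h1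
  have hsin : 0 < sin (π * z) := sin_pos_of_pos_of_lt_pi (by positivity) (by nlinarith [pi_pos])
  have e : (1 + x) / 2 - (z + x) = (1 - x) / 2 - z := by ring
  rw [doubleSineLog, doubleSineLog, e, log_mul two_ne_zero hsin.ne']
  have e2 : (log 2 + 2 * quadrantLog x (x / 2)) / x * ((1 - x) / 2 - z) =
      (log 2 + 2 * quadrantLog x (x / 2)) / x * ((1 + x) / 2 - z) -
        (log 2 + 2 * quadrantLog x (x / 2)) := by field_simp; ring
  rw [e2]
  linarith

lemma doubleSineLog_add_one {x z : ℝ} (hx : 0 < x) (h0 : 0 < z) (h1 : z < x) :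
    doubleSineLog x (z + 1) =
      doubleSineLog x z + log (2 * sin (π * (z / x))) + doubleSineDefect x := by
  have hzx : z / x < 1 := (div_lt_one hx).mpr h1
  have h := quadrantLog_shift (inv_pos.mpr hx) (div_pos h0 hx) hzx
  have hsin : 0 < sin (π * (z / x)) :=
    sin_pos_of_pos_of_lt_pi (by positivity) (by nlinarith [pi_pos])
  have e1 : (1 - x⁻¹) / 2 - z / x = ((1 + x) / 2 - (z + 1)) / x := by field_simp; ring
  have e2 : (1 + x⁻¹) / 2 - z / x = ((1 + x) / 2 - z) / x := by field_simp; ring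
  have e3 : x⁻¹ / 2 = 1 / 2 / x := by field_simp
  rw [e1, e2, e3, quadrantLog_inv hx _ (by rw [abs_lt]; constructor <;> linarith),
    quadrantLog_inv hx _ (by rw [abs_lt]; constructor <;> linarith),
    quadrantLog_inv hx _ (by rw [abs_lt]; constructor <;> linarith)] at h
  rw [doubleSineLog, doubleSineLog, doubleSineDefect, log_mul two_ne_zero hsin.ne']
  linarith

lemma doubleSineLog_half {x : ℝ} (hx : 0 < x) : doubleSineLog x (1 / 2) = -(log 2 / 2) := by
  have e : (1 + x) / 2 - 1 / 2 = x / 2 := by ring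
  rw [doubleSineLog, e]
  field_simp
  ring

/-- In the coordinate `d = (1 + x) / 2 - z` the double sine logarithm is convex for `d ≥ 0`. -/
lemma convexOn_doubleSineLog {x : ℝ} (hx : 0 < x) :
    ConvexOn ℝ (Set.Ico 0 ((1 + x) / 2)) (fun d => doubleSineLog x ((1 + x) / 2 - d)) := by
  have h : (fun d => doubleSineLog x ((1 + x) / 2 - d)) =
      fun d => quadrantLog x d + -((log 2 + 2 * quadrantLog x (x / 2)) / x) * d := by
    ext d
    simp only [doubleSineLog, sub_sub_cancel]
    ring
  rw [h]
  refine (convexOn_quadrantLog hx).add ⟨convex_Ico _ _, fun a _ b _ s t _ _ _ => ?_⟩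
  simp only [smul_eq_mul]
  apply le_of_eq
  ring

lemma continuousAt_doubleSineLog_self {x : ℝ} (hx : 0 < x) (hx1 : x < 1) :
    ContinuousAt (doubleSineLog x) x := by
  have h := (convexOn_doubleSineLog hx).continuousOn_interior
  rw [interior_Ico] at h
  have h2 := h.continuousAt (x := (1 + x) / 2 - x)
    (Ioo_mem_nhds (by linarith) (by linarith))
  have h3 : ContinuousAt (fun z => (1 + x) / 2 - z) x := by fun_prop
  have := ContinuousAt.comp (f := fun z => (1 + x) / 2 - z) h2 h3
  simpa [Function.comp_def] using this

lemma tendsto_sin_mul_div (c : ℝ) :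
    Tendsto (fun z => sin (c * z) / z) (nhdsWithin 0 (Set.Ioi 0)) (nhds c) := by
  have h : HasDerivAt (fun z => sin (c * z)) c 0 := by
    simpa using ((hasDerivAt_id (0 : ℝ)).const_mul c).sin
  have := h.tendsto_slope_zero_right
  simp only [zero_add, mul_zero, sin_zero, sub_zero, smul_eq_mul] at this
  exact this.congr fun z => by ring

/-- The value at `x` of the double sine logarithm, in terms of the defect. -/
lemma two_mul_doubleSineLog_self {x : ℝ} (hx : 0 < x) (hx1 : x < 1) :
    -(2 * doubleSineLog x x) = log (1 / x) + doubleSineDefect x := by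
  have hc := continuousAt_doubleSineLog_self hx hx1
  have t0 : Tendsto (fun z : ℝ => z) (nhdsWithin 0 (Set.Ioi 0)) (nhds 0) :=
    tendsto_nhdsWithin_of_tendsto_nhds tendsto_id
  have t1 : Tendsto (fun z : ℝ => doubleSineLog x (x - z)) (nhdsWithin 0 (Set.Ioi 0))
      (nhds (doubleSineLog x x)) := hc.tendsto.comp (by simpa using t0.const_sub x)
  have t2 : Tendsto (fun z : ℝ => doubleSineLog x (z + x)) (nhdsWithin 0 (Set.Ioi 0))
      (nhds (doubleSineLog x x)) := hc.tendsto.comp (by simpa using t0.add_const x)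
  have t3 : Tendsto (fun z : ℝ => log (sin (π / x * z) / z / (sin (π * z) / z)))
      (nhdsWithin 0 (Set.Ioi 0)) (nhds (log (1 / x))) := by
    have := (tendsto_sin_mul_div (π / x)).div (tendsto_sin_mul_div π) pi_pos.ne'
    have e : π / x / π = 1 / x := by field_simp
    rw [e] at this
    exact (continuousAt_log (by positivity)).tendsto.comp this
  have t4 := (t1.add t2).neg
  have t5 := t3.add_const (doubleSineDefect x)
  rw [← two_mul] at t4
  refine tendsto_nhds_unique t4 (t5.congr' ?_)
  filter_upwards [Ioo_mem_nhdsGT (show (0 : ℝ) < x from hx)] with z hz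
  have h1 := doubleSineLog_add_self hx hz.1 (hz.2.trans hx1)
  have h2 := doubleSineLog_add_one hx hz.1 hz.2
  have h3 := doubleSineLog_reflect x (x - z)
  have e : 1 + x - (x - z) = z + 1 := by ring
  rw [e] at h3
  have hzx : z / x < 1 := (div_lt_one hx).mpr hz.2
  have hz0 := hz.1
  have s1 : 0 < sin (π * (z / x)) :=
    sin_pos_of_pos_of_lt_pi (by positivity) (by nlinarith [pi_pos])
  have s2 : 0 < sin (π * z) :=
    sin_pos_of_pos_of_lt_pi (by positivity) (by nlinarith [pi_pos, hz.2])
  rw [log_mul two_ne_zero s1.ne'] at h2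
  rw [log_mul two_ne_zero s2.ne'] at h1
  have e2 : π / x * z = π * (z / x) := by ring
  rw [e2, div_div_div_cancel_right₀ hz0.ne', log_div s1.ne' s2.ne']
  linarith

/-- The logarithm of `∏_{r=1}^n |1 - e^{2πiry}|`, written with sines. -/
noncomputable def sineLogSum (n : ℕ) (y : ℝ) : ℝ :=
  ∑ r ∈ range n, log |2 * sin (π * ((r + 1 : ℕ) * y))|

lemma sineLogSum_zero (y : ℝ) : sineLogSum 0 y = 0 := by simp [sineLogSum]

lemma sineLogSum_succ (n : ℕ) (y : ℝ) :
    sineLogSum (n + 1) y = sineLogSum n y + log |2 * sin (π * ((n + 1 : ℕ) * y))| := by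
  rw [sineLogSum, sum_range_succ, sineLogSum]

lemma abs_sin_pi_mul_sub_nat (y : ℝ) (m : ℕ) : |sin (π * (y - m))| = |sin (π * y)| := by
  rw [show π * (y - m) = π * y - m * π by ring, sin_sub_nat_mul_pi]
  rw [abs_mul, abs_pow]
  simp

lemma abs_sin_pi_mul_nat_sub (y : ℝ) (m : ℕ) : |sin (π * (m - y))| = |sin (π * y)| := by
  rw [← abs_sin_pi_mul_sub_nat y m, show π * (m - y) = -(π * (y - m)) by ring, sin_neg, abs_neg]

lemma sineLogSum_add_nat (n : ℕ) (y : ℝ) (m : ℕ) : sineLogSum n (y + m) = sineLogSum n y := by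
  refine sum_congr rfl fun r _ => ?_
  rw [abs_mul, abs_mul]
  have h := abs_sin_pi_mul_sub_nat ((r + 1 : ℕ) * (y + m)) ((r + 1) * m)
  rw [← h]
  congr 5
  push_cast
  ring

lemma norm_one_sub_exp (y : ℝ) :
    ‖1 - Complex.exp (2 * π * Complex.I * y)‖ = |2 * sin (π * y)| := by
  have h := Complex.norm_exp_I_mul_ofReal_sub_one (2 * π * y)
  rw [norm_sub_rev]
  rw [show (2 * π * Complex.I * y : ℂ) = Complex.I * ((2 * π * y : ℝ) : ℂ) by push_cast; ring, h]
  rw [norm_eq_abs, show 2 * π * y / 2 = π * y by ring]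

lemma sineLogSum_pred {p q : ℕ} (hq : 0 < q) (hpq : p.Coprime q) :
    sineLogSum (q - 1) (p / q) = log q := by
  obtain ⟨m, rfl⟩ : ∃ m, q = m + 1 := ⟨q - 1, by omega⟩
  have hζ := Complex.isPrimitiveRoot_exp_of_coprime p (m + 1) (by omega) hpq
  have h := hζ.prod_one_sub_pow_eq_order
  have h2 : ∏ k ∈ range m, |2 * sin (π * ((k + 1 : ℕ) * ((p : ℝ) / (m + 1 : ℕ))))| = m + 1 := by
    have h3 := congrArg (fun z : ℂ => ‖z‖) h
    simp only [norm_prod] at h3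
    have h4 : ‖(m : ℂ) + 1‖ = m + 1 := by
      rw [show (m : ℂ) + 1 = ((m + 1 : ℕ) : ℂ) by push_cast; ring, Complex.norm_natCast]
      push_cast; ring
    rw [h4] at h3
    rw [← h3]
    refine prod_congr rfl fun k _ => ?_
    rw [← norm_one_sub_exp, ← Complex.exp_nat_mul]
    congr 3
    push_cast
    ring
  rw [Nat.add_sub_cancel, sineLogSum, ← log_prod, h2]
  · push_cast; rfl
  · intro i hi h0
    have := prod_eq_zero (f := fun k : ℕ =>
      |2 * sin (π * ((k + 1 : ℕ) * ((p : ℝ) / (m + 1 : ℕ))))|) hi h0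
    rw [h2] at this
    exact absurd this (by positivity)

lemma sineLogSum_reciprocity_aux {p q : ℕ} (hp : 0 < p) (hpq : p.Coprime q) {n M : ℕ}
    (hn : n < q) (h1 : M * q < (n + 1) * p) (h2 : n * p < (M + 1) * q) :
    sineLogSum n (p / q) = sineLogSum M (q / p) + M * doubleSineDefect (p / q) +
      doubleSineLog (p / q) ((n + 1 : ℕ) * (p / q) - M) - doubleSineLog (p / q) (p / q) := by
  have hq : 0 < q := by omega
  have hp' : (0 : ℝ) < p := by exact_mod_cast hp
  have hq' : (0 : ℝ) < q := by exact_mod_cast hq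
  have hx : (0 : ℝ) < p / q := by positivity
  generalize hs : n + M = s
  induction s generalizing n M with
  | zero =>
    obtain ⟨rfl, rfl⟩ : n = 0 ∧ M = 0 := by omega
    simp [sineLogSum_zero]
  | succ s ih =>
    rcases lt_trichotomy (n * p) (M * q) with h | h | h
    · obtain ⟨M, rfl⟩ : ∃ m, M = m + 1 := ⟨M - 1, by
        have : M ≠ 0 := by rintro rfl; simp at h
        omega⟩
      rw [ih hn (by nlinarith) h (by omega), sineLogSum_succ]
      set z : ℝ := (n + 1 : ℕ) * (p / q) - (M + 1 : ℕ) with hz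
      have z0 : 0 < z := by
        rw [hz, sub_pos, ← mul_div_assoc, lt_div_iff₀ hq']
        exact_mod_cast h1
      have z1 : z < p / q := by
        have : (n : ℝ) * (p / q) < (M + 1 : ℕ) := by
          rw [← mul_div_assoc, div_lt_iff₀ hq']
          exact_mod_cast h
        rw [hz]; push_cast at this ⊢; nlinarith
      have key := doubleSineLog_add_one hx z0 z1
      have e : (n + 1 : ℕ) * ((p : ℝ) / q) - M = z + 1 := by rw [hz]; push_cast; ring
      have e2 : |2 * sin (π * ((M + 1 : ℕ) * ((q : ℝ) / p)))| = 2 * sin (π * (z / (p / q))) := by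
        have e3 : z / (p / q) = (n + 1 : ℕ) - (M + 1 : ℕ) * ((q : ℝ) / p) := by
          rw [hz]; field_simp
        have hz1 : z / (p / q) < 1 := (div_lt_one hx).mpr z1
        have hsin : 0 < sin (π * (z / (p / q))) :=
          sin_pos_of_pos_of_lt_pi (by positivity) (by nlinarith [pi_pos])
        rw [← abs_of_pos hsin, e3, abs_sin_pi_mul_nat_sub, abs_mul, abs_two]
      rw [e, key, e2]
      push_cast
      ring
    · exfalso
      have : q ∣ n := by
        have : q ∣ n * p := ⟨M, by rw [h]; ring⟩
        exact hpq.symm.dvd_of_dvd_mul_right this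
      have hn0 : n = 0 := Nat.eq_zero_of_dvd_of_lt this hn
      subst hn0
      have : M = 0 := by
        rcases mul_eq_zero.mp (show M * q = 0 by simpa using h.symm) with h | h
        · exact h
        · omega
      omega
    · obtain ⟨n, rfl⟩ : ∃ m, n = m + 1 := ⟨n - 1, by
        have : n ≠ 0 := by rintro rfl; simp at h
        omega⟩
      rw [sineLogSum_succ, ih (by omega) h (by nlinarith) (by omega)]
      set z : ℝ := (n + 1 : ℕ) * (p / q) - M with hz
      have z0 : 0 < z := by
        rw [hz, sub_pos, ← mul_div_assoc, lt_div_iff₀ hq']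
        exact_mod_cast h
      have z1 : z < 1 := by
        have : ((n + 1 : ℕ) : ℝ) * (p / q) < M + 1 := by
          rw [← mul_div_assoc, div_lt_iff₀ hq']
          exact_mod_cast h2
        rw [hz]; linarith
      have key := doubleSineLog_add_self hx z0 z1
      have e : (n + 1 + 1 : ℕ) * ((p : ℝ) / q) - M = z + p / q := by rw [hz]; push_cast; ring
      have e2 : |2 * sin (π * ((n + 1 : ℕ) * ((p : ℝ) / q)))| = 2 * sin (π * z) := by
        have hsin : 0 < sin (π * z) :=
          sin_pos_of_pos_of_lt_pi (by positivity) (by nlinarith [pi_pos])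
        rw [← abs_of_pos hsin, hz, abs_sin_pi_mul_sub_nat, abs_mul, abs_two]
      rw [e, key, e2]
      ring

lemma doubleSineDefect_eq_zero {p q : ℕ} (hp : 0 < p) (hlt : p < q) (hpq : p.Coprime q) :
    doubleSineDefect (p / q) = 0 := by
  have hp' : (0 : ℝ) < p := by exact_mod_cast hp
  have hq' : (0 : ℝ) < q := by exact_mod_cast hp.trans hlt
  have hx : (0 : ℝ) < p / q := by positivity
  have hx1 : (p : ℝ) / q < 1 := by rw [div_lt_one hq']; exact_mod_cast hlt
  have h := sineLogSum_reciprocity_aux hp hpq (n := q - 1) (M := p - 1) (by omega)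
    (by rw [Nat.sub_add_cancel (by omega), mul_comm q p]
        exact Nat.mul_lt_mul_of_pos_right (by omega) (by omega))
    (by rw [Nat.sub_add_cancel (by omega), mul_comm p q]
        exact Nat.mul_lt_mul_of_pos_right (by omega) (by omega))
  rw [sineLogSum_pred (by omega) hpq, sineLogSum_pred hp hpq.symm,
    Nat.sub_add_cancel (by omega), Nat.cast_sub (by omega)] at h
  have e : (q : ℝ) * (p / q) - (p - (1 : ℕ)) = 1 + p / q - p / q := by
    push_cast; field_simp; ring
  have h2 := two_mul_doubleSineLog_self hx hx1
  rw [e, doubleSineLog_reflect] at h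
  rw [one_div_div, log_div hq'.ne' hp'.ne'] at h2
  have : (p : ℝ) * doubleSineDefect (p / q) = 0 := by push_cast at h; linarith
  rcases mul_eq_zero.mp this with h | h
  · exact absurd h hp'.ne'
  · exact h

/-- Reciprocity between the partial sums at `p/q` and at `q/p`. -/
lemma sineLogSum_reciprocity {p q : ℕ} (hp : 0 < p) (hlt : p < q) (hpq : p.Coprime q) {n M : ℕ}
    (hn : n < q) (h1 : M * q < (n + 1) * p) (h2 : n * p < (M + 1) * q) :
    sineLogSum n (p / q) = sineLogSum M (q / p) +
      doubleSineLog (p / q) ((n + 1 : ℕ) * (p / q) - M) - doubleSineLog (p / q) (p / q) := by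
  rw [sineLogSum_reciprocity_aux hp hpq hn h1 h2, doubleSineDefect_eq_zero hp hlt hpq]
  ring

lemma doubleSineLog_center (x : ℝ) : doubleSineLog x ((1 + x) / 2) = 0 := by
  have h := doubleSineLog_reflect x ((1 + x) / 2)
  rw [show 1 + x - (1 + x) / 2 = (1 + x) / 2 by ring] at h
  linarith

lemma doubleSineLog_self {x : ℝ} (hx : 0 < x) (hx1 : x < 1) (hd : doubleSineDefect x = 0) :
    doubleSineLog x x = log x / 2 := by
  have h := two_mul_doubleSineLog_self hx hx1
  rw [hd, one_div, log_inv] at h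
  linarith

lemma doubleSineLog_half_self {x : ℝ} (hx : 0 < x) (hd : doubleSineDefect x = 0) :
    doubleSineLog x (x / 2) = -(log 2 / 2) := by
  have h := doubleSineLog_add_one hx (half_pos hx) (half_lt_self hx)
  have h2 := doubleSineLog_reflect x (x / 2)
  rw [hd, show x / 2 / x = 1 / 2 by field_simp, show π * (1 / 2) = π / 2 by ring, sin_pi_div_two,
    show x / 2 + 1 = 1 + x - x / 2 by ring, h2] at h
  norm_num at h
  linarith

lemma convex_combination_bound {g : ℝ → ℝ} {D : ℝ} (hg : ConvexOn ℝ (Set.Ico 0 D) g) {a b d B : ℝ}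
    (ha : 0 ≤ a) (hb : b < D) (had : a ≤ d) (hdb : d ≤ b) (hga : g a ≤ B) (hgb : g b ≤ B) :
    g d ≤ B := by
  have := hg.le_max_of_mem_Icc (x := a) (y := b) (z := d) ⟨ha, by linarith⟩ ⟨by linarith, hb⟩
    ⟨had, hdb⟩
  exact this.trans (max_le hga hgb)

lemma doubleSineLog_nonpos {x t : ℝ} (hx : 0 < x) (hx1 : x < 1) (hd : doubleSineDefect x = 0)
    (h1 : x ≤ t) (h2 : t ≤ (1 + x) / 2) : doubleSineLog x t ≤ 0 := by
  have h := convex_combination_bound (convexOn_doubleSineLog hx) (a := 0) (b := (1 - x) / 2)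
    (d := (1 + x) / 2 - t) (B := 0) le_rfl (by linarith) (by linarith) (by linarith)
    (by simp [doubleSineLog_center])
    (by
      rw [show (1 + x) / 2 - (1 - x) / 2 = x by ring, doubleSineLog_self hx hx1 hd]
      have := log_nonpos hx.le hx1.le
      linarith)
  simpa using h

lemma doubleSineLog_center_bounds {x z : ℝ} (hx : 0 < x) (hx1 : x < 1)
    (hd : doubleSineDefect x = 0) (h1 : 1 / 2 ≤ z) (h2 : z ≤ (1 + x) / 2) :
    -(log 2 / 2) ≤ doubleSineLog x z ∧ doubleSineLog x z ≤ 0 := by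
  have hc := convexOn_doubleSineLog hx
  have hl : 0 < log 2 := log_pos one_lt_two
  constructor
  · set d := (1 + x) / 2 - z with hd'
    have hz : z = (1 + x) / 2 - d := by rw [hd']; ring
    have h12 : 0 < 1 / 2 - d := by rw [hd']; linarith
    have h13 : 1 - 2 * d ≠ 0 := by intro h; linarith
    have hd1 : d ∈ Set.Ico 0 ((1 + x) / 2) := ⟨by linarith, by linarith⟩
    have hd2 : (1 / 2 : ℝ) ∈ Set.Ico 0 ((1 + x) / 2) := ⟨by norm_num, by linarith⟩
    have ha : 0 ≤ (1 / 2 - x / 2) / (1 / 2 - d) := div_nonneg (by linarith) h12.le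
    have hb : 0 ≤ (x / 2 - d) / (1 / 2 - d) := div_nonneg (by rw [hd']; linarith) h12.le
    have := hc.2 hd1 hd2 ha hb (by field_simp; ring)
    have e : ((1 / 2 - x / 2) / (1 / 2 - d)) • d + ((x / 2 - d) / (1 / 2 - d)) • (1 / 2 : ℝ) =
        x / 2 := by
      simp only [smul_eq_mul]
      field_simp
      ring
    rw [e] at this
    simp only [smul_eq_mul] at this
    rw [show (1 + x) / 2 - x / 2 = 1 / 2 by ring, doubleSineLog_half hx,
      show (1 + x) / 2 - 1 / 2 = x / 2 by ring, doubleSineLog_half_self hx hd, ← hz] at this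
    rw [div_mul_eq_mul_div, div_mul_eq_mul_div, ← add_div, le_div_iff₀ h12] at this
    nlinarith
  · have h := convex_combination_bound hc (a := 0) (b := x / 2)
      (d := (1 + x) / 2 - z) (B := 0) le_rfl (by linarith) (by linarith) (by linarith)
      (by simp [doubleSineLog_center])
      (by rw [show (1 + x) / 2 - x / 2 = 1 / 2 by ring, doubleSineLog_half hx]; linarith)
    simpa using h

lemma abs_doubleSineLog_center_le {x z : ℝ} (hx : 0 < x) (hx1 : x < 1)
    (hd : doubleSineDefect x = 0) (h1 : 1 / 2 ≤ z) (h2 : z ≤ 1 / 2 + x) :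
    |doubleSineLog x z| ≤ log 2 / 2 := by
  have hl : 0 < log 2 := log_pos one_lt_two
  rw [abs_le]
  rcases le_total z ((1 + x) / 2) with h | h
  · have := doubleSineLog_center_bounds hx hx1 hd h1 h
    constructor <;> linarith
  · have := doubleSineLog_center_bounds (z := 1 + x - z) hx hx1 hd (by linarith) (by linarith)
    rw [doubleSineLog_reflect] at this
    constructor <;> linarith

lemma doubleSineLog_add_nat_mul {x s : ℝ} (hx : 0 < x) (hs : 0 < s) (k : ℕ)
    (h : ∀ j < k, s + j * x < 1) :
    doubleSineLog x (s + k * x) =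
      doubleSineLog x s + ∑ j ∈ range k, log (2 * sin (π * (s + j * x))) := by
  induction k with
  | zero => simp
  | succ k ih =>
    rw [sum_range_succ, ← add_assoc, ← ih fun j hj => h j (by omega),
      ← doubleSineLog_add_self hx (by positivity) (h k (by omega))]
    congr 1
    push_cast
    ring

lemma exists_abs_doubleSineLog_add_sum_le {x s : ℝ} (hx : 0 < x) (hx1 : x < 1)
    (hd : doubleSineDefect x = 0) (hs : 0 < s) (hs1 : s ≤ 1 / 2 + x) :
    ∃ k : ℕ, 1 / 2 ≤ s + k * x ∧ (∀ j < k, s + j * x < 1 / 2) ∧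
      |doubleSineLog x s + ∑ j ∈ range k, log (2 * sin (π * (s + j * x)))| ≤ log 2 / 2 := by
  refine ⟨⌈(1 / 2 - s) / x⌉₊, ?_, ?_, ?_⟩
  · have := Nat.le_ceil ((1 / 2 - s) / x)
    rw [div_le_iff₀ hx] at this
    linarith
  · intro j hj
    rw [Nat.lt_ceil, lt_div_iff₀ hx] at hj
    linarith
  · rw [← doubleSineLog_add_nat_mul hx hs]
    · refine abs_doubleSineLog_center_le hx hx1 hd ?_ ?_
      · have := Nat.le_ceil ((1 / 2 - s) / x)
        rw [div_le_iff₀ hx] at this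
        linarith
      · rcases le_total s (1 / 2) with h | h
        · have := Nat.ceil_lt_add_one (a := (1 / 2 - s) / x) (div_nonneg (by linarith) hx.le)
          rw [← sub_lt_iff_lt_add, lt_div_iff₀ hx] at this
          linarith
        · rw [Nat.ceil_eq_zero.mpr (div_nonpos_of_nonpos_of_nonneg (by linarith) hx.le)]
          simpa using hs1
    · intro j hj
      rw [Nat.lt_ceil, lt_div_iff₀ hx] at hj
      linarith

/-- The positive part of `log (2 sin πu)` on `[0, 1/2]`, extended to a monotone function. -/
noncomputable def clampedLogSine (u : ℝ) : ℝ := log (2 * sin (π * max (1 / 6) (min u (1 / 2))))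

/-- The volume constant `∫_{1/6}^{1/2} log (2 sin πu) du`. -/
noncomputable def volConst : ℝ := ∫ u in (0 : ℝ)..(1 / 2), clampedLogSine u

lemma clamp_mem (u : ℝ) : 1 / 6 ≤ max (1 / 6) (min u (1 / 2)) ∧
    max (1 / 6) (min u (1 / 2)) ≤ (1 / 2 : ℝ) :=
  ⟨le_max_left _ _, max_le (by norm_num) (min_le_right _ _)⟩

lemma sin_pi_mul_mono {u v : ℝ} (hu : 0 ≤ u) (huv : u ≤ v) (hv : v ≤ 1 / 2) :
    sin (π * u) ≤ sin (π * v) :=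
  sin_le_sin_of_le_of_le_pi_div_two (by nlinarith [pi_pos]) (by nlinarith [pi_pos])
    (by nlinarith [pi_pos])

lemma one_le_two_mul_sin {u : ℝ} (hu : 1 / 6 ≤ u) (hv : u ≤ 1 / 2) : 1 ≤ 2 * sin (π * u) := by
  have := sin_pi_mul_mono (by norm_num) hu hv
  rw [show π * (1 / 6) = π / 6 by ring, sin_pi_div_six] at this
  linarith

lemma clampedLogSine_nonneg (u : ℝ) : 0 ≤ clampedLogSine u :=
  log_nonneg (one_le_two_mul_sin (clamp_mem u).1 (clamp_mem u).2)

lemma clampedLogSine_le (u : ℝ) : clampedLogSine u ≤ log 2 := by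
  have h := one_le_two_mul_sin (clamp_mem u).1 (clamp_mem u).2
  exact log_le_log (by linarith) (by linarith [sin_le_one (π * max (1 / 6) (min u (1 / 2)))])

lemma clampedLogSine_mono : Monotone clampedLogSine := by
  intro u v huv
  have h := one_le_two_mul_sin (clamp_mem u).1 (clamp_mem u).2
  refine log_le_log (by linarith) ?_
  have := sin_pi_mul_mono (u := max (1 / 6) (min u (1 / 2))) (v := max (1 / 6) (min v (1 / 2)))
    (by linarith [(clamp_mem u).1]) (max_le_max le_rfl (min_le_min huv le_rfl)) (clamp_mem v).2
  linarith

lemma clampedLogSine_continuous : Continuous clampedLogSine := by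
  refine Continuous.log (by fun_prop) fun u => ?_
  have h := one_le_two_mul_sin (clamp_mem u).1 (clamp_mem u).2
  linarith

lemma clampedLogSine_eq {u : ℝ} (h1 : 1 / 6 ≤ u) (h2 : u ≤ 1 / 2) :
    clampedLogSine u = log (2 * sin (π * u)) := by
  rw [clampedLogSine, min_eq_left h2, max_eq_right h1]

lemma clampedLogSine_eq_zero {u : ℝ} (h1 : u ≤ 1 / 6) : clampedLogSine u = 0 := by
  rw [clampedLogSine, min_eq_left (by linarith), max_eq_left h1, show π * (1 / 6) = π / 6 by ring,
    sin_pi_div_six]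
  norm_num

lemma log_two_mul_sin_le {u : ℝ} (h1 : 0 < u) (h2 : u ≤ 1 / 2) :
    log (2 * sin (π * u)) ≤ clampedLogSine u := by
  have hsin : 0 < sin (π * u) :=
    sin_pos_of_pos_of_lt_pi (by positivity) (by nlinarith [pi_pos])
  refine log_le_log (by linarith) ?_
  have := sin_pi_mul_mono (u := u) (v := max (1 / 6) (min u (1 / 2))) h1.le
    (by rw [min_eq_left h2]; exact le_max_right _ _) (clamp_mem u).2
  linarith

lemma volConst_pos : 0 < volConst := by
  refine intervalIntegral.integral_pos (by norm_num) clampedLogSine_continuous.continuousOn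
    (fun u _ => clampedLogSine_nonneg u) ⟨1 / 2, by norm_num, ?_⟩
  rw [clampedLogSine_eq (by norm_num) le_rfl, show π * (1 / 2) = π / 2 by ring, sin_pi_div_two]
  exact log_pos (by norm_num)

lemma integral_clampedLogSine_le {a b : ℝ} (hab : a ≤ b) :
    ∫ u in a..b, clampedLogSine u ≤ (b - a) * log 2 := by
  have := intervalIntegral.integral_mono_on (μ := MeasureTheory.volume) hab
    (clampedLogSine_continuous.intervalIntegrable a b)
    (continuous_const.intervalIntegrable a b) (fun u _ => clampedLogSine_le u)
  simpa using this

lemma integral_comp_affine {x s : ℝ} (hx : 0 < x) (k : ℕ) :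
    ∫ v in (0 : ℝ)..(0 + k), clampedLogSine (x * v + s) =
      x⁻¹ * ∫ u in s..(s + k * x), clampedLogSine u := by
  rw [intervalIntegral.integral_comp_mul_add _ hx.ne']
  simp only [mul_zero, zero_add, smul_eq_mul]
  congr 2
  ring

lemma sum_log_sine_le {x s : ℝ} (hx : 0 < x) (hs : 0 < s) (k : ℕ)
    (h : ∀ j < k, s + j * x < 1 / 2) :
    ∑ j ∈ range k, log (2 * sin (π * (s + j * x))) ≤ volConst / x + log 2 := by
  have hl : 0 < log 2 := log_pos one_lt_two
  have hII := fun a b => clampedLogSine_continuous.intervalIntegrable (μ := MeasureTheory.volume) a b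
  have h1 : ∑ j ∈ range k, log (2 * sin (π * (s + j * x))) ≤
      ∑ j ∈ range k, clampedLogSine (x * (0 + (j : ℝ)) + s) := by
    refine sum_le_sum fun j hj => ?_
    rw [show x * (0 + (j : ℝ)) + s = s + j * x by ring]
    exact log_two_mul_sin_le (by positivity) (h j (mem_range.mp hj)).le
  have hm : Monotone fun v : ℝ => clampedLogSine (x * v + s) :=
    fun u v huv => clampedLogSine_mono (by nlinarith)
  have h2 := MonotoneOn.sum_le_integral (f := fun v => clampedLogSine (x * v + s)) (x₀ := 0) (a := k)
    (hm.monotoneOn _)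
  rw [integral_comp_affine hx] at h2
  have h3 : ∫ u in s..(s + k * x), clampedLogSine u ≤ volConst + x * log 2 := by
    rcases Nat.eq_zero_or_pos k with rfl | hk
    · simp only [Nat.cast_zero, zero_mul, add_zero, intervalIntegral.integral_same]
      have := volConst_pos
      positivity
    have hlast := h (k - 1) (by omega)
    rw [Nat.cast_sub (by omega)] at hlast
    push_cast at hlast
    have h4 : ∫ u in s..(s + k * x), clampedLogSine u ≤
        ∫ u in (0 : ℝ)..(1 / 2 + x), clampedLogSine u :=
      intervalIntegral.integral_mono_interval hs.le (le_add_of_nonneg_right (by positivity))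
        (by linarith) (MeasureTheory.ae_of_all _ clampedLogSine_nonneg) (hII _ _)
    have h5 := intervalIntegral.integral_add_adjacent_intervals (hII 0 (1 / 2)) (hII (1 / 2) (1 / 2 + x))
    have h6 := integral_clampedLogSine_le (a := 1 / 2) (b := 1 / 2 + x) (by linarith)
    rw [volConst]
    linarith
  have h7 : x⁻¹ * ∫ u in s..(s + k * x), clampedLogSine u ≤ x⁻¹ * (volConst + x * log 2) :=
    mul_le_mul_of_nonneg_left h3 (by positivity)
  have e : x⁻¹ * (volConst + x * log 2) = volConst / x + log 2 := by field_simp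
  linarith

lemma le_sum_log_sine {x s : ℝ} (hx : 0 < x) (hs : 1 / 6 ≤ s) (hs2 : s ≤ 1 / 6 + x) (k : ℕ)
    (h0 : 1 / 2 ≤ s + k * x) (h : ∀ j < k, s + j * x < 1 / 2) :
    volConst / x - log 2 ≤ ∑ j ∈ range k, log (2 * sin (π * (s + j * x))) := by
  have hl : 0 < log 2 := log_pos one_lt_two
  have hII := fun a b => clampedLogSine_continuous.intervalIntegrable (μ := MeasureTheory.volume) a b
  have h1 : ∑ j ∈ range k, log (2 * sin (π * (s + j * x))) =
      ∑ j ∈ range k, clampedLogSine (x * (0 + ((j + 1 : ℕ) : ℝ)) + (s - x)) := by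
    refine sum_congr rfl fun j hj => ?_
    rw [show x * (0 + ((j + 1 : ℕ) : ℝ)) + (s - x) = s + j * x by push_cast; ring]
    refine (clampedLogSine_eq ?_ (h j (mem_range.mp hj)).le).symm
    have : 0 ≤ (j : ℝ) * x := by positivity
    linarith
  have hm : Monotone fun v : ℝ => clampedLogSine (x * v + (s - x)) :=
    fun u v huv => clampedLogSine_mono (by nlinarith)
  have h2 := MonotoneOn.integral_le_sum (f := fun v => clampedLogSine (x * v + (s - x))) (x₀ := 0)
    (a := k) (hm.monotoneOn _)
  rw [integral_comp_affine hx] at h2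
  set b := s - x + k * x with hb
  have hb2 : b ≤ 1 / 2 := by
    rcases Nat.eq_zero_or_pos k with rfl | hk
    · simp only [Nat.cast_zero, zero_mul] at hb
      linarith
    have hlast := h (k - 1) (by omega)
    rw [Nat.cast_sub (by omega)] at hlast
    push_cast at hlast
    linarith
  have h3 : volConst - x * log 2 ≤ ∫ u in (s - x)..b, clampedLogSine u := by
    have h4 := intervalIntegral.integral_add_adjacent_intervals (hII 0 (s - x)) (hII (s - x) (1 / 2))
    have h5 := intervalIntegral.integral_add_adjacent_intervals (hII (s - x) b) (hII b (1 / 2))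
    have h6 := integral_clampedLogSine_le hb2
    have h7 : ∫ u in (0 : ℝ)..(s - x), clampedLogSine u = 0 := by
      rw [intervalIntegral.integral_congr (g := fun _ => 0)]
      · simp
      · intro u hu
        refine clampedLogSine_eq_zero ?_
        have := hu.2
        rcases le_total 0 (s - x) with h | h
        · rw [sup_eq_right.mpr h] at this; linarith
        · rw [sup_eq_left.mpr h] at this; linarith
    have h8 : (1 / 2 - b) * log 2 ≤ x * log 2 := mul_le_mul_of_nonneg_right (by linarith) hl.le
    rw [volConst]
    linarith
  have h7 : x⁻¹ * (volConst - x * log 2) ≤ x⁻¹ * ∫ u in (s - x)..b, clampedLogSine u :=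
    mul_le_mul_of_nonneg_left h3 (by positivity)
  have e : x⁻¹ * (volConst - x * log 2) = volConst / x - log 2 := by field_simp
  linarith

lemma doubleSineLog_le {x t : ℝ} (hx : 0 < x) (hx1 : x < 1) (hd : doubleSineDefect x = 0)
    (h1 : x ≤ t) (h2 : t < 1 + x) : doubleSineLog x t ≤ volConst / x + 3 / 2 * log 2 := by
  have hl : 0 < log 2 := log_pos one_lt_two
  rcases le_total t ((1 + x) / 2) with h | h
  · have := doubleSineLog_nonpos hx hx1 hd h1 h
    have := volConst_pos
    have : 0 < volConst / x := by positivity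
    linarith
  · obtain ⟨k, _, h3, h4⟩ := exists_abs_doubleSineLog_add_sum_le (s := 1 + x - t) hx hx1 hd
      (by linarith) (by linarith)
    have h5 := sum_log_sine_le (s := 1 + x - t) hx (by linarith) k h3
    rw [doubleSineLog_reflect, abs_le] at h4
    linarith

lemma le_doubleSineLog {x t : ℝ} (hx : 0 < x) (hx1 : x < 1) (hd : doubleSineDefect x = 0)
    (h1 : 5 / 6 ≤ t) (h2 : t ≤ 5 / 6 + x) : volConst / x - 3 / 2 * log 2 ≤ doubleSineLog x t := by
  obtain ⟨k, h0, h3, h4⟩ := exists_abs_doubleSineLog_add_sum_le (s := 1 + x - t) hx hx1 hd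
    (by linarith) (by linarith)
  have h5 := le_sum_log_sine (s := 1 + x - t) hx (by linarith) (by linarith) k h0 h3
  rw [doubleSineLog_reflect, abs_le] at h4
  linarith

/-- The largest partial sum `sineLogSum n (p/q)` with `n < q`. -/
noncomputable def maxSineLog (p q : ℕ) : ℝ := ⨆ n : Fin q, sineLogSum n (p / q)

lemma sineLogSum_le_maxSineLog {p q n : ℕ} (hn : n < q) :
    sineLogSum n (p / q) ≤ maxSineLog p q :=
  le_ciSup (f := fun n : Fin q => sineLogSum n (p / q)) (Set.finite_range _).bddAbove ⟨n, hn⟩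

lemma maxSineLog_le {p q : ℕ} {B : ℝ} (hq : 0 < q) (h : ∀ n < q, sineLogSum n (p / q) ≤ B) :
    maxSineLog p q ≤ B := by
  have : Nonempty (Fin q) := ⟨⟨0, hq⟩⟩
  exact ciSup_le fun n => h n n.2

lemma maxSineLog_one (p : ℕ) : maxSineLog p 1 = 0 := by
  refine le_antisymm (maxSineLog_le one_pos fun n hn => ?_) ?_
  · rw [Nat.lt_one_iff.mp hn, sineLogSum_zero]
  · rw [← sineLogSum_zero ((p : ℝ) / (1 : ℕ))]
    exact sineLogSum_le_maxSineLog one_pos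

lemma sineLogSum_add_mul_div {p r a : ℕ} (hp : 0 < p) (M : ℕ) :
    sineLogSum M (((a * p + r : ℕ) : ℝ) / p) = sineLogSum M (r / p) := by
  have hp' : (0 : ℝ) < p := by exact_mod_cast hp
  rw [show ((a * p + r : ℕ) : ℝ) / p = r / p + (a : ℕ) by push_cast; field_simp; ring,
    sineLogSum_add_nat]

lemma maxSineLog_le_step {p q r a : ℕ} (hp : 0 < p) (hlt : p < q) (hpq : p.Coprime q)
    (hq : q = a * p + r) :
    maxSineLog p q ≤ maxSineLog r p + volConst * (q / p) + (3 / 2 * log 2 + log (q / p) / 2) := by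
  have hp' : (0 : ℝ) < p := by exact_mod_cast hp
  have hq' : (0 : ℝ) < q := by exact_mod_cast hp.trans hlt
  have hx : (0 : ℝ) < p / q := by positivity
  have hx1 : (p : ℝ) / q < 1 := by rw [div_lt_one hq']; exact_mod_cast hlt
  have hd := doubleSineDefect_eq_zero hp hlt hpq
  refine maxSineLog_le (hp.trans hlt) fun n hn => ?_
  have hM1 : n * p / q * q ≤ n * p := Nat.div_mul_le_self _ _
  have hM2 : n * p < (n * p / q + 1) * q := by
    have := Nat.lt_div_mul_add (a := n * p) (hp.trans hlt); linarith
  set M := n * p / q with hM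
  have hMp : M < p := by
    rw [hM, Nat.div_lt_iff_lt_mul (hp.trans hlt), mul_comm p q]
    exact Nat.mul_lt_mul_of_pos_right hn hp
  rw [sineLogSum_reciprocity hp hlt hpq hn (by linarith) hM2]
  have h1 : sineLogSum M (q / p) ≤ maxSineLog r p := by
    rw [hq, sineLogSum_add_mul_div hp]
    exact sineLogSum_le_maxSineLog hMp
  have hM1' : (M : ℝ) ≤ n * (p / q) := by
    rw [← mul_div_assoc, le_div_iff₀ hq']; exact_mod_cast hM1
  have hM2' : n * ((p : ℝ) / q) < M + 1 := by
    rw [← mul_div_assoc, div_lt_iff₀ hq']; exact_mod_cast hM2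
  have h2 := doubleSineLog_le (t := (n + 1 : ℕ) * ((p : ℝ) / q) - M) hx hx1 hd
    (by push_cast; linarith) (by push_cast; linarith)
  have h3 := doubleSineLog_self hx hx1 hd
  have h4 : log (p / q) = -log (q / p) := by rw [← log_inv, inv_div]
  rw [show volConst / (p / q) = volConst * (q / p) by field_simp] at h2
  rw [h3, h4]
  linarith

lemma le_maxSineLog_step {p q r a : ℕ} (hp : 0 < p) (hlt : p < q) (hpq : p.Coprime q)
    (hq : q = a * p + r) :
    maxSineLog r p + volConst * (q / p) - 3 / 2 * log 2 ≤ maxSineLog p q := by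
  have hp' : (0 : ℝ) < p := by exact_mod_cast hp
  have hq' : (0 : ℝ) < q := by exact_mod_cast hp.trans hlt
  have hx : (0 : ℝ) < p / q := by positivity
  have hx1 : (p : ℝ) / q < 1 := by rw [div_lt_one hq']; exact_mod_cast hlt
  have hd := doubleSineDefect_eq_zero hp hlt hpq
  have key : maxSineLog r p ≤ maxSineLog p q - volConst * (q / p) + 3 / 2 * log 2 := by
    refine maxSineLog_le hp fun M hM => ?_
    set n := ⌊(M + 5 / 6 : ℝ) / (p / q)⌋₊ with hn
    have n1 : n * ((p : ℝ) / q) ≤ M + 5 / 6 := by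
      rw [← le_div_iff₀ hx]; exact Nat.floor_le (by positivity)
    have n2 : (M + 5 / 6 : ℝ) < (n + 1) * (p / q) := by
      rw [← div_lt_iff₀ hx]; exact Nat.lt_floor_add_one _
    have hM' : (M : ℝ) + 1 ≤ p := by exact_mod_cast hM
    have hnq : n < q := by
      have : n * ((p : ℝ) / q) < q * (p / q) := by
        rw [mul_div_cancel₀ _ hq'.ne']; linarith
      exact_mod_cast lt_of_mul_lt_mul_right this hx.le
    have hA : M * q < (n + 1) * p := by
      have : (M : ℝ) * q < (n + 1) * p := by
        rw [← lt_div_iff₀ hq', mul_div_assoc]; linarith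
      exact_mod_cast this
    have hB : n * p < (M + 1) * q := by
      have : (n : ℝ) * p < (M + 1) * q := by
        rw [← div_lt_iff₀ hq', mul_div_assoc]; linarith
      exact_mod_cast this
    have h0 := sineLogSum_reciprocity hp hlt hpq hnq hA hB
    have h1 : sineLogSum M (q / p) = sineLogSum M (r / p) := by
      rw [hq, sineLogSum_add_mul_div hp]
    have h2 := le_doubleSineLog (t := (n + 1 : ℕ) * ((p : ℝ) / q) - M) hx hx1 hd
      (by push_cast; linarith) (by push_cast; linarith)
    have h3 := doubleSineLog_self hx hx1 hd
    have h4 := log_nonpos hx.le hx1.le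
    have h5 := sineLogSum_le_maxSineLog (p := p) hnq
    rw [show volConst / (p / q) = volConst * (q / p) by field_simp] at h2
    linarith
  linarith

/-- One step of the continued fraction recursion for `maxSineLog`. -/
lemma abs_maxSineLog_step_le {p q r a : ℕ} (hp : 0 < p) (ha : 0 < a) (hpq : p.Coprime q)
    (hq : q = a * p + r) :
    |maxSineLog p q - maxSineLog r p - volConst * (q / p)| ≤
      3 / 2 * log 2 + volConst + log (q / p) / 2 := by
  have hl : 0 < log 2 := log_pos one_lt_two
  have hv := volConst_pos
  have hpq' : p ≤ q := by rw [hq]; nlinarith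
  rcases hpq'.eq_or_lt with h | h
  · have : p = 1 := by rw [← h] at hpq; simpa using hpq
    subst this
    rw [← h, maxSineLog_one, maxSineLog_one]
    simp only [sub_self, Nat.cast_one, div_one, mul_one, zero_sub, abs_neg, log_one, zero_div,
      add_zero]
    rw [abs_of_pos hv]
    linarith
  · have h1 := maxSineLog_le_step hp h hpq hq
    have h2 := le_maxSineLog_step hp h hpq hq
    have h3 : 0 ≤ log ((q : ℝ) / p) := by
      apply log_nonneg
      rw [le_div_iff₀ (by exact_mod_cast hp), one_mul]
      exact_mod_cast hpq'
    rw [abs_le]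
    constructor <;> linarith

/-- The denominators of the last two convergents of the continued fraction with partial
quotients `a + 1`, for `a` in the list. -/
def cfPair : List ℕ → ℕ × ℕ
  | [] => (1, 0)
  | a :: l => ((a + 1) * (cfPair l).1 + (cfPair l).2, (cfPair l).1)

/-- The sum of the partial quotients. -/
def quotientSum : List ℕ → ℕ
  | [] => 0
  | a :: l => a + 1 + quotientSum l

lemma cfPair_pos (l : List ℕ) : 0 < (cfPair l).1 := by
  induction l with
  | nil => simp [cfPair]
  | cons a l ih => simp only [cfPair]; positivity

lemma cfPair_snd_le (l : List ℕ) : (cfPair l).2 ≤ (cfPair l).1 := by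
  cases l with
  | nil => simp [cfPair]
  | cons a l => simp only [cfPair]; nlinarith

lemma cfPair_coprime (l : List ℕ) : (cfPair l).2.Coprime (cfPair l).1 := by
  induction l with
  | nil => simp [cfPair]
  | cons a l ih =>
    simp only [cfPair]
    rw [Nat.coprime_mul_right_add_right]
    exact ih.symm

lemma three_halves_pow_length_le (l : List ℕ) :
    (3 / 2 : ℝ) ^ l.length ≤ (cfPair l).1 + (cfPair l).2 := by
  induction l with
  | nil => simp [cfPair]
  | cons a l ih =>
    have h : ((cfPair l).2 : ℝ) ≤ (cfPair l).1 := by exact_mod_cast cfPair_snd_le l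
    have h0 : (0 : ℝ) ≤ (cfPair l).1 := by positivity
    have ha : (0 : ℝ) ≤ a := by positivity
    simp only [cfPair, List.length_cons, pow_succ]
    push_cast
    nlinarith

lemma length_le_log (l : List ℕ) : (l.length : ℝ) ≤ 3 * (log (cfPair l).1 + 1) := by
  have h : ((cfPair l).2 : ℝ) ≤ (cfPair l).1 := by exact_mod_cast cfPair_snd_le l
  have h0 : (0 : ℝ) < (cfPair l).1 := by exact_mod_cast cfPair_pos l
  have h1 : (3 / 2 : ℝ) ^ l.length ≤ 2 * (cfPair l).1 := by
    have := three_halves_pow_length_le l; linarith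
  have h2 := log_le_log (by positivity) h1
  rw [log_pow, log_mul two_ne_zero h0.ne'] at h2
  have h3 : 1 / 3 ≤ log (3 / 2) := by
    have := one_sub_inv_le_log_of_pos (x := 3 / 2) (by norm_num); norm_num at this; linarith
  have h4 : log 2 ≤ 1 := by have := log_le_sub_one_of_pos (x := 2) (by norm_num); linarith
  have h5 : (l.length : ℝ) * (1 / 3) ≤ l.length * log (3 / 2) :=
    mul_le_mul_of_nonneg_left h3 (by positivity)
  linarith

lemma abs_maxSineLog_sub_quotientSum_le (l : List ℕ) :
    |maxSineLog (cfPair l).2 (cfPair l).1 - volConst * quotientSum l| ≤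
      (3 / 2 * log 2 + 2 * volConst) * l.length + log (cfPair l).1 / 2 := by
  have hv := volConst_pos
  induction l with
  | nil => simp [cfPair, quotientSum, maxSineLog_one]
  | cons a l ih =>
    have hp := cfPair_pos l
    have hp' : (0 : ℝ) < (cfPair l).1 := by exact_mod_cast hp
    have hr : ((cfPair l).2 : ℝ) ≤ (cfPair l).1 := by exact_mod_cast cfPair_snd_le l
    have h1 := abs_maxSineLog_step_le hp a.succ_pos (cfPair_coprime (a :: l)) rfl
    simp only [cfPair, quotientSum, List.length_cons] at h1 ⊢
    set q := (a + 1) * (cfPair l).1 + (cfPair l).2 with hq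
    have hq' : (0 : ℝ) < q := by rw [hq]; positivity
    have h2 : |(q : ℝ) / (cfPair l).1 - (a + 1)| ≤ 1 := by
      rw [hq]
      push_cast
      rw [show (((a : ℝ) + 1) * (cfPair l).1 + (cfPair l).2) / (cfPair l).1 - (a + 1) =
        (cfPair l).2 / (cfPair l).1 by field_simp; ring, abs_of_nonneg (by positivity)]
      rw [div_le_one hp']
      exact hr
    rw [log_div hq'.ne' hp'.ne'] at h1
    push_cast
    rw [abs_le] at *
    have h3 := mul_le_mul_of_nonneg_left h2.1 hv.le
    have h4 := mul_le_mul_of_nonneg_left h2.2 hv.le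
    constructor <;> nlinarith

lemma abs_log_kashaevJ_sub_le {p q : ℕ} (hq : 0 < q) (hpq : p.Coprime q) :
    |log (kashaevJ ((p : ℚ) / (q : ℚ))) - 2 * maxSineLog p q| ≤ log q := by
  have hq' : (0 : ℝ) < q := by exact_mod_cast hq
  have hterm : ∀ n : ℕ, ∏ r ∈ Finset.Icc 1 n,
      ‖1 - Complex.exp (2 * (π : ℂ) * Complex.I * r * (((p : ℚ) / (q : ℚ) : ℚ) : ℂ))‖ ^ 2 =
      ∏ r ∈ range n, |2 * sin (π * ((r + 1 : ℕ) * ((p : ℝ) / q)))| ^ 2 := by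
    intro n
    rw [← Finset.Ico_succ_right_eq_Icc, Finset.prod_Ico_eq_prod_range]
    refine prod_congr (by simp) fun r _ => ?_
    rw [← norm_one_sub_exp]
    congr 4
    push_cast
    ring
  have hne : ∀ n < q, ∀ r ∈ range n, |2 * sin (π * ((r + 1 : ℕ) * ((p : ℝ) / q)))| ≠ 0 := by
    intro n hn r hr h0
    rw [mem_range] at hr
    rw [abs_eq_zero, mul_eq_zero, or_iff_right two_ne_zero, sin_eq_zero_iff] at h0
    obtain ⟨m, hm⟩ := h0
    have h1 : (m : ℝ) * q = (r + 1 : ℕ) * p := by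
      have : (m : ℝ) = (r + 1 : ℕ) * (p / q) := by
        have hpi := pi_pos.ne'
        have : π * (m - (r + 1 : ℕ) * ((p : ℝ) / q)) = 0 := by rw [mul_sub, ← hm]; ring
        rcases mul_eq_zero.mp this with h | h
        · exact absurd h hpi
        · linarith
      rw [this]; field_simp
    have h2 : m * (q : ℤ) = ((r + 1) * p : ℕ) := by
      have : ((m * (q : ℤ) : ℤ) : ℝ) = (((r + 1) * p : ℕ) : ℤ) := by push_cast at h1 ⊢; exact h1
      exact_mod_cast this
    have h3 : q ∣ (r + 1) * p := by
      have : (q : ℤ) ∣ (((r + 1) * p : ℕ) : ℤ) := ⟨m, by rw [← h2]; ring⟩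
      exact_mod_cast this
    have h4 := Nat.le_of_dvd (by omega) (hpq.symm.dvd_of_dvd_mul_right h3)
    omega
  have hexp : ∀ n < q, ∏ r ∈ range n, |2 * sin (π * ((r + 1 : ℕ) * ((p : ℝ) / q)))| ^ 2 =
      exp (2 * sineLogSum n (p / q)) := by
    intro n hn
    rw [prod_pow, mul_comm, exp_mul, sineLogSum, exp_sum, ← rpow_natCast]
    congr 1
    refine prod_congr rfl fun r hr => ?_
    rw [exp_log]
    exact lt_of_le_of_ne (abs_nonneg _) (hne n hn r hr).symm
  have hzero : ∀ n ∉ range q, ∏ r ∈ range n,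
      |2 * sin (π * ((r + 1 : ℕ) * ((p : ℝ) / q)))| ^ 2 = 0 := by
    intro n hn
    rw [mem_range, not_lt] at hn
    refine prod_eq_zero (i := q - 1) (mem_range.mpr (by omega)) ?_
    rw [Nat.sub_add_cancel hq, mul_div_cancel₀ _ hq'.ne', mul_comm π, sin_nat_mul_pi]
    simp
  have hJ : kashaevJ ((p : ℚ) / (q : ℚ)) = ∑ n ∈ range q, exp (2 * sineLogSum n (p / q)) := by
    rw [kashaevJ]
    simp only [hterm]
    rw [tsum_eq_sum hzero]
    exact sum_congr rfl fun n hn => hexp n (mem_range.mp hn)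
  have hup : kashaevJ ((p : ℚ) / (q : ℚ)) ≤ q * exp (2 * maxSineLog p q) := by
    rw [hJ, ← nsmul_eq_mul]
    have := sum_le_card_nsmul (range q) (fun n => exp (2 * sineLogSum n (p / q)))
      (exp (2 * maxSineLog p q)) fun n hn => exp_le_exp.mpr (by
        have := sineLogSum_le_maxSineLog (p := p) (mem_range.mp hn); linarith)
    simpa using this
  have hn : ∀ n < q, exp (2 * sineLogSum n (p / q)) ≤ kashaevJ ((p : ℚ) / (q : ℚ)) := by
    intro n hn
    rw [hJ]
    exact single_le_sum (f := fun n => exp (2 * sineLogSum n ((p : ℝ) / q)))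
      (fun i _ => (exp_pos _).le) (mem_range.mpr hn)
  have hpos : 0 < kashaevJ ((p : ℚ) / (q : ℚ)) := (exp_pos _).trans_le (hn 0 hq)
  have hlow : maxSineLog p q ≤ log (kashaevJ ((p : ℚ) / (q : ℚ))) / 2 := by
    refine maxSineLog_le hq fun n h => ?_
    have := (le_log_iff_exp_le hpos).mpr (hn n h)
    linarith
  have hup2 := log_le_log hpos hup
  rw [log_mul hq'.ne' (exp_pos _).ne', log_exp] at hup2
  have hlq : 0 ≤ log (q : ℝ) := log_natCast_nonneg q
  rw [abs_le]
  constructor <;> linarith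

/-- `log J` is governed by the sum of the partial quotients. -/
lemma exists_abs_log_kashaevJ_sub_quotientSum_le : ∃ C : ℝ, 0 < C ∧ ∀ l : List ℕ,
    |log (kashaevJ (((cfPair l).2 : ℚ) / ((cfPair l).1 : ℚ))) - 2 * volConst * quotientSum l| ≤
      C * (1 + log (cfPair l).1) := by
  have hv := volConst_pos
  have hl : 0 < log 2 := log_pos one_lt_two
  refine ⟨6 * (3 / 2 * log 2 + 2 * volConst) + 2, by positivity, fun l => ?_⟩
  have h1 := abs_log_kashaevJ_sub_le (cfPair_pos l) (cfPair_coprime l)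
  have h2 := abs_maxSineLog_sub_quotientSum_le l
  have h3 := mul_le_mul_of_nonneg_left (length_le_log l)
    (show 0 ≤ 3 / 2 * log 2 + 2 * volConst by positivity)
  have h4 : 0 ≤ log ((cfPair l).1 : ℝ) := log_natCast_nonneg _
  rw [abs_le] at *
  constructor <;> nlinarith

/-- The probability that the next letter is at least `a`, given the ratio `θ` of the last two
denominators. -/
noncomputable def letterTail (a : ℕ) (θ : ℝ) : ℝ := (1 + θ) / (a + 1 + θ)

/-- The average of `f` over the next letter, with letters truncated at `Λ`. -/
noncomputable def letterAvg (Λ : ℕ) (θ : ℝ) (f : ℕ → ℝ) : ℝ :=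
  ∑ a ∈ range Λ, (letterTail a θ - letterTail (a + 1) θ) * f a + letterTail Λ θ * f Λ

/-- The transfer operator of the chain `θ ↦ 1 / (a + 1 + θ)`. -/
noncomputable def transfer (Λ : ℕ) (g : ℝ → ℝ) (θ : ℝ) : ℝ :=
  letterAvg Λ θ fun a => g (1 / (a + 1 + θ))

lemma letterTail_zero {θ : ℝ} (h : 0 ≤ θ) : letterTail 0 θ = 1 := by
  rw [letterTail]; simp only [Nat.cast_zero, zero_add]; exact div_self (by linarith)

lemma letterTail_nonneg (a : ℕ) {θ : ℝ} (h : 0 ≤ θ) : 0 ≤ letterTail a θ := by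
  rw [letterTail]; positivity

lemma letterTail_le_one (a : ℕ) {θ : ℝ} (h : 0 ≤ θ) : letterTail a θ ≤ 1 := by
  rw [letterTail, div_le_one (by positivity)]
  have : (0 : ℝ) ≤ a := by positivity
  linarith

lemma letterTail_le (a : ℕ) {θ : ℝ} (h : 0 ≤ θ) (h1 : θ ≤ 1) : letterTail a θ ≤ 2 / (a + 1) := by
  rw [letterTail]; exact div_le_div₀ (by norm_num) (by linarith) (by positivity) (by linarith)

lemma letterTail_sub (a : ℕ) {θ : ℝ} (h : 0 ≤ θ) :
    letterTail a θ - letterTail (a + 1) θ = (1 + θ) / ((a + 1 + θ) * (a + 2 + θ)) := by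
  have : (a : ℝ) + 1 + θ ≠ 0 := by positivity
  have : (a : ℝ) + 2 + θ ≠ 0 := by positivity
  have : (a : ℝ) + 1 + 1 + θ ≠ 0 := by positivity
  rw [letterTail, letterTail]
  push_cast
  field_simp
  ring

lemma letterTail_sub_nonneg (a : ℕ) {θ : ℝ} (h : 0 ≤ θ) :
    0 ≤ letterTail a θ - letterTail (a + 1) θ := by
  rw [letterTail_sub a h]; positivity

lemma abs_letterTail_sub_le (a : ℕ) {s t : ℝ} (hs : 0 ≤ s) (ht : 0 ≤ t) :
    |letterTail a s - letterTail a t| ≤ a / (a + 1) ^ 2 * |s - t| := by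
  have h1 : (a : ℝ) + 1 + s ≠ 0 := by positivity
  have h2 : (a : ℝ) + 1 + t ≠ 0 := by positivity
  have e : letterTail a s - letterTail a t = a / ((a + 1 + s) * (a + 1 + t)) * (s - t) := by
    rw [letterTail, letterTail]
    field_simp
    ring
  rw [e, abs_mul, abs_of_nonneg (by positivity)]
  gcongr
  nlinarith [mul_nonneg hs ht, (Nat.cast_nonneg a : (0 : ℝ) ≤ a)]

lemma letterAvg_zero (θ : ℝ) (f : ℕ → ℝ) : letterAvg 0 θ f = letterTail 0 θ * f 0 := by
  simp [letterAvg]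

lemma letterAvg_succ (Λ : ℕ) (θ : ℝ) (f : ℕ → ℝ) :
    letterAvg (Λ + 1) θ f = letterAvg Λ θ f + letterTail (Λ + 1) θ * (f (Λ + 1) - f Λ) := by
  rw [letterAvg, letterAvg, sum_range_succ]; ring

lemma letterAvg_eq_abel (Λ : ℕ) {θ : ℝ} (h : 0 ≤ θ) (f : ℕ → ℝ) :
    letterAvg Λ θ f = f 0 + ∑ a ∈ range Λ, letterTail (a + 1) θ * (f (a + 1) - f a) := by
  induction Λ with
  | zero => simp [letterAvg_zero, letterTail_zero h]
  | succ Λ ih => rw [letterAvg_succ, ih, sum_range_succ]; ring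

lemma letterAvg_const (Λ : ℕ) {θ : ℝ} (h : 0 ≤ θ) (c : ℝ) : letterAvg Λ θ (fun _ => c) = c := by
  simp [letterAvg_eq_abel Λ h]

lemma letterAvg_add (Λ : ℕ) (θ : ℝ) (f g : ℕ → ℝ) :
    letterAvg Λ θ (fun a => f a + g a) = letterAvg Λ θ f + letterAvg Λ θ g := by
  simp only [letterAvg, mul_add, sum_add_distrib]; ring

lemma letterAvg_mul_left (Λ : ℕ) (θ c : ℝ) (f : ℕ → ℝ) :
    letterAvg Λ θ (fun a => c * f a) = c * letterAvg Λ θ f := by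
  simp only [letterAvg, mul_add, mul_sum]
  congr 1
  · exact sum_congr rfl fun a _ => by ring
  · ring

lemma letterAvg_sub (Λ : ℕ) (θ : ℝ) (f g : ℕ → ℝ) :
    letterAvg Λ θ (fun a => f a - g a) = letterAvg Λ θ f - letterAvg Λ θ g := by
  simp only [letterAvg, mul_sub, sum_sub_distrib]; ring

lemma letterAvg_mono (Λ : ℕ) {θ : ℝ} (h : 0 ≤ θ) {f g : ℕ → ℝ} (hfg : ∀ a, f a ≤ g a) :
    letterAvg Λ θ f ≤ letterAvg Λ θ g := by
  refine add_le_add (sum_le_sum fun a _ => ?_) ?_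
  · exact mul_le_mul_of_nonneg_left (hfg a) (letterTail_sub_nonneg a h)
  · exact mul_le_mul_of_nonneg_left (hfg Λ) (letterTail_nonneg Λ h)

lemma letterAvg_le (Λ : ℕ) {θ : ℝ} (h : 0 ≤ θ) {f : ℕ → ℝ} {c : ℝ} (hf : ∀ a, f a ≤ c) :
    letterAvg Λ θ f ≤ c :=
  (letterAvg_mono Λ h hf).trans_eq (letterAvg_const Λ h c)

lemma le_letterAvg (Λ : ℕ) {θ : ℝ} (h : 0 ≤ θ) {f : ℕ → ℝ} {c : ℝ} (hf : ∀ a, c ≤ f a) :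
    c ≤ letterAvg Λ θ f :=
  (letterAvg_const Λ h c).symm.trans_le (letterAvg_mono Λ h hf)

lemma abs_letterAvg_le (Λ : ℕ) {θ : ℝ} (h : 0 ≤ θ) (f : ℕ → ℝ) :
    |letterAvg Λ θ f| ≤ letterAvg Λ θ fun a => |f a| := by
  rw [abs_le]
  constructor
  · have := letterAvg_mono Λ h (f := fun a => (-1) * |f a|) (g := f) fun a => by
      linarith [neg_abs_le (f a)]
    rw [letterAvg_mul_left] at this
    linarith
  · exact letterAvg_mono Λ h fun a => le_abs_self _

lemma abs_letterAvg_sub_le {Λ Λ' : ℕ} (hΛ : Λ ≤ Λ') {θ K : ℝ} (h : 0 ≤ θ) (f : ℕ → ℝ)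
    (hf : ∀ a, letterTail (a + 1) θ * |f (a + 1) - f a| ≤ K / ((a + 1) * (a + 2))) :
    |letterAvg Λ θ f - letterAvg Λ' θ f| ≤ K / (Λ + 1) := by
  have key : |letterAvg Λ θ f - letterAvg Λ' θ f| ≤ K / (Λ + 1) - K / (Λ' + 1) := by
    induction Λ', hΛ using Nat.le_induction with
    | base => simp
    | succ n _ ih =>
      rw [letterAvg_succ]
      have h1 := hf n
      have h2 : K / ((n : ℝ) + 1) - K / (((n + 1 : ℕ) : ℝ) + 1) = K / ((n + 1) * (n + 2)) := by
        have : (n : ℝ) + 1 ≠ 0 := by positivity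
        have : (n : ℝ) + 2 ≠ 0 := by positivity
        have : (n : ℝ) + 1 + 1 ≠ 0 := by positivity
        push_cast
        field_simp
        ring
      have h3 : |letterTail (n + 1) θ * (f (n + 1) - f n)| ≤ K / ((n + 1) * (n + 2)) := by
        rwa [abs_mul, abs_of_nonneg (letterTail_nonneg _ h)]
      rw [abs_le] at *
      constructor <;> linarith
  have hK : 0 ≤ K := by
    have := (mul_nonneg (letterTail_nonneg (0 + 1) h) (abs_nonneg (f (0 + 1) - f 0))).trans (hf 0)
    norm_num at this
    linarith
  have : 0 ≤ K / ((Λ' : ℝ) + 1) := by positivity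
  linarith

/-- `g` is Lipschitz on `[0,1]` with constant `K`. -/
def LipUnit (K : ℝ) (g : ℝ → ℝ) : Prop :=
  ∀ s t : ℝ, 0 ≤ s → s ≤ 1 → 0 ≤ t → t ≤ 1 → |g s - g t| ≤ K * |s - t|

lemma LipUnit.nonneg {K : ℝ} {g : ℝ → ℝ} (hg : LipUnit K g) : 0 ≤ K := by
  have := (abs_nonneg _).trans (hg 0 1 le_rfl zero_le_one zero_le_one le_rfl)
  norm_num at this
  exact this

lemma LipUnit.osc_le {K : ℝ} {g : ℝ → ℝ} (hg : LipUnit K g) {s t : ℝ} (hs : 0 ≤ s) (hs1 : s ≤ 1)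
    (ht : 0 ≤ t) (ht1 : t ≤ 1) : |g s - g t| ≤ K := by
  refine (hg s t hs hs1 ht ht1).trans (mul_le_of_le_one_right hg.nonneg ?_)
  rw [abs_le]; constructor <;> linarith

lemma gauss_nonneg (a : ℕ) {θ : ℝ} (h : 0 ≤ θ) : 0 ≤ 1 / ((a : ℝ) + 1 + θ) := by positivity

lemma gauss_le_one (a : ℕ) {θ : ℝ} (h : 0 ≤ θ) : 1 / ((a : ℝ) + 1 + θ) ≤ 1 := by
  rw [div_le_one (by positivity)]
  have : (0 : ℝ) ≤ a := by positivity
  linarith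

lemma sum_inv_cube_le (n : ℕ) : ∑ a ∈ range n, 1 / ((a : ℝ) + 2) ^ 3 ≤ 1 / 4 := by
  have : ∑ a ∈ range n, 1 / ((a : ℝ) + 2) ^ 3 ≤ 1 / 4 - 1 / (2 * ((n : ℝ) + 1) * (n + 2)) := by
    induction n with
    | zero => norm_num
    | succ n ih =>
      rw [sum_range_succ]
      have : 1 / ((n : ℝ) + 2) ^ 3 ≤
          1 / (2 * (n + 1) * (n + 2)) - 1 / (2 * ((n + 1 : ℕ) + 1) * ((n + 1 : ℕ) + 2)) := by
        have e : 1 / (2 * ((n : ℝ) + 1) * (n + 2)) -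
            1 / (2 * ((n + 1 : ℕ) + 1) * ((n + 1 : ℕ) + 2)) = 1 / ((n + 1) * (n + 2) * (n + 3)) := by
          have : (n : ℝ) + 1 ≠ 0 := by positivity
          have : (n : ℝ) + 2 ≠ 0 := by positivity
          have : (n : ℝ) + 3 ≠ 0 := by positivity
          have : (n : ℝ) + 1 + 1 ≠ 0 := by positivity
          have : (n : ℝ) + 1 + 2 ≠ 0 := by positivity
          push_cast
          field_simp
          ring
        rw [e]
        gcongr
        nlinarith [(Nat.cast_nonneg n : (0 : ℝ) ≤ n)]
      linarith
  have h : (0 : ℝ) ≤ 1 / (2 * (n + 1) * (n + 2)) := by positivity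
  linarith

lemma abs_gauss_sub {a : ℕ} {s t : ℝ} (hs : 0 ≤ s) (ht : 0 ≤ t) :
    |1 / ((a : ℝ) + 1 + s) - 1 / (a + 1 + t)| = 1 / ((a + 1 + s) * (a + 1 + t)) * |s - t| := by
  have h1 : (a : ℝ) + 1 + s ≠ 0 := by positivity
  have h2 : (a : ℝ) + 1 + t ≠ 0 := by positivity
  rw [show 1 / ((a : ℝ) + 1 + s) - 1 / (a + 1 + t) =
    1 / ((a + 1 + s) * (a + 1 + t)) * (t - s) by field_simp; ring, abs_mul,
    abs_of_nonneg (by positivity), abs_sub_comm]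

lemma abs_gauss_sub_succ {a : ℕ} {t : ℝ} (ht : 0 ≤ t) :
    |1 / (((a + 1 : ℕ) : ℝ) + 1 + t) - 1 / (a + 1 + t)| ≤ 1 / ((a + 1) * (a + 2)) := by
  have h1 : (a : ℝ) + 2 + t ≠ 0 := by positivity
  have h2 : (a : ℝ) + 1 + t ≠ 0 := by positivity
  rw [show 1 / (((a + 1 : ℕ) : ℝ) + 1 + t) - 1 / (a + 1 + t) =
    -(1 / ((a + 1 + t) * (a + 2 + t))) by
      push_cast; rw [show (a : ℝ) + 1 + 1 + t = a + 2 + t by ring]; field_simp; ring,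
    abs_neg, abs_of_nonneg (by positivity)]
  exact one_div_le_one_div_of_le (by positivity)
    (mul_le_mul (by linarith) (by linarith) (by positivity) (by positivity))

lemma LipUnit.transfer_lip {K : ℝ} {g : ℝ → ℝ} (hg : LipUnit K g) {Λ : ℕ} (hΛ : 1 ≤ Λ) :
    LipUnit (7 / 8 * K) (transfer Λ g) := by
  intro s t hs hs1 ht ht1
  have hK := hg.nonneg
  have h1 : |letterAvg Λ s (fun a => g (1 / (a + 1 + s))) -
      letterAvg Λ s (fun a => g (1 / (a + 1 + t)))| ≤ 5 / 8 * (K * |s - t|) := by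
    rw [← letterAvg_sub]
    refine (abs_letterAvg_le Λ hs _).trans ?_
    have hle : ∀ a : ℕ, |g (1 / (a + 1 + s)) - g (1 / (a + 1 + t))| ≤
        (K * |s - t|) * (1 / ((a + 1 + s) * (a + 1 + t))) := fun a => by
      refine (hg _ _ (gauss_nonneg a hs) (gauss_le_one a hs) (gauss_nonneg a ht)
        (gauss_le_one a ht)).trans_eq ?_
      rw [abs_gauss_sub hs ht]
      ring
    refine (letterAvg_mono Λ hs hle).trans ?_
    rw [letterAvg_mul_left, mul_comm (5 / 8)]
    refine mul_le_mul_of_nonneg_left ?_ (by positivity)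
    obtain ⟨n, rfl⟩ : ∃ n, Λ = n + 1 := ⟨Λ - 1, by omega⟩
    rw [letterAvg_eq_abel _ hs, sum_range_succ']
    have hneg : ∑ a ∈ range n, letterTail (a + 1 + 1) s *
        (1 / ((((a + 1 + 1 : ℕ) : ℝ) + 1 + s) * (((a + 1 + 1 : ℕ) : ℝ) + 1 + t)) -
          1 / ((((a + 1 : ℕ) : ℝ) + 1 + s) * (((a + 1 : ℕ) : ℝ) + 1 + t))) ≤ 0 := by
      refine sum_nonpos fun a _ => mul_nonpos_of_nonneg_of_nonpos (letterTail_nonneg _ hs) ?_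
      rw [sub_nonpos]
      push_cast
      gcongr <;> linarith
    have hfirst : 1 / ((((0 : ℕ) : ℝ) + 1 + s) * (((0 : ℕ) : ℝ) + 1 + t)) +
        letterTail (0 + 1) s * (1 / ((((0 + 1 : ℕ) : ℝ) + 1 + s) * (((0 + 1 : ℕ) : ℝ) + 1 + t)) -
          1 / ((((0 : ℕ) : ℝ) + 1 + s) * (((0 : ℕ) : ℝ) + 1 + t))) ≤ 5 / 8 := by
      rw [letterTail]
      norm_num
      have e : ((1 + t)⁻¹ * (1 + s)⁻¹ + (1 + s) / (2 + s) *
          ((2 + t)⁻¹ * (2 + s)⁻¹ - (1 + t)⁻¹ * (1 + s)⁻¹) : ℝ) =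
          1 / ((1 + t) * ((1 + s) * (2 + s))) + (1 + s) / ((2 + t) * (2 + s) ^ 2) := by
        field_simp
        ring
      rw [e]
      have b1 : 1 / ((1 + t) * ((1 + s) * (2 + s))) ≤ 1 / 2 := by
        gcongr
        nlinarith [mul_nonneg hs ht, mul_nonneg hs hs, mul_nonneg ht (mul_nonneg hs hs)]
      have b2 : (1 + s) / ((2 + t) * (2 + s) ^ 2) ≤ 1 / 8 := by
        rw [div_le_div_iff₀ (by positivity) (by norm_num)]
        nlinarith [mul_nonneg hs ht, mul_nonneg hs hs, mul_nonneg ht (mul_nonneg hs hs)]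
      linarith
    linarith
  have h2 : |letterAvg Λ s (fun a => g (1 / (a + 1 + t))) -
      letterAvg Λ t (fun a => g (1 / (a + 1 + t)))| ≤ 1 / 4 * (K * |s - t|) := by
    rw [letterAvg_eq_abel _ hs, letterAvg_eq_abel _ ht, add_sub_add_left_eq_sub,
      ← sum_sub_distrib]
    refine (abs_sum_le_sum_abs _ _).trans ?_
    refine le_trans ?_ (mul_le_mul_of_nonneg_right (sum_inv_cube_le Λ)
      (show 0 ≤ K * |s - t| by positivity))
    rw [sum_mul]
    refine sum_le_sum fun a _ => ?_
    rw [← sub_mul, abs_mul]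
    have b1 := abs_letterTail_sub_le (a + 1) hs ht
    have b2 := (hg (1 / (((a + 1 : ℕ) : ℝ) + 1 + t)) (1 / (a + 1 + t)) (gauss_nonneg (a + 1) ht)
      (gauss_le_one (a + 1) ht) (gauss_nonneg a ht) (gauss_le_one a ht)).trans
      (mul_le_mul_of_nonneg_left (abs_gauss_sub_succ ht) hK)
    refine (mul_le_mul b1 b2 (abs_nonneg _) (by positivity)).trans_eq ?_
    have : (a : ℝ) + 1 ≠ 0 := by positivity
    have : (a : ℝ) + 2 ≠ 0 := by positivity
    push_cast
    rw [show (a : ℝ) + 1 + 1 = a + 2 by ring]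
    field_simp
  have h3 := abs_sub_le (transfer Λ g s) (letterAvg Λ s fun a => g (1 / (a + 1 + t)))
    (transfer Λ g t)
  rw [transfer, transfer] at h3
  rw [transfer, transfer]
  linarith

lemma LipUnit.iterate {K : ℝ} {g : ℝ → ℝ} (hg : LipUnit K g) {Λ : ℕ} (hΛ : 1 ≤ Λ) (n : ℕ) :
    LipUnit ((7 / 8) ^ n * K) ((transfer Λ)^[n] g) := by
  induction n with
  | zero => simpa using hg
  | succ n ih =>
    rw [Function.iterate_succ_apply', pow_succ, mul_comm ((7 / 8 : ℝ) ^ n), mul_assoc]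
    exact ih.transfer_lip hΛ

lemma abs_transfer_sub_le {Λ Λ' : ℕ} (hΛ : Λ ≤ Λ') {K θ : ℝ} {g : ℝ → ℝ} (hg : LipUnit K g)
    (h : 0 ≤ θ) : |transfer Λ g θ - transfer Λ' g θ| ≤ K / (Λ + 1) := by
  refine abs_letterAvg_sub_le hΛ h _ fun a => ?_
  have b2 := (hg (1 / (((a + 1 : ℕ) : ℝ) + 1 + θ)) (1 / (a + 1 + θ)) (gauss_nonneg (a + 1) h)
    (gauss_le_one (a + 1) h) (gauss_nonneg a h) (gauss_le_one a h)).trans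
    (mul_le_mul_of_nonneg_left (abs_gauss_sub_succ h) hg.nonneg)
  refine (mul_le_of_le_one_left (abs_nonneg _) (letterTail_le_one _ h)).trans (b2.trans_eq ?_)
  ring

lemma abs_transfer_le {Λ : ℕ} {θ B : ℝ} {g : ℝ → ℝ} (hg : ∀ s, 0 ≤ s → s ≤ 1 → |g s| ≤ B)
    (h : 0 ≤ θ) : |transfer Λ g θ| ≤ B :=
  (abs_letterAvg_le Λ h _).trans
    (letterAvg_le Λ h fun a => hg _ (gauss_nonneg a h) (gauss_le_one a h))

lemma transfer_sub (Λ : ℕ) (f g : ℝ → ℝ) (θ : ℝ) :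
    transfer Λ (fun s => f s - g s) θ = transfer Λ f θ - transfer Λ g θ :=
  letterAvg_sub _ _ _ _

lemma abs_iterate_transfer_sub_le {Λ Λ' : ℕ} (h0 : 1 ≤ Λ) (hΛ : Λ ≤ Λ') {K δ : ℝ} {g g' : ℝ → ℝ}
    (hg : LipUnit K g) (hgg : ∀ s, 0 ≤ s → s ≤ 1 → |g s - g' s| ≤ δ) (n : ℕ) {θ : ℝ}
    (h : 0 ≤ θ) (h1 : θ ≤ 1) :
    |(transfer Λ)^[n] g θ - (transfer Λ')^[n] g' θ| ≤
      δ + 8 * (1 - (7 / 8) ^ n) * (K / (Λ + 1)) := by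
  induction n generalizing θ with
  | zero => simpa using hgg θ h h1
  | succ n ih =>
    rw [Function.iterate_succ_apply', Function.iterate_succ_apply']
    have a1 := abs_transfer_sub_le hΛ (hg.iterate h0 n) h
    have a2 := abs_transfer_le (Λ := Λ') (g := fun s => (transfer Λ)^[n] g s - (transfer Λ')^[n] g' s)
      (fun s hs hs1 => ih hs hs1) h
    rw [transfer_sub] at a2
    have a3 := abs_sub_le (transfer Λ ((transfer Λ)^[n] g) θ) (transfer Λ' ((transfer Λ)^[n] g) θ)
      (transfer Λ' ((transfer Λ')^[n] g') θ)
    have e : δ + 8 * (1 - (7 / 8) ^ (n + 1)) * (K / ((Λ : ℝ) + 1)) =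
      δ + 8 * (1 - (7 / 8) ^ n) * (K / (Λ + 1)) + (7 / 8) ^ n * K / (Λ + 1) := by
      rw [pow_succ]; ring
    have a2' : |transfer Λ' ((transfer Λ)^[n] g) θ - transfer Λ' ((transfer Λ')^[n] g') θ| ≤
      δ + 8 * (1 - (7 / 8) ^ n) * (K / (Λ + 1)) := a2
    linarith

lemma abs_iterate_transfer_sub_self_le {Λ : ℕ} {K : ℝ} {g : ℝ → ℝ} (c : ℝ) (hc : ∀ s, 0 ≤ s → s ≤ 1 → |g s - c| ≤ K) (n : ℕ) {θ : ℝ}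
    (h : 0 ≤ θ) (h1 : θ ≤ 1) : |(transfer Λ)^[n] g θ - c| ≤ K := by
  induction n generalizing θ with
  | zero => exact hc θ h h1
  | succ n ih =>
    rw [Function.iterate_succ_apply']
    have a2 := abs_transfer_le (Λ := Λ) (g := fun s => (transfer Λ)^[n] g s - c)
      (fun s hs hs1 => ih hs hs1) h
    rw [transfer_sub Λ ((transfer Λ)^[n] g) (fun _ => c)] at a2
    rwa [show transfer Λ (fun _ => c) θ = c from letterAvg_const Λ h c] at a2

/-- The iterates of the transfer operators converge, uniformly in the truncation level. -/
lemma exists_limit_iterate_transfer {K : ℝ} {m : ℕ → ℝ → ℝ} (hm : ∀ Λ, LipUnit K (m Λ))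
    (hmm : ∀ Λ Λ', Λ ≤ Λ' → ∀ s, 0 ≤ s → s ≤ 1 → |m Λ s - m Λ' s| ≤ K / (Λ + 1)) :
    ∃ c : ℝ, ∀ Λ n : ℕ, 1 ≤ Λ →
      |(transfer Λ)^[n] (m Λ) 0 - c| ≤ K * (7 / 8) ^ n + 9 * K / (Λ + 1) := by
  have hK := (hm 0).nonneg
  have key : ∀ Λ Λ' n n' : ℕ, 1 ≤ Λ → Λ ≤ Λ' → n ≤ n' →
      |(transfer Λ)^[n] (m Λ) 0 - (transfer Λ')^[n'] (m Λ') 0| ≤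
        K * (7 / 8) ^ n + 9 * K / (Λ + 1) := by
    intro Λ Λ' n n' h0 hΛ hn
    have a1 := abs_iterate_transfer_sub_le h0 hΛ (hm Λ) (hmm Λ Λ' hΛ) n (le_refl (0 : ℝ))
      zero_le_one
    have hL := (hm Λ').iterate (h0.trans hΛ) n
    have a2 := abs_iterate_transfer_sub_self_le (Λ := Λ') ((transfer Λ')^[n] (m Λ') 0)
      (fun s hs hs1 => hL.osc_le hs hs1 le_rfl zero_le_one) (n' - n) (le_refl (0 : ℝ)) zero_le_one
    rw [← Function.iterate_add_apply, Nat.sub_add_cancel hn] at a2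
    have a3 := abs_sub_le ((transfer Λ)^[n] (m Λ) 0) ((transfer Λ')^[n] (m Λ') 0)
      ((transfer Λ')^[n'] (m Λ') 0)
    rw [abs_sub_comm] at a2
    have a4 : 0 ≤ (7 / 8 : ℝ) ^ n * (K / (Λ + 1)) := by positivity
    have e : 9 * K / ((Λ : ℝ) + 1) = 9 * (K / (Λ + 1)) := by ring
    rw [e]
    nlinarith
  have hcauchy : CauchySeq fun k : ℕ => (transfer k)^[k] (m k) 0 := by
    refine Metric.cauchySeq_iff'.mpr fun ε hε => ?_
    have hlim : Tendsto (fun k : ℕ => K * (7 / 8) ^ k + 9 * K / ((k : ℝ) + 1)) atTop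
        (nhds (K * 0 + 0)) := by
      refine ((tendsto_pow_atTop_nhds_zero_of_lt_one (by norm_num) (by norm_num)).const_mul K).add ?_
      exact tendsto_const_nhds.div_atTop
        (tendsto_atTop_add_const_right _ _ tendsto_natCast_atTop_atTop)
    rw [mul_zero, zero_add] at hlim
    obtain ⟨k, hk, hk1⟩ := ((hlim.eventually (gt_mem_nhds hε)).and (eventually_ge_atTop 1)).exists
    refine ⟨k, fun j hj => ?_⟩
    rw [dist_comm, Real.dist_eq]
    exact (key k j k j hk1 hj hj).trans_lt hk
  obtain ⟨c, hc⟩ := cauchySeq_tendsto_of_complete hcauchy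
  refine ⟨c, fun Λ n h0 => ?_⟩
  refine le_of_tendsto ((tendsto_const_nhds.sub hc).abs) ?_
  filter_upwards [eventually_ge_atTop Λ, eventually_ge_atTop n] with k hk hk'
  exact key Λ k n k h0 hk hk'

/-- The ratio of the last two convergent denominators. -/
noncomputable def cfRatio (l : List ℕ) : ℝ := (cfPair l).2 / (cfPair l).1

lemma cfRatio_nil : cfRatio [] = 0 := by simp [cfRatio, cfPair]

lemma cfRatio_cons (a : ℕ) (l : List ℕ) : cfRatio (a :: l) = 1 / (a + 1 + cfRatio l) := by
  have h : (0 : ℝ) < (cfPair l).1 := by exact_mod_cast cfPair_pos l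
  simp only [cfRatio, cfPair]
  push_cast
  field_simp

lemma cfRatio_nonneg (l : List ℕ) : 0 ≤ cfRatio l := by rw [cfRatio]; positivity

lemma cfRatio_le_one (l : List ℕ) : cfRatio l ≤ 1 := by
  have h : (0 : ℝ) < (cfPair l).1 := by exact_mod_cast cfPair_pos l
  rw [cfRatio, div_le_one h]
  exact_mod_cast cfPair_snd_le l

/-- The average of `φ` over histories of `n` letters, each truncated at `Λ`. -/
noncomputable def historyAvg (Λ : ℕ) : ℕ → (List ℕ → ℝ) → ℝ
  | 0, φ => φ []
  | n + 1, φ => historyAvg Λ n fun l => letterAvg Λ (cfRatio l) fun a => φ (a :: l)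

lemma historyAvg_mono (Λ n : ℕ) {φ ψ : List ℕ → ℝ} (h : ∀ l, l.length = n → φ l ≤ ψ l) :
    historyAvg Λ n φ ≤ historyAvg Λ n ψ := by
  induction n generalizing φ ψ with
  | zero => exact h [] rfl
  | succ n ih =>
    refine ih fun l hl => letterAvg_mono Λ (cfRatio_nonneg l) fun a => h _ ?_
    simp [hl]

lemma historyAvg_add (Λ n : ℕ) (φ ψ : List ℕ → ℝ) :
    historyAvg Λ n (fun l => φ l + ψ l) = historyAvg Λ n φ + historyAvg Λ n ψ := by
  induction n generalizing φ ψ with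
  | zero => rfl
  | succ n ih => simp only [historyAvg, letterAvg_add, ih]

lemma historyAvg_mul_left (Λ n : ℕ) (c : ℝ) (φ : List ℕ → ℝ) :
    historyAvg Λ n (fun l => c * φ l) = c * historyAvg Λ n φ := by
  induction n generalizing φ with
  | zero => rfl
  | succ n ih => simp only [historyAvg, letterAvg_mul_left, ih]

lemma historyAvg_const (Λ n : ℕ) (c : ℝ) : historyAvg Λ n (fun _ => c) = c := by
  induction n with
  | zero => rfl
  | succ n ih => simp only [historyAvg, letterAvg_const Λ (cfRatio_nonneg _), ih]

lemma historyAvg_sum {ι : Type*} (Λ n : ℕ) (s : Finset ι) (φ : ι → List ℕ → ℝ) :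
    historyAvg Λ n (fun l => ∑ i ∈ s, φ i l) = ∑ i ∈ s, historyAvg Λ n (φ i) := by
  classical
  induction s using Finset.induction_on with
  | empty => simp [historyAvg_const]
  | insert i s hi ih => simp only [sum_insert hi, historyAvg_add, ih]

/-- The sum of `f` along a history. -/
noncomputable def birkhoff (f : ℕ → ℝ → ℝ) : List ℕ → ℝ
  | [] => 0
  | a :: l => f a (cfRatio l) + birkhoff f l

lemma historyAvg_birkhoff_sq_le {Λ : ℕ} {z : ℕ → ℝ → ℝ} {C : ℝ}
    (h0 : ∀ θ, 0 ≤ θ → θ ≤ 1 → letterAvg Λ θ (fun a => z a θ) = 0)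
    (h2 : ∀ θ, 0 ≤ θ → θ ≤ 1 → letterAvg Λ θ (fun a => z a θ ^ 2) ≤ C) (n : ℕ) :
    historyAvg Λ n (fun l => birkhoff z l ^ 2) ≤ n * C := by
  induction n with
  | zero => simp [historyAvg, birkhoff]
  | succ n ih =>
    have : historyAvg Λ (n + 1) (fun l => birkhoff z l ^ 2) ≤
        historyAvg Λ n (fun l => birkhoff z l ^ 2 + C) := by
      refine historyAvg_mono Λ n fun l _ => ?_
      have e : (fun a => birkhoff z (a :: l) ^ 2) = fun a =>
          (z a (cfRatio l) ^ 2 + 2 * birkhoff z l * z a (cfRatio l)) + birkhoff z l ^ 2 := by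
        funext a; simp only [birkhoff]; ring
      rw [e, letterAvg_add, letterAvg_add, letterAvg_mul_left, letterAvg_const Λ (cfRatio_nonneg l),
        h0 _ (cfRatio_nonneg l) (cfRatio_le_one l)]
      linarith [h2 _ (cfRatio_nonneg l) (cfRatio_le_one l)]
    rw [historyAvg_add, historyAvg_const] at this
    push_cast
    linarith

/-- The truncated potential solving the Poisson equation for `m` up to `(transfer Λ)^[n] m`. -/
noncomputable def potential (Λ : ℕ) (m : ℝ → ℝ) (n : ℕ) (θ : ℝ) : ℝ :=
  ∑ j ∈ range n, (transfer Λ)^[j] m θ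

lemma transfer_potential (Λ : ℕ) (m : ℝ → ℝ) (n : ℕ) {θ : ℝ} (h : 0 ≤ θ) :
    transfer Λ (potential Λ m n) θ + m θ = potential Λ m n θ + (transfer Λ)^[n] m θ := by
  induction n with
  | zero =>
    have : potential Λ m 0 = fun _ => 0 := by funext; simp [potential]
    rw [this, transfer, letterAvg_const Λ h]
    simp
  | succ n ih =>
    have e : potential Λ m (n + 1) = fun t => potential Λ m n t + (transfer Λ)^[n] m t := by
      funext t; rw [potential, sum_range_succ, potential]
    have e2 : transfer Λ (potential Λ m (n + 1)) θ =
        transfer Λ (potential Λ m n) θ + (transfer Λ)^[n + 1] m θ := by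
      rw [e, Function.iterate_succ_apply']
      exact letterAvg_add _ _ _ _
    rw [e2, e]
    linarith

lemma abs_potential_sub_le {Λ : ℕ} (hΛ : 1 ≤ Λ) {m : ℝ → ℝ} {K : ℝ} (hm : LipUnit K m) (n : ℕ)
    {s t : ℝ} (hs : 0 ≤ s) (hs1 : s ≤ 1) (ht : 0 ≤ t) (ht1 : t ≤ 1) :
    |potential Λ m n s - potential Λ m n t| ≤ 8 * K := by
  rw [potential, potential, ← sum_sub_distrib]
  refine (abs_sum_le_sum_abs _ _).trans ?_
  refine (sum_le_sum fun j _ => (hm.iterate hΛ j).osc_le hs hs1 ht ht1).trans ?_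
  rw [← sum_mul]
  refine mul_le_mul_of_nonneg_right ?_ hm.nonneg
  rw [geom_sum_eq (by norm_num)]
  have : (0 : ℝ) ≤ (7 / 8) ^ n := by positivity
  norm_num
  linarith

lemma nat_mul_pow_le (n : ℕ) : (n : ℝ) * (7 / 8) ^ n ≤ 8 := by
  have h := one_add_mul_le_pow (a := (1 / 7 : ℝ)) (by norm_num) n
  have h2 : (7 / 8 : ℝ) ^ n * (1 + 1 / 7) ^ n = 1 := by rw [← mul_pow]; norm_num
  have h3 : 0 < (7 / 8 : ℝ) ^ n := by positivity
  nlinarith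

lemma sq_letterAvg_sub {Λ : ℕ} {θ : ℝ} (h : 0 ≤ θ) (y : ℕ → ℝ) :
    letterAvg Λ θ (fun a => (y a - letterAvg Λ θ y) ^ 2) ≤ letterAvg Λ θ fun a => y a ^ 2 := by
  have e : (fun a => (y a - letterAvg Λ θ y) ^ 2) = fun a =>
      (y a ^ 2 + (-2 * letterAvg Λ θ y) * y a) + letterAvg Λ θ y ^ 2 := by funext a; ring
  rw [e, letterAvg_add, letterAvg_add, letterAvg_mul_left, letterAvg_const Λ h]
  nlinarith [sq_nonneg (letterAvg Λ θ y)]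

/-- A quantitative weak law of large numbers for sums along histories. -/
lemma historyAvg_birkhoff_sub_sq_le {Λ : ℕ} (hΛ : 1 ≤ Λ) {f : ℕ → ℝ → ℝ} {m : ℝ → ℝ} {K B : ℝ}
    (hfm : ∀ θ, 0 ≤ θ → θ ≤ 1 → letterAvg Λ θ (fun a => f a θ) = m θ) (hm : LipUnit K m)
    (hB : ∀ θ, 0 ≤ θ → θ ≤ 1 → letterAvg Λ θ (fun a => f a θ ^ 2) ≤ B) (n : ℕ) :
    historyAvg Λ n (fun l => (birkhoff f l - n * (transfer Λ)^[n] m 0) ^ 2) ≤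
      n * (4 * B + 256 * K ^ 2) + 512 * K ^ 2 := by
  have hK := hm.nonneg
  set h := potential Λ m n with hh
  set G := (transfer Λ)^[n] m with hG
  have hosc : ∀ s t : ℝ, 0 ≤ s → s ≤ 1 → 0 ≤ t → t ≤ 1 → |h s - h t| ≤ 8 * K :=
    fun s t hs hs1 ht ht1 => abs_potential_sub_le hΛ hm n hs hs1 ht ht1
  set y : ℕ → ℝ → ℝ := fun a θ => f a θ + (h (1 / (a + 1 + θ)) - h θ) with hy
  have hyavg : ∀ θ, 0 ≤ θ → θ ≤ 1 → letterAvg Λ θ (fun a => y a θ) = G θ := by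
    intro θ h0 h1
    rw [hy, letterAvg_add, letterAvg_sub, letterAvg_const Λ h0, hfm θ h0 h1]
    have := transfer_potential Λ m n h0
    rw [← hh, ← hG, transfer] at this
    linarith
  set z : ℕ → ℝ → ℝ := fun a θ => y a θ - G θ with hz
  have hz0 : ∀ θ, 0 ≤ θ → θ ≤ 1 → letterAvg Λ θ (fun a => z a θ) = 0 := by
    intro θ h0 h1
    rw [hz, letterAvg_sub, letterAvg_const Λ h0, hyavg θ h0 h1, sub_self]
  have hz2 : ∀ θ, 0 ≤ θ → θ ≤ 1 → letterAvg Λ θ (fun a => z a θ ^ 2) ≤ 2 * B + 128 * K ^ 2 := by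
    intro θ h0 h1
    have b1 := sq_letterAvg_sub (Λ := Λ) h0 (fun a => y a θ)
    rw [hyavg θ h0 h1] at b1
    refine b1.trans ?_
    have b2 : ∀ a, y a θ ^ 2 ≤ 2 * f a θ ^ 2 + 128 * K ^ 2 := by
      intro a
      have := sq_le_sq' (abs_le.mp (hosc _ θ (gauss_nonneg a h0) (gauss_le_one a h0) h0 h1)).1
        (abs_le.mp (hosc _ θ (gauss_nonneg a h0) (gauss_le_one a h0) h0 h1)).2
      simp only [hy]
      nlinarith [sq_nonneg (f a θ - (h (1 / (a + 1 + θ)) - h θ))]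
    refine (letterAvg_mono Λ h0 b2).trans ?_
    rw [letterAvg_add, letterAvg_mul_left, letterAvg_const Λ h0]
    linarith [hB θ h0 h1]
  have hD := historyAvg_birkhoff_sq_le hz0 hz2 n
  have hrel : ∀ l : List ℕ, |birkhoff f l - l.length * G 0 - birkhoff z l +
      (h (cfRatio l) - h 0)| ≤ l.length * ((7 / 8) ^ n * K) := by
    intro l
    induction l with
    | nil => simp [birkhoff, cfRatio_nil]
    | cons a l ih =>
      have b := (hm.iterate hΛ n).osc_le (cfRatio_nonneg l) (cfRatio_le_one l) le_rfl zero_le_one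
      rw [← hG] at b
      have e : birkhoff f (a :: l) - (a :: l).length * G 0 - birkhoff z (a :: l) +
          (h (cfRatio (a :: l)) - h 0) = (birkhoff f l - l.length * G 0 - birkhoff z l +
          (h (cfRatio l) - h 0)) + (G (cfRatio l) - G 0) := by
        simp only [birkhoff, hz, hy, cfRatio_cons, List.length_cons]
        push_cast
        ring
      rw [e]
      refine (abs_add_le _ _).trans ?_
      simp only [List.length_cons]
      push_cast
      linarith
  have hfin : ∀ l : List ℕ, l.length = n →
      (birkhoff f l - n * G 0) ^ 2 ≤ 2 * birkhoff z l ^ 2 + 512 * K ^ 2 := by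
    intro l hl
    have b1 := hrel l
    rw [hl] at b1
    have b2 := hosc _ 0 (cfRatio_nonneg l) (cfRatio_le_one l) le_rfl zero_le_one
    have b3 := mul_le_mul_of_nonneg_right (nat_mul_pow_le n) hK
    rw [mul_assoc] at b3
    have b4 : |birkhoff f l - n * G 0 - birkhoff z l| ≤ 16 * K := by
      rw [abs_le] at *
      constructor <;> linarith
    have b5 := sq_le_sq' (abs_le.mp b4).1 (abs_le.mp b4).2
    nlinarith [sq_nonneg (birkhoff f l - n * G 0 - 2 * birkhoff z l)]
  refine (historyAvg_mono Λ n hfin).trans ?_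
  rw [historyAvg_add, historyAvg_mul_left, historyAvg_const]
  nlinarith

open Classical in
/-- The probability of a set of histories of `n` letters. -/
noncomputable def historyProb (Λ n : ℕ) (A : Set (List ℕ)) : ℝ :=
  historyAvg Λ n fun l => if l ∈ A then 1 else 0

lemma historyProb_mono (Λ n : ℕ) {A B : Set (List ℕ)} (h : ∀ l, l.length = n → l ∈ A → l ∈ B) :
    historyProb Λ n A ≤ historyProb Λ n B := by
  refine historyAvg_mono Λ n fun l hl => ?_
  by_cases hA : l ∈ A
  · simp [hA, h l hl hA]
  · simp only [hA, if_false]; split_ifs <;> norm_num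

lemma historyProb_union_le (Λ n : ℕ) (A B : Set (List ℕ)) :
    historyProb Λ n (A ∪ B) ≤ historyProb Λ n A + historyProb Λ n B := by
  rw [historyProb, historyProb, historyProb, ← historyAvg_add]
  refine historyAvg_mono Λ n fun l _ => ?_
  by_cases hA : l ∈ A <;> by_cases hB : l ∈ B <;> simp [hA, hB]

lemma historyProb_chebyshev {Λ n : ℕ} {X : List ℕ → ℝ} {δ V : ℝ} (hδ : 0 < δ)
    (hV : historyAvg Λ n (fun l => X l ^ 2) ≤ V) : historyProb Λ n {l | δ < |X l|} ≤ V / δ ^ 2 := by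
  have : historyProb Λ n {l | δ < |X l|} ≤ historyAvg Λ n (fun l => (δ ^ 2)⁻¹ * X l ^ 2) := by
    refine historyAvg_mono Λ n fun l _ => ?_
    by_cases h : δ < |X l|
    · simp only [Set.mem_ofPred_eq, h, if_true]
      have : δ ^ 2 ≤ X l ^ 2 := by rw [← sq_abs (X l)]; gcongr
      rw [← div_eq_inv_mul, le_div_iff₀ (by positivity), one_mul]
      exact this
    · simp only [Set.mem_ofPred_eq, h, if_false]; positivity
  rw [historyAvg_mul_left] at this
  refine this.trans ?_
  rw [div_eq_inv_mul]
  gcongr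

lemma le_iterate_transfer {Λ : ℕ} {g : ℝ → ℝ} {b : ℝ} (hg : ∀ s, 0 ≤ s → s ≤ 1 → b ≤ g s) (n : ℕ)
    {θ : ℝ} (h : 0 ≤ θ) (h1 : θ ≤ 1) : b ≤ (transfer Λ)^[n] g θ := by
  induction n generalizing θ with
  | zero => exact hg θ h h1
  | succ n ih =>
    rw [Function.iterate_succ_apply']
    exact le_letterAvg Λ h fun a => ih (gauss_nonneg a h) (gauss_le_one a h)

lemma iterate_transfer_mul_left (Λ : ℕ) (g : ℝ → ℝ) (c : ℝ) (n : ℕ) :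
    (transfer Λ)^[n] (fun s => c * g s) = fun s => c * (transfer Λ)^[n] g s := by
  induction n with
  | zero => rfl
  | succ n ih =>
    rw [Function.iterate_succ_apply', ih, Function.iterate_succ_apply']
    funext s
    exact letterAvg_mul_left _ _ _ _

lemma tendsto_mixing_error (K : ℝ) :
    Tendsto (fun k : ℕ => K * (7 / 8) ^ k + 9 * K / ((k : ℝ) + 1)) atTop (nhds 0) := by
  have : Tendsto (fun k : ℕ => K * (7 / 8) ^ k + 9 * K / ((k : ℝ) + 1)) atTop
      (nhds (K * 0 + 0)) := by
    refine ((tendsto_pow_atTop_nhds_zero_of_lt_one (by norm_num) (by norm_num)).const_mul K).add ?_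
    exact tendsto_const_nhds.div_atTop
      (tendsto_atTop_add_const_right _ _ tendsto_natCast_atTop_atTop)
  simpa using this

lemma le_limit_iterate_transfer {K b c : ℝ} {m : ℕ → ℝ → ℝ}
    (hc : ∀ Λ n : ℕ, 1 ≤ Λ →
      |(transfer Λ)^[n] (m Λ) 0 - c| ≤ K * (7 / 8) ^ n + 9 * K / (Λ + 1))
    (hb : ∀ Λ s, 1 ≤ Λ → 0 ≤ s → s ≤ 1 → b ≤ m Λ s) : b ≤ c := by
  have h := (tendsto_mixing_error K).const_add c
  rw [add_zero] at h
  refine ge_of_tendsto h ?_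
  filter_upwards [eventually_ge_atTop 1] with k hk
  have h1 := hc k k hk
  have h2 := le_iterate_transfer (Λ := k) (fun s hs hs1 => hb k s hk hs hs1) k (le_refl (0 : ℝ))
    zero_le_one
  rw [abs_le] at h1
  linarith [h1.2]

/-- The increment of the logarithm of the denominator. -/
noncomputable def logStep (a : ℕ) (θ : ℝ) : ℝ := log (a + 1 + θ)

lemma birkhoff_logStep (l : List ℕ) : birkhoff logStep l = log (cfPair l).1 := by
  induction l with
  | nil => simp [birkhoff, cfPair]
  | cons a l ih =>
    have h : (0 : ℝ) < (cfPair l).1 := by exact_mod_cast cfPair_pos l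
    have h2 := cfRatio_nonneg l
    rw [birkhoff, ih, logStep, ← log_mul (by positivity) h.ne']
    simp only [cfPair, cfRatio]
    push_cast
    congr 1
    field_simp

lemma logStep_succ_sub_nonneg (a : ℕ) {θ : ℝ} (h : 0 ≤ θ) :
    0 ≤ logStep (a + 1) θ - logStep a θ := by
  rw [sub_nonneg, logStep, logStep]
  refine log_le_log (by positivity) ?_
  push_cast
  linarith

lemma logStep_succ_sub_le (a : ℕ) {θ : ℝ} (h : 0 ≤ θ) :
    logStep (a + 1) θ - logStep a θ ≤ 1 / (a + 1) := by
  rw [logStep, logStep, ← log_div (by positivity) (by positivity)]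
  refine (log_le_sub_one_of_pos (by positivity)).trans ?_
  rw [show (((a + 1 : ℕ) : ℝ) + 1 + θ) / (a + 1 + θ) - 1 = 1 / (a + 1 + θ) by
    push_cast; field_simp; ring]
  exact one_div_le_one_div_of_le (by positivity) (by linarith)

lemma abs_logStep_second_diff_le (a : ℕ) {s t : ℝ} (hs : 0 ≤ s) (ht : 0 ≤ t) :
    |(logStep (a + 1) s - logStep a s) - (logStep (a + 1) t - logStep a t)| ≤
      1 / ((a + 1) * (a + 2)) * |s - t| := by
  wlog hst : s ≤ t generalizing s t
  · rw [abs_sub_comm, abs_sub_comm s t]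
    exact this ht hs (le_of_not_ge hst)
  have e : (logStep (a + 1) s - logStep a s) - (logStep (a + 1) t - logStep a t) =
      log (((a + 2 + s) * (a + 1 + t)) / ((a + 1 + s) * (a + 2 + t))) := by
    rw [log_div (by positivity) (by positivity), log_mul (by positivity) (by positivity),
      log_mul (by positivity) (by positivity)]
    simp only [logStep]
    push_cast
    rw [show (a : ℝ) + 1 + 1 + s = a + 2 + s by ring, show (a : ℝ) + 1 + 1 + t = a + 2 + t by ring]
    ring
  rw [e]
  have hdiv : ((a + 2 + s) * (a + 1 + t)) / ((a + 1 + s) * (a + 2 + t)) =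
      1 + (t - s) / (((a : ℝ) + 1 + s) * (a + 2 + t)) := by
    field_simp; ring
  rw [hdiv]
  have hp : 0 ≤ (t - s) / (((a : ℝ) + 1 + s) * (a + 2 + t)) :=
    div_nonneg (by linarith) (by positivity)
  rw [abs_of_nonneg (log_nonneg (by linarith)), abs_of_nonpos (by linarith : s - t ≤ 0), neg_sub]
  have h1 := log_le_sub_one_of_pos (show 0 < 1 + (t - s) / (((a : ℝ) + 1 + s) * (a + 2 + t)) by
    linarith)
  have h2 : (t - s) / (((a : ℝ) + 1 + s) * (a + 2 + t)) ≤ (t - s) / ((a + 1) * (a + 2)) :=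
    div_le_div_of_nonneg_left (by linarith) (by positivity)
      (mul_le_mul (by linarith) (by linarith) (by positivity) (by positivity))
  rw [one_div_mul_eq_div]
  linarith

lemma sum_inv_mul_le (n : ℕ) : ∑ a ∈ range n, 1 / (((a : ℝ) + 1) * (a + 2)) ≤ 1 := by
  have : ∑ a ∈ range n, 1 / (((a : ℝ) + 1) * (a + 2)) = 1 - 1 / ((n : ℝ) + 1) := by
    induction n with
    | zero => norm_num
    | succ n ih =>
      rw [sum_range_succ, ih]
      push_cast
      field_simp
      ring
  have h : (0 : ℝ) ≤ 1 / ((n : ℝ) + 1) := by positivity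
  linarith

lemma lipUnit_logStep (Λ : ℕ) : LipUnit 3 fun θ => letterAvg Λ θ fun a => logStep a θ := by
  intro s t hs hs1 ht ht1
  simp only [letterAvg_eq_abel _ hs, letterAvg_eq_abel _ ht]
  have h0 : |logStep 0 s - logStep 0 t| ≤ |s - t| := by
    wlog hst : s ≤ t generalizing s t
    · rw [abs_sub_comm, abs_sub_comm s t]
      exact this t s ht ht1 hs hs1 (le_of_not_ge hst)
    rw [abs_sub_comm, abs_sub_comm s t, abs_of_nonneg (by linarith : 0 ≤ t - s)]
    simp only [logStep, Nat.cast_zero, zero_add]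
    rw [abs_of_nonneg (sub_nonneg.mpr (log_le_log (by linarith) (by linarith))),
      ← log_div (by linarith) (by linarith)]
    refine (log_le_sub_one_of_pos (div_pos (by linarith) (by linarith))).trans ?_
    rw [div_sub_one (by linarith), div_le_iff₀ (by linarith)]
    nlinarith
  have h1 : |∑ a ∈ range Λ, letterTail (a + 1) s * (logStep (a + 1) s - logStep a s) -
      ∑ a ∈ range Λ, letterTail (a + 1) t * (logStep (a + 1) t - logStep a t)| ≤ 2 * |s - t| := by
    rw [← sum_sub_distrib]
    refine (abs_sum_le_sum_abs _ _).trans ?_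
    refine le_trans ?_ (mul_le_mul_of_nonneg_right (mul_le_of_le_one_right (by norm_num)
      (sum_inv_mul_le Λ)) (abs_nonneg (s - t)))
    rw [mul_sum, sum_mul]
    refine sum_le_sum fun a _ => ?_
    have e : letterTail (a + 1) s * (logStep (a + 1) s - logStep a s) -
        letterTail (a + 1) t * (logStep (a + 1) t - logStep a t) =
        (letterTail (a + 1) s - letterTail (a + 1) t) * (logStep (a + 1) s - logStep a s) +
        letterTail (a + 1) t * ((logStep (a + 1) s - logStep a s) -
          (logStep (a + 1) t - logStep a t)) := by ring
    rw [e]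
    refine (abs_add_le _ _).trans ?_
    rw [abs_mul, abs_mul, abs_of_nonneg (logStep_succ_sub_nonneg a hs),
      abs_of_nonneg (letterTail_nonneg _ ht)]
    have b1 : |letterTail (a + 1) s - letterTail (a + 1) t| ≤ 1 / (a + 2) * |s - t| := by
      refine (abs_letterTail_sub_le (a + 1) hs ht).trans
        (mul_le_mul_of_nonneg_right ?_ (abs_nonneg _))
      push_cast
      rw [div_le_div_iff₀ (by positivity) (by positivity)]
      nlinarith [(Nat.cast_nonneg a : (0 : ℝ) ≤ a)]
    have b2 := mul_le_mul b1 (logStep_succ_sub_le a hs) (logStep_succ_sub_nonneg a hs)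
      (by positivity)
    have b3 := mul_le_of_le_one_left (abs_nonneg ((logStep (a + 1) s - logStep a s) -
      (logStep (a + 1) t - logStep a t))) (letterTail_le_one (a + 1) ht)
    have b4 := abs_logStep_second_diff_le a hs ht
    have e2 : 1 / ((a : ℝ) + 2) * |s - t| * (1 / (a + 1)) =
      1 / ((a + 1) * (a + 2)) * |s - t| := by field_simp
    linarith
  rw [add_sub_add_comm]
  refine (abs_add_le _ _).trans ?_
  linarith

lemma abs_letterAvg_logStep_sub_le {Λ Λ' : ℕ} (h : Λ ≤ Λ') {s : ℝ} (hs : 0 ≤ s) (hs1 : s ≤ 1) :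
    |letterAvg Λ s (fun a => logStep a s) - letterAvg Λ' s (fun a => logStep a s)| ≤
      3 / (Λ + 1) := by
  refine abs_letterAvg_sub_le h hs _ fun a => ?_
  rw [abs_of_nonneg (logStep_succ_sub_nonneg a hs)]
  have b1 := letterTail_le (a + 1) hs hs1
  refine (mul_le_mul b1 (logStep_succ_sub_le a hs) (logStep_succ_sub_nonneg a hs)
    (by positivity)).trans ?_
  push_cast
  rw [div_mul_div_comm, mul_one, show ((a : ℝ) + 1 + 1) * (a + 1) = (a + 1) * (a + 2) by ring]
  gcongr
  norm_num

lemma log_sq_le_sqrt {y : ℝ} (hy : 1 ≤ y) : log y ^ 2 ≤ 16 * √y := by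
  have h0 : 0 ≤ log y := log_nonneg hy
  have h1 : log y = 4 * log (√(√y)) := by
    rw [log_sqrt (sqrt_nonneg _), log_sqrt (by linarith)]; ring
  have h2 : log (√(√y)) ≤ √(√y) := by
    have := log_le_sub_one_of_pos (x := √(√y)) (by positivity); linarith
  have h3 : log y ≤ 4 * √(√y) := by rw [h1]; linarith
  calc log y ^ 2 ≤ (4 * √(√y)) ^ 2 := by gcongr
    _ = 16 * √y := by rw [mul_pow, sq_sqrt (sqrt_nonneg _)]; norm_num

lemma letterAvg_sqrt_le (Λ : ℕ) {θ : ℝ} (h : 0 ≤ θ) (h1 : θ ≤ 1) :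
    letterAvg Λ θ (fun a => √(a + 1 + θ)) ≤ 4 := by
  have key : letterAvg Λ θ (fun a => √(a + 1 + θ)) ≤
      √(1 + θ) + (1 + θ) * (1 / √(1 + θ) - 1 / √(Λ + 1 + θ)) := by
    induction Λ with
    | zero => simp [letterAvg_zero, letterTail_zero h]
    | succ Λ ih =>
      rw [letterAvg_succ]
      set y : ℝ := Λ + 1 + θ with hy
      have hy0 : 0 < y := by positivity
      have e1 : ((Λ + 1 : ℕ) : ℝ) + 1 + θ = y + 1 := by rw [hy]; push_cast; ring
      rw [letterTail, e1]
      have hs : 0 < √y := sqrt_pos.mpr hy0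
      have hs1 : 0 < √(y + 1) := sqrt_pos.mpr (by linarith)
      have hle : √y ≤ √(y + 1) := sqrt_le_sqrt (by linarith)
      have b : (√(y + 1) - √y) / (y + 1) ≤ 1 / √y - 1 / √(y + 1) := by
        rw [show 1 / √y - 1 / √(y + 1) = (√(y + 1) - √y) / (√y * √(y + 1)) by field_simp]
        refine div_le_div_of_nonneg_left (by linarith) (by positivity) ?_
        nlinarith [sq_sqrt (show 0 ≤ y + 1 by linarith)]
      have b2 := mul_le_mul_of_nonneg_left b (show 0 ≤ 1 + θ by linarith)
      have e2 : (1 + θ) / (y + 1) * (√(y + 1) - √y) = (1 + θ) * ((√(y + 1) - √y) / (y + 1)) := by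
        ring
      rw [e2]
      linarith
  refine key.trans ?_
  have hs : 0 < √(1 + θ) := sqrt_pos.mpr (by linarith)
  have e : (1 + θ) * (1 / √(1 + θ)) = √(1 + θ) := by
    rw [mul_one_div, div_sqrt]
  have h2 : √(1 + θ) ≤ 2 := by rw [sqrt_le_left (by norm_num)]; linarith
  have h3 : 0 ≤ (1 + θ) * (1 / √(Λ + 1 + θ)) := by positivity
  rw [mul_sub]
  linarith

lemma letterAvg_logStep_sq_le (Λ : ℕ) {θ : ℝ} (h : 0 ≤ θ) (h1 : θ ≤ 1) :
    letterAvg Λ θ (fun a => logStep a θ ^ 2) ≤ 64 := by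
  have : ∀ a : ℕ, logStep a θ ^ 2 ≤ 16 * √(a + 1 + θ) := fun a =>
    log_sq_le_sqrt (by have : (0 : ℝ) ≤ a := by positivity
                       linarith)
  refine (letterAvg_mono Λ h this).trans ?_
  rw [letterAvg_mul_left]
  linarith [letterAvg_sqrt_le Λ h h1]

lemma le_letterAvg_logStep {Λ : ℕ} (hΛ : 1 ≤ Λ) {θ : ℝ} (h : 0 ≤ θ) :
    log 2 / 2 ≤ letterAvg Λ θ (fun a => logStep a θ) := by
  obtain ⟨n, rfl⟩ : ∃ n, Λ = n + 1 := ⟨Λ - 1, by omega⟩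
  rw [letterAvg_eq_abel _ h, sum_range_succ']
  have hs : 0 ≤ ∑ a ∈ range n, letterTail (a + 1 + 1) θ *
      (logStep (a + 1 + 1) θ - logStep (a + 1) θ) :=
    sum_nonneg fun a _ => mul_nonneg (letterTail_nonneg _ h) (logStep_succ_sub_nonneg _ h)
  have h2 : 1 / 2 ≤ letterTail (0 + 1) θ := by
    rw [letterTail]
    push_cast
    rw [div_le_div_iff₀ (by norm_num) (by linarith)]
    linarith
  have h3 : 0 ≤ logStep 0 θ := log_nonneg (by simp [h])
  have h4 : log 2 ≤ logStep (0 + 1) θ := by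
    rw [logStep]
    refine log_le_log (by norm_num) ?_
    push_cast
    linarith
  have h5 := mul_le_mul_of_nonneg_right h2 (logStep_succ_sub_nonneg 0 h)
  linarith

/-- Law of large numbers for the logarithm of the denominator. -/
lemma exists_log_denominator_law : ∃ lam : ℝ, 0 < lam ∧ ∀ η : ℝ, 0 < η → ∀ᶠ n : ℕ in atTop,
    ∀ Λ : ℕ, n ≤ Λ →
      historyProb Λ n {l | η * n < |log (cfPair l).1 - lam * n|} ≤ η := by
  obtain ⟨c, hc⟩ := exists_limit_iterate_transfer lipUnit_logStep
    fun Λ Λ' h s hs hs1 => abs_letterAvg_logStep_sub_le h hs hs1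
  refine ⟨c, (by positivity : 0 < log 2 / 2).trans_le (le_limit_iterate_transfer hc
    fun Λ s hΛ hs _ => le_letterAvg_logStep hΛ hs), fun η hη => ?_⟩
  have hlim := (tendsto_mixing_error 3).eventually (gt_mem_nhds (show 0 < η / 2 by positivity))
  filter_upwards [hlim, eventually_ge_atTop 1,
    tendsto_natCast_atTop_atTop.eventually (eventually_ge_atTop (28800 / η ^ 3))]
    with n hn hn1 hn2 Λ hΛ
  have hn' : (1 : ℝ) ≤ n := by exact_mod_cast hn1
  have hΛ' : (n : ℝ) ≤ Λ := by exact_mod_cast hΛ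
  set u := (transfer Λ)^[n] (fun θ => letterAvg Λ θ fun a => logStep a θ) 0 with hu
  have hcu : |u - c| ≤ η / 2 := by
    refine (hc Λ n (hn1.trans hΛ)).trans (le_trans ?_ hn.le)
    gcongr
  have hvar := historyAvg_birkhoff_sub_sq_le (hn1.trans hΛ) (fun θ _ _ => rfl) (lipUnit_logStep Λ)
    (fun θ h h1 => letterAvg_logStep_sq_le Λ h h1) n
  have hch := historyProb_chebyshev (δ := η / 2 * n) (by positivity) hvar
  refine (historyProb_mono Λ n ?_).trans (hch.trans ?_)
  · intro l _ hl
    rw [Set.mem_ofPred_eq] at hl ⊢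
    rw [birkhoff_logStep, ← hu]
    have b : |(n : ℝ) * u - c * n| ≤ η / 2 * n := by
      rw [show (n : ℝ) * u - c * n = (u - c) * n by ring, abs_mul, Nat.abs_cast]
      gcongr
    have b2 := abs_sub_le (log (cfPair l).1) (n * u) (c * n)
    linarith
  · rw [div_le_iff₀ (by positivity)]
    rw [div_le_iff₀ (by positivity)] at hn2
    have : 28800 * (n : ℝ) ≤ n * η ^ 3 * n := by nlinarith
    nlinarith

lemma sum_inv_succ_le (L : ℕ) : ∑ a ∈ range L, 1 / ((a : ℝ) + 1) ≤ 1 + log L := by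
  have h := harmonic_le_one_add_log L
  simpa [harmonic, one_div] using h

lemma log_le_sum_inv_succ (L : ℕ) : log (L + 1) ≤ ∑ a ∈ range L, 1 / ((a : ℝ) + 1) := by
  have h := log_add_one_le_harmonic L
  simpa [harmonic, one_div] using h

/-- The mean of the digit `a + 1` truncated at height `L`. -/
noncomputable def truncMean (L : ℕ) (θ : ℝ) : ℝ := ∑ a ∈ range L, letterTail a θ

lemma letterAvg_min {Λ L : ℕ} (hL : 1 ≤ L) (hΛ : L ≤ Λ) (θ : ℝ) :
    letterAvg Λ θ (fun a => min ((a : ℝ) + 1) L) = truncMean L θ := by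
  have hL' : (1 : ℝ) ≤ L := by exact_mod_cast hL
  have key : ∀ Λ : ℕ, letterAvg Λ θ (fun a => min ((a : ℝ) + 1) L) = truncMean (min L (Λ + 1)) θ := by
    intro Λ
    induction Λ with
    | zero =>
      rw [letterAvg_zero, zero_add, min_eq_right hL]
      simp [truncMean, hL']
    | succ Λ ih =>
      rw [letterAvg_succ, ih]
      rcases le_or_gt L (Λ + 1) with hc | hc
      · have hc' : (L : ℝ) ≤ Λ + 1 := by exact_mod_cast hc
        have hd : (L : ℝ) ≤ ((Λ + 1 : ℕ) : ℝ) + 1 := by push_cast; linarith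
        rw [min_eq_left hc, min_eq_left (show L ≤ Λ + 1 + 1 by omega), min_eq_right hc',
          min_eq_right hd]
        ring
      · have hc' : ((Λ + 1 : ℕ) : ℝ) + 1 ≤ L := by exact_mod_cast hc
        have hd : (Λ : ℝ) + 1 ≤ L := by push_cast at hc'; linarith
        rw [min_eq_right hc.le, min_eq_right (show Λ + 1 + 1 ≤ L by omega), min_eq_left hc',
          min_eq_left hd, truncMean, truncMean, sum_range_succ _ (Λ + 1)]
        push_cast
        ring
  rw [key, min_eq_left (by omega)]

lemma abs_truncMean_sub_le {L : ℕ} (hL : 1 ≤ L) {θ : ℝ} (h : 0 ≤ θ) (h1 : θ ≤ 1) :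
    |truncMean L θ - log L * (1 + θ)| ≤ 2 := by
  have e : truncMean L θ = (1 + θ) * ∑ a ∈ range L, 1 / ((a : ℝ) + 1 + θ) := by
    rw [truncMean, mul_sum]
    exact sum_congr rfl fun a _ => by rw [letterTail]; ring
  have hu : ∑ a ∈ range L, 1 / ((a : ℝ) + 1 + θ) ≤ 1 + log L :=
    (sum_le_sum fun a _ => one_div_le_one_div_of_le (by positivity) (by linarith)).trans
      (sum_inv_succ_le L)
  have hl : log L - 1 ≤ ∑ a ∈ range L, 1 / ((a : ℝ) + 1 + θ) := by
    have h2 := log_le_sum_inv_succ (L + 1)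
    rw [sum_range_succ'] at h2
    have h3 : log L ≤ log (((L + 1 : ℕ) : ℝ) + 1) :=
      log_le_log (by exact_mod_cast hL) (by push_cast; linarith)
    have h4 : ∑ a ∈ range L, 1 / (((a + 1 : ℕ) : ℝ) + 1) ≤ ∑ a ∈ range L, 1 / ((a : ℝ) + 1 + θ) :=
      sum_le_sum fun a _ => one_div_le_one_div_of_le (by positivity) (by push_cast; linarith)
    norm_num at h2 h4 ⊢
    norm_num at h3
    linarith
  rw [e, show (1 + θ) * ∑ a ∈ range L, 1 / ((a : ℝ) + 1 + θ) - log L * (1 + θ) =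
    (1 + θ) * (∑ a ∈ range L, 1 / ((a : ℝ) + 1 + θ) - log L) by ring, abs_mul,
    abs_of_nonneg (by linarith : 0 ≤ 1 + θ)]
  have h5 : |∑ a ∈ range L, 1 / ((a : ℝ) + 1 + θ) - log L| ≤ 1 := by
    rw [abs_le]; constructor <;> linarith
  nlinarith

lemma lipUnit_truncMean (L : ℕ) : LipUnit (1 + log L) (truncMean L) := by
  intro s t hs hs1 ht ht1
  rw [truncMean, truncMean, ← sum_sub_distrib]
  refine (abs_sum_le_sum_abs _ _).trans ?_
  refine le_trans ?_ (mul_le_mul_of_nonneg_right (sum_inv_succ_le L) (abs_nonneg _))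
  rw [sum_mul]
  refine sum_le_sum fun a _ => (abs_letterTail_sub_le a hs ht).trans ?_
  refine mul_le_mul_of_nonneg_right ?_ (abs_nonneg _)
  rw [div_le_div_iff₀ (by positivity) (by positivity)]
  nlinarith [(Nat.cast_nonneg a : (0 : ℝ) ≤ a)]

lemma letterAvg_min_sq_le {Λ L : ℕ} (hL : 1 ≤ L) (hΛ : L ≤ Λ) {θ : ℝ} (h : 0 ≤ θ) (h1 : θ ≤ 1) :
    letterAvg Λ θ (fun a => min ((a : ℝ) + 1) L ^ 2) ≤ L * (2 * log L + 2) := by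
  have hm : letterAvg Λ θ (fun a => min ((a : ℝ) + 1) L ^ 2) ≤
      letterAvg Λ θ (fun a => L * min ((a : ℝ) + 1) L) := by
    refine letterAvg_mono Λ h fun a => ?_
    rw [sq]
    exact mul_le_mul_of_nonneg_right (min_le_right _ _) (by positivity)
  rw [letterAvg_mul_left, letterAvg_min hL hΛ] at hm
  refine hm.trans (mul_le_mul_of_nonneg_left ?_ (by positivity))
  have h2 := (abs_le.mp (abs_truncMean_sub_le hL h h1)).2
  have h3 : 0 ≤ log (L : ℝ) := log_natCast_nonneg L
  nlinarith

lemma letterAvg_large {Λ L : ℕ} (hΛ : L ≤ Λ) (θ : ℝ) :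
    letterAvg Λ θ (fun a => if L ≤ a then (1 : ℝ) else 0) = letterTail L θ := by
  have key : ∀ Λ : ℕ, letterAvg Λ θ (fun a => if L ≤ a then (1 : ℝ) else 0) =
      if L ≤ Λ then letterTail L θ else 0 := by
    intro Λ
    induction Λ with
    | zero =>
      rw [letterAvg_zero]
      by_cases hc : L ≤ 0
      · obtain rfl : L = 0 := by omega
        simp
      · simp [hc]
    | succ Λ ih =>
      rw [letterAvg_succ, ih]
      by_cases hc : L ≤ Λ
      · simp [hc, hc.trans (Nat.le_succ Λ)]
      · by_cases hd : L ≤ Λ + 1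
        · obtain rfl : L = Λ + 1 := by omega
          simp
        · simp [hc, hd]
  rw [key, if_pos hΛ]

open Classical in
lemma historyProb_exists_large_le {Λ L : ℕ} (hΛ : L ≤ Λ) (n : ℕ) :
    historyProb Λ n {l | ∃ a ∈ l, L ≤ a} ≤ n * (2 / (L + 1)) := by
  induction n with
  | zero => simp [historyProb, historyAvg]
  | succ n ih =>
    have e : historyProb Λ (n + 1) {l | ∃ a ∈ l, L ≤ a} ≤
        historyProb Λ n {l | ∃ a ∈ l, L ≤ a} + 2 / ((L : ℝ) + 1) := by
      rw [historyProb, historyProb, historyAvg, ← historyAvg_const Λ n (2 / ((L : ℝ) + 1)),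
        ← historyAvg_add]
      refine historyAvg_mono Λ n fun l _ => ?_
      have h0 := cfRatio_nonneg l
      have h1 := cfRatio_le_one l
      refine le_trans (letterAvg_mono Λ h0 (g := fun a =>
        (if l ∈ {l : List ℕ | ∃ a ∈ l, L ≤ a} then (1 : ℝ) else 0) + if L ≤ a then (1 : ℝ) else 0) ?_) ?_
      · intro a
        by_cases hl : ∃ a ∈ l, L ≤ a <;> by_cases ha : L ≤ a <;> simp [ha, hl]
      · rw [letterAvg_add, letterAvg_const Λ h0, letterAvg_large hΛ]
        have := letterTail_le L h0 h1
        by_cases hl : ∃ a ∈ l, L ≤ a <;> simp [hl, this]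
    push_cast
    linarith

lemma birkhoff_min_eq_quotientSum {L : ℕ} (l : List ℕ) (h : ∀ a ∈ l, a < L) :
    birkhoff (fun a _ => min ((a : ℝ) + 1) L) l = quotientSum l := by
  induction l with
  | nil => simp [birkhoff, quotientSum]
  | cons a l ih =>
    have ha : (a : ℝ) + 1 ≤ L := by exact_mod_cast h a (by simp)
    rw [birkhoff, ih fun b hb => h b (by simp [hb]), min_eq_left ha]
    simp [quotientSum]

lemma lipUnit_one_add : LipUnit 1 fun θ => 1 + θ := by
  intro s t _ _ _ _
  simp

set_option maxHeartbeats 1000000 in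
/-- Law of large numbers for the sum of the partial quotients. -/
lemma exists_quotientSum_law : ∃ κ : ℝ, 1 ≤ κ ∧ ∀ η : ℝ, 0 < η → ∀ᶠ n : ℕ in atTop,
    ∀ Λ : ℕ, n ^ 2 ≤ Λ →
      historyProb Λ n {l | η * (n * log n) < |quotientSum l - κ * (n * log n)|} ≤ η := by
  obtain ⟨κ, hκ⟩ := exists_limit_iterate_transfer (m := fun _ θ => 1 + θ)
    (fun _ => lipUnit_one_add) fun Λ Λ' _ s _ _ => by simp; positivity
  have hκ1 : 1 ≤ κ := le_limit_iterate_transfer hκ fun _ s _ hs _ => by linarith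
  refine ⟨κ, hκ1, fun η hη => ?_⟩
  obtain ⟨K, hK⟩ := exists_nat_ge (4 / η)
  have hK0 : (0 : ℝ) < K := (by positivity : 0 < 4 / η).trans_le hK
  have hK1 : 1 ≤ K := by exact_mod_cast hK0
  have hlog := tendsto_log_atTop.comp (tendsto_natCast_atTop_atTop (R := ℝ))
  filter_upwards [eventually_ge_atTop K, eventually_ge_atTop 3,
    hlog.eventually (eventually_ge_atTop ((44 + κ * log K) / (η / 2))),
    hlog.eventually (eventually_ge_atTop (8 * (24 * K + 6912) / η ^ 3))]
    with n hnK hn3 hx1 hx2 Λ hΛ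
  simp only [Function.comp_apply] at hx1 hx2
  have hn0 : (3 : ℝ) ≤ n := by exact_mod_cast hn3
  have hkx : log K ≤ log n := log_le_log hK0 (by exact_mod_cast hnK)
  have hx : 1 ≤ log n := by
    rw [le_log_iff_exp_le (by linarith)]
    exact exp_one_lt_three.le.trans hn0
  have hxn : log n ≤ n := (log_le_sub_one_of_pos (by linarith)).trans (by linarith)
  have hk0 : 0 ≤ log (K : ℝ) := log_natCast_nonneg K
  set L := K * n with hLdef
  have hL1 : 1 ≤ L := Nat.mul_pos hK1 (by omega)
  have hLΛ : L ≤ Λ := by nlinarith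
  have hL : log L = log K + log n := by
    rw [hLdef, Nat.cast_mul, log_mul (by positivity) (by positivity)]
  set x := log (n : ℝ) with hxdef
  have hLL : log L ≤ L := (log_le_sub_one_of_pos (by exact_mod_cast hL1)).trans (by linarith)
  have hLΛ' : (L : ℝ) ≤ Λ := by exact_mod_cast hLΛ
  have hnΛ : (n : ℝ) ≤ Λ := by
    have : n ≤ Λ := by nlinarith
    exact_mod_cast this
  set u := (transfer Λ)^[n] (truncMean L) 0 with hu
  set v := (transfer Λ)^[n] (fun θ => 1 + θ) 0 with hv
  have hp0 : (0 : ℝ) < (7 / 8) ^ n := by positivity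
  have huv : |u - log L * v| ≤ 10 := by
    have h := abs_iterate_transfer_sub_le (hL1.trans hLΛ) le_rfl (lipUnit_truncMean L)
      (g' := fun s => log L * (1 + s)) (fun s hs hs1 => abs_truncMean_sub_le hL1 hs hs1) n
      (le_refl (0 : ℝ)) zero_le_one
    rw [iterate_transfer_mul_left] at h
    refine h.trans ?_
    have h2 : (1 + log (L : ℝ)) / (Λ + 1) ≤ 1 := by
      rw [div_le_one (by positivity)]
      linarith
    have h3 : 0 ≤ (1 + log (L : ℝ)) / (Λ + 1) := div_nonneg (by linarith) (by positivity)
    nlinarith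
  have hvκ : log L * |v - κ| ≤ 34 := by
    have h := hκ Λ n (hL1.trans hLΛ)
    have h2 : log L ≤ 2 * n := by linarith
    have h3 : (9 : ℝ) * 1 / (Λ + 1) ≤ 9 / n := by
      rw [mul_one]
      exact div_le_div_of_nonneg_left (by norm_num) (by linarith) (by linarith)
    calc log L * |v - κ| ≤ (2 * n) * (1 * (7 / 8) ^ n + 9 / n) :=
          mul_le_mul h2 (h.trans (by linarith)) (abs_nonneg _) (by linarith)
      _ = 2 * (n * (7 / 8) ^ n) + 18 := by field_simp; ring
      _ ≤ 34 := by linarith [nat_mul_pow_le n]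
  have huκ : |u - κ * x| ≤ η / 2 * x := by
    rw [div_le_iff₀ (by positivity)] at hx1
    have e : u - κ * x = (u - log L * v) + (log L * (v - κ) + κ * log K) := by rw [hL]; ring
    have h1 : |log L * (v - κ)| ≤ 34 := by
      rw [abs_mul, abs_of_nonneg (by linarith)]
      exact hvκ
    have h2 : |κ * log K| = κ * log K := abs_of_nonneg (by positivity)
    rw [e]
    have := abs_add_le (u - log L * v) (log L * (v - κ) + κ * log K)
    have := abs_add_le (log L * (v - κ)) (κ * log K)
    linarith
  have hvar := historyAvg_birkhoff_sub_sq_le (hL1.trans hLΛ)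
    (f := fun a _ => min ((a : ℝ) + 1) L) (fun θ _ _ => letterAvg_min hL1 hLΛ θ)
    (lipUnit_truncMean L) (fun θ h h1 => letterAvg_min_sq_le hL1 hLΛ h h1) n
  have hch := historyProb_chebyshev (δ := η / 2 * (n * x)) (by positivity) hvar
  refine (historyProb_mono Λ n (B := {l | ∃ a ∈ l, L ≤ a} ∪
    {l | η / 2 * (n * x) < |birkhoff (fun a _ => min ((a : ℝ) + 1) L) l - n * u|}) ?_).trans
    ((historyProb_union_le _ _ _ _).trans ?_)
  · intro l _ hl
    by_cases hlarge : ∃ a ∈ l, L ≤ a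
    · exact Or.inl hlarge
    · right
      push Not at hlarge
      rw [Set.mem_ofPred_eq] at hl ⊢
      rw [birkhoff_min_eq_quotientSum l hlarge]
      have b : |(n : ℝ) * u - κ * (n * x)| ≤ η / 2 * (n * x) := by
        rw [show (n : ℝ) * u - κ * (n * x) = n * (u - κ * x) by ring, abs_mul, Nat.abs_cast]
        nlinarith
      have b2 := abs_sub_le (quotientSum l : ℝ) (n * u) (κ * (n * x))
      linarith
  · have h1 := historyProb_exists_large_le hLΛ n
    have h2 : (n : ℝ) * (2 / (L + 1)) ≤ η / 2 := by
      rw [div_le_iff₀ hη] at hK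
      rw [mul_div_assoc', div_le_iff₀ (by positivity), hLdef]
      push_cast
      nlinarith
    have h3 : (n * (4 * (L * (2 * log L + 2)) + 256 * (1 + log L) ^ 2) + 512 * (1 + log (L : ℝ)) ^ 2) /
        (η / 2 * (n * x)) ^ 2 ≤ η / 2 := by
      rw [div_le_iff₀ (by positivity)]
      rw [div_le_iff₀ (by positivity)] at hx2
      have hb1 : 2 * log L + 2 ≤ 6 * x := by linarith
      have hb2 : (1 + log (L : ℝ)) ^ 2 ≤ 9 * x * n := by
        have : (1 + log (L : ℝ)) ^ 2 ≤ (3 * x) ^ 2 := by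
          apply pow_le_pow_left₀ <;> linarith
        nlinarith
      have hb3 : (L : ℝ) * (2 * log L + 2) ≤ K * n * (6 * x) := by
        rw [hLdef] at hb1 ⊢
        push_cast at hb1 ⊢
        exact mul_le_mul_of_nonneg_left hb1 (by positivity)
      calc _ ≤ n * (4 * (K * n * (6 * x)) + 256 * (9 * x * n)) + 512 * (9 * x * (n : ℝ)) := by
            gcongr
        _ ≤ n * (4 * (K * n * (6 * x)) + 256 * (9 * x * n)) + n * (512 * (9 * x * (n : ℝ))) := by
            have : 0 ≤ 512 * (9 * x * (n : ℝ)) := by positivity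
            nlinarith
        _ = (8 * (24 * K + 6912)) * ((n : ℝ) ^ 2 * x / 8) := by ring
        _ ≤ (x * η ^ 3) * ((n : ℝ) ^ 2 * x / 8) :=
            mul_le_mul_of_nonneg_right hx2 (by positivity)
        _ = η / 2 * (η / 2 * (n * x)) ^ 2 := by ring
    linarith

lemma exists_cfPair_eq (a : ℕ) : ∀ q : ℕ, 1 ≤ a → a ≤ q → a.Coprime q →
    ∃ l : List ℕ, cfPair l = (q, a) ∧ (∀ b ∈ l, b < q) ∧ l.length ≤ q := by
  induction a using Nat.strong_induction_on with
  | _ a ih =>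
    intro q ha haq hc
    rcases ha.eq_or_lt with rfl | ha
    · refine ⟨[q - 1], ?_, by simp; omega, by simpa using haq⟩
      simp [cfPair]
      omega
    · have hr : 1 ≤ q % a := by
        rw [Nat.one_le_iff_ne_zero]
        intro h0
        have h1 := Nat.Coprime.eq_one_of_dvd hc (Nat.dvd_of_mod_eq_zero h0)
        omega
      have hlt : a < q := lt_of_le_of_ne haq fun h => by
        rw [h, Nat.coprime_self] at hc
        omega
      have hra : q % a < a := Nat.mod_lt _ (by omega)
      have hc' : (q % a).Coprime a := by
        rw [Nat.Coprime, ← Nat.gcd_rec, ← Nat.Coprime]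
        exact hc
      obtain ⟨l, hl, hb, hlen⟩ := ih (q % a) hra a hr hra.le hc'
      have hqa : 1 ≤ q / a := Nat.div_pos haq (by omega)
      refine ⟨(q / a - 1) :: l, ?_, ?_, ?_⟩
      · rw [cfPair, hl, Nat.sub_add_cancel hqa]
        simp only [Prod.mk.injEq, and_true]
        rw [mul_comm]
        exact Nat.div_add_mod q a
      · intro b hb'
        rcases List.mem_cons.mp hb' with rfl | h
        · have := Nat.div_le_self q a
          omega
        · exact (hb b h).trans hlt
      · simp only [List.length_cons]
        omega

/-- The probability of the history `l`. -/
noncomputable def historyWeight (l : List ℕ) : ℝ :=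
  1 / ((cfPair l).1 * ((cfPair l).1 + (cfPair l).2))

lemma historyWeight_cons (a : ℕ) (l : List ℕ) : historyWeight (a :: l) =
    (letterTail a (cfRatio l) - letterTail (a + 1) (cfRatio l)) * historyWeight l := by
  have h : (0 : ℝ) < (cfPair l).1 := by exact_mod_cast cfPair_pos l
  rw [letterTail_sub a (cfRatio_nonneg l), historyWeight, historyWeight, cfRatio, cfPair]
  push_cast
  field_simp
  ring

lemma historyWeight_le_historyProb {Λ : ℕ} (l : List ℕ) (h : ∀ a ∈ l, a < Λ) :
    historyWeight l ≤ historyProb Λ l.length {l} := by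
  induction l with
  | nil => simp [historyWeight, historyProb, historyAvg, cfPair]
  | cons a l ih =>
    rw [historyWeight_cons]
    have h0 := letterTail_sub_nonneg a (cfRatio_nonneg l)
    refine (mul_le_mul_of_nonneg_left (ih fun b hb => h b (by simp [hb])) h0).trans ?_
    rw [historyProb, historyProb, ← historyAvg_mul_left, List.length_cons, historyAvg]
    refine historyAvg_mono Λ _ fun l' _ => ?_
    by_cases hl : l' = l
    · subst hl
      have ha : a < Λ := h a (by simp)
      have hpos : 0 ≤ letterTail Λ (cfRatio l') *
          (if Λ :: l' ∈ ({a :: l'} : Set (List ℕ)) then (1 : ℝ) else 0) :=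
        mul_nonneg (letterTail_nonneg Λ (cfRatio_nonneg l')) (by split_ifs <;> norm_num)
      have hs := single_le_sum (s := range Λ) (f := fun b =>
        (letterTail b (cfRatio l') - letterTail (b + 1) (cfRatio l')) *
          (if b :: l' ∈ ({a :: l'} : Set (List ℕ)) then (1 : ℝ) else 0))
        (fun b _ => mul_nonneg (letterTail_sub_nonneg b (cfRatio_nonneg l'))
          (by split_ifs <;> norm_num)) (mem_range.mpr ha)
      simp only [Set.mem_singleton_iff, if_true, mul_one] at hs hpos ⊢
      rw [letterAvg]
      linarith
    · simp only [Set.mem_singleton_iff, hl, if_false, mul_zero]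
      exact le_letterAvg Λ (cfRatio_nonneg l') fun b => by split_ifs <;> norm_num

lemma historyAvg_drop (Λ : ℕ) {n N : ℕ} (h : n ≤ N) (ψ : List ℕ → ℝ) :
    historyAvg Λ N (fun l => ψ (l.drop (N - n))) = historyAvg Λ n ψ := by
  induction N, h using Nat.le_induction with
  | base => simp
  | succ N h ih =>
    rw [historyAvg, ← ih]
    congr 1
    funext l
    rw [Nat.succ_sub h]
    simp only [List.drop_succ_cons]
    exact letterAvg_const Λ (cfRatio_nonneg l) _

lemma historyProb_drop (Λ : ℕ) {n N : ℕ} (h : n ≤ N) (A : Set (List ℕ)) :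
    historyProb Λ N {l | l.drop (N - n) ∈ A} = historyProb Λ n A := by
  classical
  rw [historyProb, historyProb, ← historyAvg_drop Λ h]
  congr

lemma historyWeight_le_historyProb_suffix {Λ N : ℕ} (l : List ℕ) (h : ∀ a ∈ l, a < Λ)
    (hl : l.length ≤ N) : historyWeight l ≤ historyProb Λ N {L | l <:+ L} := by
  refine (historyWeight_le_historyProb l h).trans ?_
  rw [← historyProb_drop Λ hl]
  refine historyProb_mono Λ N fun L _ hL => ?_
  rw [Set.mem_ofPred_eq, Set.mem_singleton_iff] at hL
  rw [Set.mem_ofPred_eq, ← hL]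
  exact List.drop_suffix _ _

lemma one_le_mul_historyWeight (l : List ℕ) : 1 ≤ 2 * ((cfPair l).1 : ℝ) ^ 2 * historyWeight l := by
  have h : (0 : ℝ) < (cfPair l).1 := by exact_mod_cast cfPair_pos l
  have h2 : ((cfPair l).2 : ℝ) ≤ (cfPair l).1 := by exact_mod_cast cfPair_snd_le l
  rw [historyWeight, mul_one_div, one_le_div (by positivity)]
  nlinarith

lemma sum_sq_suffix_le (L : List ℕ) (T : Finset (List ℕ)) (hT : ∀ l ∈ T, l <:+ L) :
    ∑ l ∈ T, (cfPair l).1 ^ 2 ≤ (cfPair L).1 * ((cfPair L).1 + (cfPair L).2) := by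
  classical
  induction L generalizing T with
  | nil =>
    have : T ⊆ {[]} := fun l hl => by simpa using hT l hl
    exact (sum_le_sum_of_subset this).trans (by simp [cfPair])
  | cons a L ih =>
    have h1 := ih (T.erase (a :: L)) fun l hl => by
      rcases List.suffix_cons_iff.mp (hT l (mem_of_mem_erase hl)) with h | h
      · exact absurd h (ne_of_mem_erase hl)
      · exact h
    have h2 : ∑ l ∈ T, (cfPair l).1 ^ 2 ≤
        ∑ l ∈ T.erase (a :: L), (cfPair l).1 ^ 2 + (cfPair (a :: L)).1 ^ 2 := by
      by_cases h : a :: L ∈ T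
      · rw [sum_erase_add _ _ h]
      · rw [erase_eq_of_notMem h]; omega
    refine h2.trans ?_
    rw [cfPair] at h2 ⊢
    simp only
    nlinarith [Nat.zero_le ((cfPair L).1 * (a * (cfPair L).1))]

lemma sum_sq_suffix_le_of_le {Q : ℕ} (hQ : 1 ≤ Q) (L : List ℕ) (T : Finset (List ℕ))
    (hT : ∀ l ∈ T, l <:+ L) (hq : ∀ l ∈ T, (cfPair l).1 ≤ Q) :
    ∑ l ∈ T, (cfPair l).1 ^ 2 ≤ 2 * Q ^ 2 := by
  induction L with
  | nil =>
    refine (sum_sq_suffix_le [] T hT).trans ?_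
    simp [cfPair]
    nlinarith
  | cons a L ih =>
    by_cases h : a :: L ∈ T
    · refine (sum_sq_suffix_le _ T hT).trans ?_
      have h1 := hq _ h
      have h2 := cfPair_snd_le (a :: L)
      nlinarith
    · refine ih fun l hl => ?_
      rcases List.suffix_cons_iff.mp (hT l hl) with h' | h'
      · exact absurd (h' ▸ hl) h
      · exact h'

/-- A family of reduced fractions whose expansions all force the event `A` is small if `A` is
improbable. -/
lemma card_le_historyProb {Q : ℕ} (hQ : 1 ≤ Q) (B : Finset (ℕ × ℕ)) (hB : B ⊆ fracs Q)
    (A : Set (List ℕ))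
    (hA : ∀ l L : List ℕ, L.length = Q → l <:+ L → ((cfPair l).2, (cfPair l).1) ∈ B → L ∈ A) :
    (B.card : ℝ) ≤ 4 * Q ^ 2 * historyProb Q Q A := by
  classical
  have hex : ∀ p : ℕ × ℕ, ∃ l : List ℕ, p ∈ B → cfPair l = (p.2, p.1) ∧ (∀ b ∈ l, b < Q) ∧
      l.length ≤ Q := by
    intro p
    by_cases hp : p ∈ B
    · have h := hB hp
      simp only [fracs, mem_filter, mem_product, mem_Icc] at h
      obtain ⟨l, hl, hb, hlen⟩ := exists_cfPair_eq p.1 p.2 h.1.1.1 h.2.1 h.2.2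
      exact ⟨l, fun _ => ⟨hl, fun b hb' => (hb b hb').trans_le h.1.2.2, hlen.trans h.1.2.2⟩⟩
    · exact ⟨[], fun h => absurd h hp⟩
  choose e he using hex
  have hinj : Set.InjOn e B := by
    intro p hp p' hp' h
    have h1 := (he p hp).1
    rw [h, (he p' hp').1] at h1
    simp only [Prod.mk.injEq] at h1
    exact Prod.ext h1.2.symm h1.1.symm
  have h1 : (B.card : ℝ) ≤ ∑ p ∈ B, 2 * ((cfPair (e p)).1 : ℝ) ^ 2 * historyProb Q Q {L | e p <:+ L} := by
    rw [card_eq_sum_ones]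
    push_cast
    refine sum_le_sum fun p hp => (one_le_mul_historyWeight (e p)).trans ?_
    exact mul_le_mul_of_nonneg_left
      (historyWeight_le_historyProb_suffix _ (he p hp).2.1 (he p hp).2.2) (by positivity)
  refine h1.trans ?_
  simp only [historyProb, ← historyAvg_mul_left]
  rw [← historyAvg_sum]
  refine historyAvg_mono Q Q fun L hL => ?_
  have h2 : ∑ p ∈ B, 2 * ((cfPair (e p)).1 : ℝ) ^ 2 * (if L ∈ {L | e p <:+ L} then (1 : ℝ) else 0) =
      2 * ((∑ l ∈ (B.filter fun p => e p <:+ L).image e, (cfPair l).1 ^ 2 : ℕ) : ℝ) := by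
    rw [sum_image fun p hp p' hp' => hinj (mem_filter.mp hp).1 (mem_filter.mp hp').1, sum_filter]
    push_cast
    rw [mul_sum]
    refine sum_congr rfl fun p _ => ?_
    by_cases h : e p <:+ L <;> simp [h]
  have h3 := sum_sq_suffix_le_of_le hQ L ((B.filter fun p => e p <:+ L).image e)
    (fun l hl => by
      obtain ⟨p, hp, rfl⟩ := mem_image.mp hl
      exact (mem_filter.mp hp).2)
    (fun l hl => by
      obtain ⟨p, hp, rfl⟩ := mem_image.mp hl
      have hp := (mem_filter.mp hp).1
      rw [(he p hp).1]
      have := hB hp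
      simp only [fracs, mem_filter, mem_product, mem_Icc] at this
      exact this.1.2.2)
  have h3' : ((∑ l ∈ (B.filter fun p => e p <:+ L).image e, (cfPair l).1 ^ 2 : ℕ) : ℝ) ≤
      2 * (Q : ℝ) ^ 2 := by exact_mod_cast h3
  by_cases hLA : L ∈ A
  · rw [if_pos hLA]
    refine le_trans (le_of_eq ?_) ((mul_le_mul_of_nonneg_left h3' zero_le_two).trans (by linarith))
    rw [← h2]
    exact sum_congr rfl fun p _ => by congr
  · rw [if_neg hLA, mul_zero]
    refine sum_nonpos fun p hp => ?_
    have : ¬ e p <:+ L := fun h => hLA (hA (e p) L hL h (by rw [(he p hp).1]; exact hp))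
    simp [this]

lemma cfPair_le_of_suffix {l L : List ℕ} (h : l <:+ L) : (cfPair l).1 ≤ (cfPair L).1 := by
  induction L with
  | nil => rw [List.suffix_nil.mp h]
  | cons a L ih =>
    rcases List.suffix_cons_iff.mp h with rfl | h
    · rfl
    · refine (ih h).trans ?_
      rw [cfPair]
      nlinarith

lemma quotientSum_le_of_suffix {l L : List ℕ} (h : l <:+ L) : quotientSum l ≤ quotientSum L := by
  induction L with
  | nil => rw [List.suffix_nil.mp h]
  | cons a L ih =>
    rcases List.suffix_cons_iff.mp h with rfl | h
    · rfl
    · refine (ih h).trans ?_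
      rw [quotientSum]
      omega

lemma quotientSum_le_of_lt {l l' L : List ℕ} (h : l <:+ L) (h' : l' <:+ L)
    (hlt : (cfPair l).1 < (cfPair l').1) : quotientSum l ≤ quotientSum l' := by
  rcases List.suffix_or_suffix_of_suffix h h' with h | h
  · exact quotientSum_le_of_suffix h
  · exact absurd (cfPair_le_of_suffix h) (not_le.mpr hlt)

lemma sum_inv_sq_le (Q : ℕ) : ∑ d ∈ Icc 2 Q, 1 / (d : ℝ) ^ 2 ≤ 3 / 4 := by
  have key : ∀ n : ℕ, ∑ d ∈ Icc 2 (n + 2), 1 / (d : ℝ) ^ 2 ≤ 3 / 4 - 1 / ((n : ℝ) + 2) := by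
    intro n
    induction n with
    | zero => norm_num
    | succ n ih =>
      rw [show n + 1 + 2 = n + 2 + 1 by ring, sum_Icc_succ_top (by omega)]
      have : 1 / (((n + 2 + 1 : ℕ) : ℝ)) ^ 2 ≤ 1 / ((n : ℝ) + 2) - 1 / (((n + 1 : ℕ) : ℝ) + 2) := by
        push_cast
        rw [div_sub_div _ _ (by positivity) (by positivity), div_le_div_iff₀ (by positivity) (by positivity)]
        nlinarith [(Nat.cast_nonneg n : (0 : ℝ) ≤ n)]
      linarith
  refine (sum_le_sum_of_subset_of_nonneg (Icc_subset_Icc_right (show Q ≤ Q + 2 by omega))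
    fun _ _ _ => by positivity).trans ((key Q).trans ?_)
  have : 0 ≤ 1 / ((Q : ℝ) + 2) := by positivity
  linarith

lemma sq_le_card_fracs (Q : ℕ) : (Q : ℝ) ^ 2 ≤ 8 * (fracs Q).card := by
  have hsub : Icc 1 Q ×ˢ Icc 1 Q ⊆ (fracs Q ∪ (fracs Q).image Prod.swap) ∪
      (Icc 2 Q).biUnion fun d => (Icc 1 Q).filter (d ∣ ·) ×ˢ (Icc 1 Q).filter (d ∣ ·) := by
    rintro ⟨a, b⟩ h
    simp only [mem_product, mem_Icc] at h
    by_cases hc : a.Coprime b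
    · refine mem_union_left _ ?_
      rcases le_total a b with hab | hab
      · refine mem_union_left _ ?_
        simpa [fracs, h, hab] using hc
      · refine mem_union_right _ (mem_image.mpr ⟨(b, a), ?_, rfl⟩)
        simpa [fracs, h, hab] using hc.symm
    · refine mem_union_right _ (mem_biUnion.mpr ⟨a.gcd b, ?_, ?_⟩)
      · have h1 : a.gcd b ≤ a := Nat.gcd_le_left b (by omega)
        have h2 : 0 < a.gcd b := Nat.gcd_pos_of_pos_left b (by omega)
        have h3 : a.gcd b ≠ 1 := hc
        rw [mem_Icc]
        omega
      · simp [h, Nat.gcd_dvd_left, Nat.gcd_dvd_right]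
  have h1 := (card_le_card hsub).trans ((card_union_le _ _).trans (add_le_add
    ((card_union_le _ _).trans (add_le_add le_rfl card_image_le)) card_biUnion_le))
  have h2 : ∀ d : ℕ, ((Icc 1 Q).filter (d ∣ ·)).card = Q / d := fun d =>
    Nat.Ioc_filter_dvd_card_eq_div Q d
  simp only [card_product, Nat.card_Icc, Nat.add_sub_cancel, h2] at h1
  have h3 : (Q : ℝ) * Q ≤ (fracs Q).card + (fracs Q).card + ∑ d ∈ Icc 2 Q, ((Q / d : ℕ) : ℝ) * (Q / d : ℕ) := by
    exact_mod_cast h1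
  have h4 : ∑ d ∈ Icc 2 Q, ((Q / d : ℕ) : ℝ) * (Q / d : ℕ) ≤ Q ^ 2 * (3 / 4) := by
    refine le_trans ?_ (mul_le_mul_of_nonneg_left (sum_inv_sq_le Q) (by positivity))
    rw [mul_sum]
    refine sum_le_sum fun d _ => ?_
    have h5 : ((Q / d : ℕ) : ℝ) ≤ Q / d := Nat.cast_div_le
    calc ((Q / d : ℕ) : ℝ) * (Q / d : ℕ) ≤ (Q / d) * (Q / d) :=
          mul_le_mul h5 h5 (by positivity) (by positivity)
      _ = _ := by ring
  nlinarith

lemma card_small_denominator_le {Q : ℕ} {y : ℝ} (hy : 0 ≤ y) :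
    (((fracs Q).filter fun p => (p.2 : ℝ) ≤ y).card : ℝ) ≤ y ^ 2 := by
  have hsub : ((fracs Q).filter fun p => (p.2 : ℝ) ≤ y) ⊆ Icc 1 ⌊y⌋₊ ×ˢ Icc 1 ⌊y⌋₊ := by
    rintro ⟨a, q⟩ h
    simp only [fracs, mem_filter, mem_product, mem_Icc] at h ⊢
    have := Nat.le_floor h.2
    omega
  have h1 := card_le_card hsub
  simp only [card_product, Nat.card_Icc, Nat.add_sub_cancel] at h1
  have h2 : (((fracs Q).filter fun p => (p.2 : ℝ) ≤ y).card : ℝ) ≤ (⌊y⌋₊ : ℝ) * ⌊y⌋₊ := by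
    exact_mod_cast h1
  have h3 := Nat.floor_le hy
  nlinarith [(Nat.cast_nonneg ⌊y⌋₊ : (0 : ℝ) ≤ ⌊y⌋₊)]

/-- The histories of `n` letters with denominator and quotient sum of the typical size. -/
def typicalSet (lam κ η : ℝ) (n : ℕ) : Set (List ℕ) :=
  {l | |log (cfPair l).1 - lam * n| ≤ η * n ∧
    |quotientSum l - κ * (n * log n)| ≤ η * (n * log n)}

lemma exists_typicalSet_law : ∃ lam κ : ℝ, 0 < lam ∧ 1 ≤ κ ∧ ∀ η : ℝ, 0 < η → ∀ᶠ n : ℕ in atTop,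
    ∀ Λ : ℕ, n ^ 2 ≤ Λ → historyProb Λ n (typicalSet lam κ η n)ᶜ ≤ 2 * η := by
  obtain ⟨lam, hlam, h1⟩ := exists_log_denominator_law
  obtain ⟨κ, hκ, h2⟩ := exists_quotientSum_law
  refine ⟨lam, κ, hlam, hκ, fun η hη => ?_⟩
  filter_upwards [h1 η hη, h2 η hη] with n h1 h2 Λ hΛ
  have h3 := h1 Λ ((Nat.le_self_pow two_ne_zero n).trans hΛ)
  have h4 := h2 Λ hΛ
  refine (historyProb_mono Λ n fun l _ hl => ?_).trans ((historyProb_union_le Λ n _ _).trans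
    ((add_le_add h3 h4).trans_eq (two_mul η).symm))
  by_contra hn
  refine hl ⟨not_lt.mp fun h => hn (Or.inl h), not_lt.mp fun h => hn (Or.inr h)⟩

/-- If the quotient sum of every expansion in `B` lies outside the range spanned by typical
histories of `n₁` and `n₂` letters, then `B` is small. -/
lemma card_le_of_typical {Q n₁ n₂ : ℕ} (hQ : 1 ≤ Q) (h₁ : n₁ ≤ Q) (h₂ : n₂ ≤ Q)
    {A₁ A₂ : Set (List ℕ)} {B : Finset (ℕ × ℕ)} (hB : B ⊆ fracs Q)
    (hA : ∀ l : List ℕ, ((cfPair l).2, (cfPair l).1) ∈ B → ∀ l₁ ∈ A₁, ∀ l₂ ∈ A₂,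
      (cfPair l₁).1 < (cfPair l).1 ∧ (cfPair l).1 < (cfPair l₂).1 ∧
        ¬ (quotientSum l₁ ≤ quotientSum l ∧ quotientSum l ≤ quotientSum l₂)) :
    (B.card : ℝ) ≤ 4 * Q ^ 2 * (historyProb Q n₁ A₁ᶜ + historyProb Q n₂ A₂ᶜ) := by
  refine (card_le_historyProb hQ B hB
    ({L | L.drop (Q - n₁) ∈ A₁ᶜ} ∪ {L | L.drop (Q - n₂) ∈ A₂ᶜ}) ?_).trans ?_
  · intro l L _ hl hlB
    by_contra hn
    rw [Set.mem_union, not_or] at hn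
    have hd₁ : L.drop (Q - n₁) ∈ A₁ := not_not.mp hn.1
    have hd₂ : L.drop (Q - n₂) ∈ A₂ := not_not.mp hn.2
    obtain ⟨g1, g2, g3⟩ := hA l hlB _ hd₁ _ hd₂
    exact g3 ⟨quotientSum_le_of_lt (List.drop_suffix _ _) hl g1,
      quotientSum_le_of_lt hl (List.drop_suffix _ _) g2⟩
  · refine mul_le_mul_of_nonneg_left ((historyProb_union_le _ _ _ _).trans_eq ?_) (by positivity)
    rw [historyProb_drop Q h₁, historyProb_drop Q h₂]

lemma typicalSet_lower {lam κ η δ X : ℝ} (hlam : 0 < lam) (hκ : 1 ≤ κ) (hη : 0 < η)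
    (hη1 : η ≤ 1 / 10) (hδ : δ ≤ η * lam) (hδ' : δ ≤ η) (hX : 0 < X) (hX' : 0 < log X) {n : ℕ}
    (hn : (n : ℝ) ≤ (1 - 2 * η) * X / lam) (hn' : (1 - 3 * η) * X / lam ≤ n)
    (hnlog : (1 - η) * log X ≤ log n) {l : List ℕ} (hl : l ∈ typicalSet lam κ δ n) :
    log (cfPair l).1 < (1 - η) * X ∧
      (κ - η * (5 * κ + 2)) / lam * (X * log X) ≤ quotientSum l := by
  obtain ⟨h1, h2⟩ := hl
  have h3 := (abs_le.mp h1).2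
  have h4 := (abs_le.mp h2).1
  have hn0 : (0 : ℝ) ≤ n := by positivity
  constructor
  · rw [le_div_iff₀ hlam] at hn
    have h5 : δ * n ≤ η * lam * n := mul_le_mul_of_nonneg_right hδ hn0
    have h6 : (1 + η) * (n * lam) ≤ (1 + η) * ((1 - 2 * η) * X) :=
      mul_le_mul_of_nonneg_left hn (by linarith)
    have h7 : 0 < η ^ 2 * X := by positivity
    nlinarith
  · have h5 : (1 - 3 * η) * X / lam * ((1 - η) * log X) ≤ n * log n :=
      mul_le_mul hn' hnlog (mul_nonneg (by linarith) hX'.le) hn0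
    have h6 : 0 ≤ (n : ℝ) * log n := mul_nonneg hn0 (log_natCast_nonneg n)
    have h7 : (κ - η) * ((1 - 3 * η) * X / lam * ((1 - η) * log X)) ≤ (κ - η) * (n * log n) :=
      mul_le_mul_of_nonneg_left h5 (by linarith)
    have h8 : δ * (n * log n) ≤ η * (n * log n) := mul_le_mul_of_nonneg_right hδ' h6
    have h9 : (κ - η * (5 * κ + 2)) / lam * (X * log X) ≤
        (κ - η) * ((1 - 3 * η) * X / lam * ((1 - η) * log X)) := by
      rw [show (κ - η) * ((1 - 3 * η) * X / lam * ((1 - η) * log X)) =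
        ((κ - η) * ((1 - 3 * η) * (1 - η))) / lam * (X * log X) by ring]
      have h10 : κ - η * (5 * κ + 2) ≤ (κ - η) * ((1 - 3 * η) * (1 - η)) := by
        have h11 : (κ - η) * (1 - 4 * η) ≤ (κ - η) * ((1 - 3 * η) * (1 - η)) :=
          mul_le_mul_of_nonneg_left (by nlinarith) (by linarith)
        nlinarith
      gcongr
    linarith

lemma typicalSet_upper {lam κ η δ X : ℝ} (hlam : 0 < lam) (hκ : 1 ≤ κ) (hη : 0 < η)
    (hη1 : η ≤ 1 / 10) (hδ : δ ≤ η * lam) (hδ' : δ ≤ η) (hX : 0 < X) (hX' : 0 < log X) {n : ℕ}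
    (hn : (1 + 2 * η) * X / lam ≤ n) (hn' : n ≤ (1 + 3 * η) * X / lam)
    (hnlog : log n ≤ (1 + η) * log X) {l : List ℕ} (hl : l ∈ typicalSet lam κ δ n) :
    X < log (cfPair l).1 ∧
      quotientSum l ≤ (κ + η * (5 * κ + 2)) / lam * (X * log X) := by
  obtain ⟨h1, h2⟩ := hl
  have h3 := (abs_le.mp h1).1
  have h4 := (abs_le.mp h2).2
  have hn0 : (0 : ℝ) ≤ n := by positivity
  constructor
  · rw [div_le_iff₀ hlam] at hn
    have h5 : δ * n ≤ η * lam * n := mul_le_mul_of_nonneg_right hδ hn0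
    have h6 : (1 - η) * ((1 + 2 * η) * X) ≤ (1 - η) * (n * lam) :=
      mul_le_mul_of_nonneg_left hn (by linarith)
    have h7 : 0 < (η - 2 * η ^ 2) * X := mul_pos (by nlinarith) hX
    nlinarith
  · have h6 : 0 ≤ (n : ℝ) * log n := mul_nonneg hn0 (log_natCast_nonneg n)
    have h5 : n * log n ≤ (1 + 3 * η) * X / lam * ((1 + η) * log X) :=
      mul_le_mul hn' hnlog (log_natCast_nonneg n) (hn0.trans hn')
    have h7 : (κ + η) * (n * log n) ≤ (κ + η) * ((1 + 3 * η) * X / lam * ((1 + η) * log X)) :=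
      mul_le_mul_of_nonneg_left h5 (by linarith)
    have h8 : δ * (n * log n) ≤ η * (n * log n) := mul_le_mul_of_nonneg_right hδ' h6
    have h9 : (κ + η) * ((1 + 3 * η) * X / lam * ((1 + η) * log X)) ≤
        (κ + η * (5 * κ + 2)) / lam * (X * log X) := by
      rw [show (κ + η) * ((1 + 3 * η) * X / lam * ((1 + η) * log X)) =
        ((κ + η) * ((1 + 3 * η) * (1 + η))) / lam * (X * log X) by ring]
      have h10 : (κ + η) * ((1 + 3 * η) * (1 + η)) ≤ κ + η * (5 * κ + 2) := by
        have h11 : (κ + η) * ((1 + 3 * η) * (1 + η)) ≤ (κ + η) * (1 + 5 * η) :=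
          mul_le_mul_of_nonneg_left (by nlinarith) (by linarith)
        nlinarith
      gcongr
    linarith

lemma tendsto_log_natCast : Tendsto (fun Q : ℕ => log (Q : ℝ)) atTop atTop :=
  tendsto_log_atTop.comp tendsto_natCast_atTop_atTop

lemma eventually_mul_log_sq_le (c : ℝ) : ∀ᶠ Q : ℕ in atTop, c * log (Q : ℝ) ^ 2 ≤ Q := by
  have h := (isLittleO_pow_log_id_atTop (n := 2)).comp_tendsto tendsto_natCast_atTop_atTop
  have h2 := h.def (show 0 < (|c| + 1)⁻¹ by positivity)
  filter_upwards [h2] with Q hQ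
  simp only [Function.comp_apply, norm_pow, norm_eq_abs, id, sq_abs, Nat.abs_cast] at hQ
  rw [inv_mul_eq_div, le_div_iff₀ (by positivity)] at hQ
  nlinarith [le_abs_self c, sq_nonneg (log (Q : ℝ))]

set_option maxHeartbeats 1000000 in
lemma exists_eventually_card_exceptional_le : ∃ μ : ℝ, 0 < μ ∧ ∀ ε ε' : ℝ, 0 < ε → 0 < ε' →
    ∀ᶠ Q : ℕ in atTop, (((fracs Q).filter fun p : ℕ × ℕ =>
      ¬ |log (kashaevJ ((p.1 : ℚ) / (p.2 : ℚ))) - μ * log Q * log (log Q)| ≤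
        ε * log Q * log (log Q)).card : ℝ) ≤ ε' * (fracs Q).card := by
  obtain ⟨lam, κ, hlam, hκ, hlaw⟩ := exists_typicalSet_law
  obtain ⟨C, hC, hJ⟩ := exists_abs_log_kashaevJ_sub_quotientSum_le
  have hv := volConst_pos
  have hκ0 : 0 < κ := by linarith
  refine ⟨2 * volConst * κ / lam, by positivity, fun ε ε' hε hε' => ?_⟩
  set D := 1 + 2 * volConst * (5 * κ + 2) / lam with hD
  have hD0 : 0 < D := by positivity
  obtain ⟨η, hη, hη1, hηD, hηε⟩ : ∃ η : ℝ, 0 < η ∧ η ≤ 1 / 10 ∧ η * D ≤ ε ∧ 136 * η ≤ ε' := by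
    refine ⟨min (1 / 10) (min (ε / D) (ε' / 136)), by positivity, min_le_left _ _, ?_, ?_⟩
    · rw [← le_div_iff₀ hD0]
      exact (min_le_right _ _).trans (min_le_left _ _)
    · rw [← le_div_iff₀' (by norm_num)]
      exact (min_le_right _ _).trans (min_le_right _ _)
  obtain ⟨δ, hδ0, hδ, hδ'⟩ : ∃ δ : ℝ, 0 < δ ∧ δ ≤ η * lam ∧ δ ≤ η :=
    ⟨min (η * lam) η, by positivity, min_le_left _ _, min_le_right _ _⟩
  have hscale : ∀ c : ℝ, 0 < c → Tendsto (fun Q : ℕ => c * log (Q : ℝ) / lam) atTop atTop :=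
    fun c hc => (tendsto_log_natCast.const_mul_atTop hc).atTop_div_const hlam
  have hlaw₁ := ((tendsto_nat_floor_atTop (α := ℝ)).comp
    (hscale (1 - 2 * η) (by linarith))).eventually (hlaw δ hδ0)
  have hlaw₂ := ((tendsto_nat_ceil_atTop (α := ℝ)).comp
    (hscale (1 + 2 * η) (by linarith))).eventually (hlaw δ hδ0)
  have hlog := tendsto_log_natCast
  have hloglog := tendsto_log_atTop.comp tendsto_log_natCast
  filter_upwards [hlaw₁, hlaw₂, eventually_ge_atTop 1, eventually_mul_log_sq_le (4 / lam ^ 2),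
    hlog.eventually (eventually_ge_atTop 1), hlog.eventually (eventually_ge_atTop (lam / η)),
    hlog.eventually (eventually_ge_atTop (log (1 / η) / (2 * η))),
    hloglog.eventually (eventually_ge_atTop 1),
    hloglog.eventually (eventually_ge_atTop (log (2 / lam) / η)),
    hloglog.eventually (eventually_ge_atTop (log (2 * lam) / η)),
    hloglog.eventually (eventually_ge_atTop (2 * C / η))]
    with Q hP₁ hP₂ hQ hQsq hX1 hXlam hXη hY1 hY2 hY3 hY4
  simp only [Function.comp_apply] at hP₁ hP₂ hY1 hY2 hY3 hY4
  have hQ0 : (0 : ℝ) < Q := by exact_mod_cast hQ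
  set X := log (Q : ℝ) with hX
  set n₁ := ⌊(1 - 2 * η) * X / lam⌋₊ with hn₁
  set n₂ := ⌈(1 + 2 * η) * X / lam⌉₊ with hn₂
  rw [div_le_iff₀ hη] at hXlam hY2 hY3 hY4
  have hX0 : 0 < X := by linarith
  have hone : 1 ≤ η * X / lam := by
    rw [le_div_iff₀ hlam]
    linarith
  have hpos₁ : 0 ≤ (1 - 2 * η) * X / lam :=
    div_nonneg (mul_nonneg (by linarith) hX0.le) hlam.le
  have hn₁u : (n₁ : ℝ) ≤ (1 - 2 * η) * X / lam := Nat.floor_le hpos₁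
  have hn₁l : (1 - 3 * η) * X / lam ≤ n₁ := by
    have h := Nat.lt_floor_add_one ((1 - 2 * η) * X / lam)
    have e : (1 - 3 * η) * X / lam = (1 - 2 * η) * X / lam - η * X / lam := by ring
    rw [e]
    linarith
  have hn₂l : (1 + 2 * η) * X / lam ≤ n₂ := Nat.le_ceil _
  have hn₂u : (n₂ : ℝ) ≤ (1 + 3 * η) * X / lam := by
    have h := Nat.ceil_lt_add_one (show 0 ≤ (1 + 2 * η) * X / lam by positivity)
    have e : (1 + 3 * η) * X / lam = (1 + 2 * η) * X / lam + η * X / lam := by ring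
    rw [e]
    linarith
  have hn₂2 : (n₂ : ℝ) ≤ 2 / lam * X := by
    refine hn₂u.trans ?_
    rw [div_mul_eq_mul_div]
    gcongr
    linarith
  have hn₁2 : X / (2 * lam) ≤ n₁ := by
    refine le_trans ?_ hn₁l
    rw [div_le_div_iff₀ (by positivity) hlam]
    have : 0 ≤ (1 / 2 - 3 * η) * (X * lam) := mul_nonneg (by linarith) (by positivity)
    linarith
  have hn₁₂ : (n₁ : ℝ) ≤ n₂ := by
    refine hn₁u.trans (le_trans ?_ hn₂l)
    gcongr
    linarith
  have hn₂pos : (0 : ℝ) < n₂ := lt_of_lt_of_le (by positivity) hn₂l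
  have hlog₂ : log n₂ ≤ (1 + η) * log X := by
    have h := log_le_log hn₂pos hn₂2
    rw [log_mul (by positivity) (by positivity)] at h
    linarith
  have hlog₁ : (1 - η) * log X ≤ log n₁ := by
    have h := log_le_log (by positivity) hn₁2
    rw [log_div (by positivity) (by positivity)] at h
    linarith
  have hn₂sq : n₂ ^ 2 ≤ Q := by
    have h : (n₂ : ℝ) ^ 2 ≤ Q := by
      refine (pow_le_pow_left₀ hn₂pos.le hn₂2 2).trans (le_trans (le_of_eq ?_) hQsq)
      ring
    exact_mod_cast h
  have hn₁sq : n₁ ^ 2 ≤ Q := (Nat.pow_le_pow_left (by exact_mod_cast hn₁₂) 2).trans hn₂sq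
  have hYpos : 0 < X * log X := mul_pos hX0 (by linarith)
  set Bad := (fracs Q).filter fun p : ℕ × ℕ =>
    ¬ |log (kashaevJ ((p.1 : ℚ) / (p.2 : ℚ))) - 2 * volConst * κ / lam * X * log X| ≤
      ε * X * log X with hBad
  have hsplit : Bad ⊆ ((fracs Q).filter fun p => (p.2 : ℝ) ≤ exp ((1 - η) * X)) ∪
      Bad.filter fun p => (1 - η) * X ≤ log p.2 := by
    intro p hp
    by_cases h : (1 - η) * X ≤ log p.2
    · exact mem_union_right _ (mem_filter.mpr ⟨hp, h⟩)
    · refine mem_union_left _ (mem_filter.mpr ⟨(mem_filter.mp hp).1, ?_⟩)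
      have hp' := (mem_filter.mp hp).1
      simp only [fracs, mem_filter, mem_product, mem_Icc] at hp'
      rw [← log_le_iff_le_exp (by exact_mod_cast hp'.1.2.1)]
      exact (not_le.mp h).le
  have hsmall := card_small_denominator_le (Q := Q) (exp_nonneg ((1 - η) * X))
  have hexp : exp ((1 - η) * X) ^ 2 ≤ η * (Q : ℝ) ^ 2 := by
    have h1 : exp ((1 - η) * X) ^ 2 = exp X ^ 2 * exp (-(2 * η * X)) := by
      rw [← exp_nat_mul, ← exp_nat_mul, ← exp_add]
      congr 1
      push_cast
      ring
    rw [h1, hX, exp_log hQ0, mul_comm]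
    refine mul_le_mul_of_nonneg_right ?_ (by positivity)
    rw [← le_log_iff_exp_le hη]
    rw [div_le_iff₀ (by positivity), one_div, log_inv] at hXη
    linarith
  have hwin : ((Bad.filter fun p => (1 - η) * X ≤ log p.2).card : ℝ) ≤
      4 * Q ^ 2 * (historyProb Q n₁ (typicalSet lam κ δ n₁)ᶜ +
        historyProb Q n₂ (typicalSet lam κ δ n₂)ᶜ) := by
    refine card_le_of_typical hQ ((Nat.le_self_pow two_ne_zero _).trans hn₁sq)
      ((Nat.le_self_pow two_ne_zero _).trans hn₂sq)
      ((filter_subset _ _).trans (filter_subset _ _)) ?_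
    intro l hl l₁ hl₁ l₂ hl₂
    rw [mem_filter, hBad, mem_filter] at hl
    obtain ⟨⟨hlf, hbad⟩, hlq⟩ := hl
    simp only [fracs, mem_filter, mem_product, mem_Icc] at hlf
    simp only at hbad hlq
    have hlQ : log ((cfPair l).1 : ℝ) ≤ X :=
      log_le_log (by exact_mod_cast cfPair_pos l) (by exact_mod_cast hlf.1.2.2)
    obtain ⟨g1, g2⟩ := typicalSet_lower hlam hκ hη hη1 hδ hδ' hX0 (by linarith) hn₁u hn₁l hlog₁ hl₁
    obtain ⟨g3, g4⟩ := typicalSet_upper hlam hκ hη hη1 hδ hδ' hX0 (by linarith) hn₂l hn₂u hlog₂ hl₂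
    have hlt : ∀ m k : List ℕ, log ((cfPair m).1 : ℝ) < log (cfPair k).1 →
        (cfPair m).1 < (cfPair k).1 := fun m k h => by
      rw [log_lt_log_iff (by exact_mod_cast cfPair_pos m) (by exact_mod_cast cfPair_pos k)] at h
      exact_mod_cast h
    refine ⟨hlt _ _ (g1.trans_le hlq), hlt _ _ (hlQ.trans_lt g3), ?_⟩
    rintro ⟨s1, s2⟩
    apply hbad
    have s1' : (quotientSum l₁ : ℝ) ≤ quotientSum l := by exact_mod_cast s1
    have s2' : (quotientSum l : ℝ) ≤ quotientSum l₂ := by exact_mod_cast s2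
    set S := (quotientSum l : ℝ)
    have hS : |S - κ / lam * (X * log X)| ≤ η * (5 * κ + 2) / lam * (X * log X) := by
      rw [sub_div, sub_mul] at g2
      rw [add_div, add_mul] at g4
      rw [abs_le]
      constructor <;> linarith
    have hJl := hJ l
    have hCX : C * (1 + log ((cfPair l).1 : ℝ)) ≤ η * (X * log X) := by
      have h1 : C * (1 + log ((cfPair l).1 : ℝ)) ≤ C * (2 * X) :=
        mul_le_mul_of_nonneg_left (by linarith) hC.le
      have h2 : 2 * C * X ≤ log X * η * X := mul_le_mul_of_nonneg_right hY4 hX0.le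
      linarith
    have h5 : |2 * volConst * S - 2 * volConst * κ / lam * X * log X| ≤
        2 * volConst * (η * (5 * κ + 2) / lam * (X * log X)) := by
      rw [show 2 * volConst * S - 2 * volConst * κ / lam * X * log X =
        2 * volConst * (S - κ / lam * (X * log X)) by ring, abs_mul,
        abs_of_pos (by positivity : 0 < 2 * volConst)]
      exact mul_le_mul_of_nonneg_left hS (by positivity)
    have h6 : η * (X * log X) + 2 * volConst * (η * (5 * κ + 2) / lam * (X * log X)) =
        η * D * (X * log X) := by rw [hD]; ring
    have h7 : η * D * (X * log X) ≤ ε * (X * log X) := mul_le_mul_of_nonneg_right hηD hYpos.le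
    have h8 := abs_sub_le (log (kashaevJ (((cfPair l).2 : ℚ) / ((cfPair l).1 : ℚ))))
      (2 * volConst * S) (2 * volConst * κ / lam * X * log X)
    linarith
  have hcard : (Bad.card : ℝ) ≤
      (((fracs Q).filter fun p => (p.2 : ℝ) ≤ exp ((1 - η) * X)).card : ℝ) +
      ((Bad.filter fun p => (1 - η) * X ≤ log p.2).card : ℝ) := by
    exact_mod_cast (card_le_card hsplit).trans (card_union_le _ _)
  have hp₁ := hP₁ Q hn₁sq
  have hp₂ := hP₂ Q hn₂sq
  have hQ2 : (0 : ℝ) < (Q : ℝ) ^ 2 := by positivity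
  have hfin : 4 * (Q : ℝ) ^ 2 * (historyProb Q n₁ (typicalSet lam κ δ n₁)ᶜ +
        historyProb Q n₂ (typicalSet lam κ δ n₂)ᶜ) ≤ 4 * (Q : ℝ) ^ 2 * (4 * η) :=
    mul_le_mul_of_nonneg_left (by linarith) (by positivity)
  have hfr := sq_le_card_fracs Q
  have hend : 17 * η * (Q : ℝ) ^ 2 ≤ 17 * η * (8 * (fracs Q).card) :=
    mul_le_mul_of_nonneg_left hfr (by positivity)
  have hend2 : 136 * η * ((fracs Q).card : ℝ) ≤ ε' * (fracs Q).card :=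
    mul_le_mul_of_nonneg_right hηε (by positivity)
  linarith

/-- There is `μ > 0` such that `log J(x) ∼ μ (log Q) log log Q` for a proportion
`1 - o(1)` of the fractions `x ∈ (0,1] ∩ ℚ` of reduced denominator at most `Q`. -/
theorem kashaev_log_law_of_large_numbers :
    ∃ μ : ℝ, 0 < μ ∧ ∀ ε : ℝ, 0 < ε →
      Tendsto (fun Q : ℕ =>
          (((fracs Q).filter (fun p : ℕ × ℕ =>
              |Real.log (kashaevJ ((p.1 : ℚ) / (p.2 : ℚ))) -
                  μ * Real.log Q * Real.log (Real.log Q)| ≤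
                ε * Real.log Q * Real.log (Real.log Q))).card : ℝ) / ((fracs Q).card : ℝ))
        atTop (nhds 1) := by
  obtain ⟨μ, hμ, h⟩ := exists_eventually_card_exceptional_le
  refine ⟨μ, hμ, fun ε hε => ?_⟩
  rw [Metric.tendsto_atTop']
  intro ε' hε'
  obtain ⟨N, hN⟩ := eventually_atTop.mp ((h ε (ε' / 2) hε (by positivity)).and
    (eventually_ge_atTop 1))
  refine ⟨N, fun Q hQ => ?_⟩
  obtain ⟨hb, hQ1⟩ := hN Q hQ.le
  have hpos : (0 : ℝ) < (fracs Q).card := by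
    have h1 := sq_le_card_fracs Q
    have h2 : (0 : ℝ) < (Q : ℝ) ^ 2 := by
      have : (0 : ℝ) < Q := by exact_mod_cast hQ1
      positivity
    linarith
  have hsum := card_filter_add_card_filter_not (s := fracs Q) fun p : ℕ × ℕ =>
    |log (kashaevJ ((p.1 : ℚ) / (p.2 : ℚ))) - μ * log Q * log (log Q)| ≤ ε * log Q * log (log Q)
  rw [← Nat.cast_inj (R := ℝ), Nat.cast_add] at hsum
  rw [dist_eq, div_sub_one hpos.ne', abs_div, abs_of_pos hpos, div_lt_iff₀ hpos, abs_lt]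
  have h0 : 0 < ε' / 2 * (fracs Q).card := by positivity
  constructor
  · linarith
  · have : (0 : ℝ) ≤ (((fracs Q).filter fun p : ℕ × ℕ =>
      ¬ |log (kashaevJ ((p.1 : ℚ) / (p.2 : ℚ))) - μ * log Q * log (log Q)| ≤
        ε * log Q * log (log Q)).card : ℝ) := Nat.cast_nonneg _
    linarith
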